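/- Let s > 1 and R = R_s. For t ∈ ℕ write t = 11ℓ + r with 0 ≤ r ≤ 10, set n = 6 and m = ⌊r/2⌋, and read all congruences mod s. Then dim_K HH^t(R) = 1 if one of the following holds: (1) r ∈ {0,6,7,8}, ℓn+m≡0, ℓ even; (2) r ∈ {0,6}, ℓn+m≡1, ℓ even, char K = 3; (3) r ∈ {1,9}, ℓn+m≡0; (4) r ∈ {2,4,10}, ℓn+m≡1, ℓ odd; (5) r = 3, ℓn+m≡0, ℓ even, char K = 2; (6) r = 3, ℓn+m≡0, ℓ odd; (7) r ∈ {4,10}, ℓn+m≡0, ℓ odd, char K = 3; (8) r = 4, ℓn+m≡1, ℓ even, char K = 2; (9) r = 5, ℓn+m≡0, char K = 3; (10) r ∈ {6,7}, ℓn+m≡0, ℓ odd, char K = 2. In all other cases dim_K HH^t(R) = 0. -/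

import Mathlib

open scoped TensorProduct

set_option synthInstance.maxHeartbeats 1000000
set_option maxHeartbeats 2000000

universe u v

namespace E6

/-- Generators of the presentation of the path algebra of the quiver `𝒬ₛ`:
trivial paths `e i`, arrows `a i` (the `αᵢ`), `b i` (the `βᵢ`) and `g i` (the `γᵢ`). -/
inductive Gen (s : ℕ) : Type
  | e (i : ZMod (6 * s))
  | a (i : ZMod (3 * s))
  | b (i : ZMod (3 * s))
  | g (i : ZMod s)

variable (K : Type u) [Field K] (s : ℕ)

/-- The free algebra on the generators. -/
abbrev F : Type u := FreeAlgebra K (Gen s)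

/-- Trivial path generators. -/
noncomputable def E (i : ZMod (6 * s)) : F K s := FreeAlgebra.ι K (Gen.e i)
/-- `α` arrow generators. -/
noncomputable def A (i : ZMod (3 * s)) : F K s := FreeAlgebra.ι K (Gen.a i)
/-- `β` arrow generators. -/
noncomputable def B (i : ZMod (3 * s)) : F K s := FreeAlgebra.ι K (Gen.b i)
/-- `γ` arrow generators. -/
noncomputable def G (i : ZMod s) : F K s := FreeAlgebra.ι K (Gen.g i)

/-- Source vertex of the arrow `αᵢ` : writing `i = 3t + j` with `j < 3`,
`α_{3t} : 6t → 6t+1`, `α_{3t+1} : 6t+1 → 6t+2`, `α_{3t+2} : 6t+2 → 6t+5`. -/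
def aSrc (i : ZMod (3 * s)) : ZMod (6 * s) := ((2 * i.val - i.val % 3 : ℕ) : ZMod (6 * s))

/-- Target vertex of the arrow `αᵢ`. -/
def aTgt (i : ZMod (3 * s)) : ZMod (6 * s) :=
  if i.val % 3 = 1 then ((2 * i.val : ℕ) : ZMod (6 * s)) else ((2 * i.val + 1 : ℕ) : ZMod (6 * s))

/-- Source vertex of the arrow `βᵢ` : `β_{3t} : 6t → 6t+3`, `β_{3t+1} : 6t+3 → 6t+4`,
`β_{3t+2} : 6t+4 → 6t+5`. -/
def bSrc (i : ZMod (3 * s)) : ZMod (6 * s) :=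
  if i.val % 3 = 1 then ((2 * i.val + 1 : ℕ) : ZMod (6 * s)) else ((2 * i.val : ℕ) : ZMod (6 * s))

/-- Target vertex of the arrow `βᵢ`. -/
def bTgt (i : ZMod (3 * s)) : ZMod (6 * s) := ((2 * i.val + 3 - i.val % 3 : ℕ) : ZMod (6 * s))

/-- Source vertex of the arrow `γₜ : 6t+5 → 6t+6`. -/
def gSrc (i : ZMod s) : ZMod (6 * s) := ((6 * i.val + 5 : ℕ) : ZMod (6 * s))

/-- Target vertex of the arrow `γₜ`. -/
def gTgt (i : ZMod s) : ZMod (6 * s) := ((6 * i.val + 6 : ℕ) : ZMod (6 * s))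

/-- The set of arrow generators inside the free algebra. -/
noncomputable def arrows : Set (F K s) :=
  Set.range (A K s) ∪ Set.range (B K s) ∪ Set.range (G K s)

/-- The relations presenting `R_s = K[𝒬ₛ]/I₀` as a quotient of the free algebra on the
trivial paths and the arrows.  The first eight families of relations present the path
algebra `K[𝒬ₛ]` (the trivial paths are orthogonal idempotents summing to `1`, and each
arrow is fixed by multiplication with the trivial paths at its target, resp. source);
the remaining relations generate the ideal `I₀`: all paths of length `5` vanish
(equivalently, all products of five arrows), `α_{3t+2}α_{3t+1}α_{3t} = β_{3t+2}β_{3t+1}β_{3t}`,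
and `α_{3t+3}γ_tβ_{3t+2} = 0 = β_{3t+3}γ_tα_{3t+2}`. -/
inductive Rel : F K s → F K s → Prop
  | idem (i j : ZMod (6 * s)) :
      Rel (E K s i * E K s j) (if i = j then E K s i else 0)
  | sum_one :
      Rel (∑ i ∈ Finset.range (6 * s), E K s (i : ZMod (6 * s))) 1
  | a_tgt (i : ZMod (3 * s)) : Rel (E K s (aTgt s i) * A K s i) (A K s i)
  | a_src (i : ZMod (3 * s)) : Rel (A K s i * E K s (aSrc s i)) (A K s i)
  | b_tgt (i : ZMod (3 * s)) : Rel (E K s (bTgt s i) * B K s i) (B K s i)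
  | b_src (i : ZMod (3 * s)) : Rel (B K s i * E K s (bSrc s i)) (B K s i)
  | g_tgt (i : ZMod s) : Rel (E K s (gTgt s i) * G K s i) (G K s i)
  | g_src (i : ZMod s) : Rel (G K s i * E K s (gSrc s i)) (G K s i)
  | len5 (x₁ x₂ x₃ x₄ x₅ : F K s) (h₁ : x₁ ∈ arrows K s) (h₂ : x₂ ∈ arrows K s)
      (h₃ : x₃ ∈ arrows K s) (h₄ : x₄ ∈ arrows K s) (h₅ : x₅ ∈ arrows K s) :
      Rel (x₁ * x₂ * x₃ * x₄ * x₅) 0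
  | comm (t : Fin s) :
      Rel (A K s ((3 * (t : ℕ) + 2 : ℕ) : ZMod (3 * s)) *
             A K s ((3 * (t : ℕ) + 1 : ℕ) : ZMod (3 * s)) *
             A K s ((3 * (t : ℕ) : ℕ) : ZMod (3 * s)))
          (B K s ((3 * (t : ℕ) + 2 : ℕ) : ZMod (3 * s)) *
             B K s ((3 * (t : ℕ) + 1 : ℕ) : ZMod (3 * s)) *
             B K s ((3 * (t : ℕ) : ℕ) : ZMod (3 * s)))
  | zero_agb (t : Fin s) :
      Rel (A K s ((3 * (t : ℕ) + 3 : ℕ) : ZMod (3 * s)) * G K s (((t : ℕ) : ℕ) : ZMod s) *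
             B K s ((3 * (t : ℕ) + 2 : ℕ) : ZMod (3 * s))) 0
  | zero_bga (t : Fin s) :
      Rel (B K s ((3 * (t : ℕ) + 3 : ℕ) : ZMod (3 * s)) * G K s (((t : ℕ) : ℕ) : ZMod s) *
             A K s ((3 * (t : ℕ) + 2 : ℕ) : ZMod (3 * s))) 0

/-- The self-injective algebra `R_s` of tree class `E₆`, i.e. the quotient
`K[𝒬ₛ]/I₀` of the path algebra of `𝒬ₛ`, presented by generators and relations. -/
abbrev Alg : Type u := RingQuot (Rel K s)

/-- A canonical `Semiring` instance on `R_s`, routed through the `Ring` structure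
(this keeps instance paths on `R_s` coherent). -/
noncomputable instance (priority := 1100) : Semiring (Alg K s) :=
  Ring.toSemiring

/-- The images `e_i` in `R_s` of the trivial paths. -/
noncomputable def ee (i : ZMod (6 * s)) : Alg K s :=
  RingQuot.mkAlgHom K (Rel K s) (E K s i)

/-- The images `α_i` in `R_s` of the arrows `α`. -/
noncomputable def aa (i : ZMod (3 * s)) : Alg K s :=
  RingQuot.mkAlgHom K (Rel K s) (A K s i)

/-- The images `β_i` in `R_s` of the arrows `β`. -/
noncomputable def bb (i : ZMod (3 * s)) : Alg K s :=
  RingQuot.mkAlgHom K (Rel K s) (B K s i)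

/-- The images `γ_i` in `R_s` of the arrows `γ`. -/
noncomputable def gg (i : ZMod s) : Alg K s :=
  RingQuot.mkAlgHom K (Rel K s) (G K s i)

/-! ### The enveloping algebra `Λ = R ⊗ₖ Rᵐᵒᵖ` and the outer bimodule structure on `R` -/

/-- The enveloping algebra `Λ = R_s ⊗[K] R_sᵐᵒᵖ`. -/
abbrev Env : Type u := Alg K s ⊗[K] (Alg K s)ᵐᵒᵖ

/-- A canonical `Semiring` instance on `Λ`, routed through the `Ring` structure
(this keeps instance paths on `Λ` coherent). -/
noncomputable instance (priority := 1100) : Semiring (Env K s) :=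
  Ring.toSemiring

/-- `R_s` is a left `Λ`-module via the outer action `(a ⊗ b) • r = a * r * b.unop`. -/
noncomputable instance : Module (Env K s) (Alg K s) :=
  TensorProduct.Algebra.module


instance : SMulCommClass (Env K s) K (Alg K s) where
  smul_comm l k r := by
    induction l using TensorProduct.induction_on with
    | zero => simp
    | tmul a b =>
        show a • b • (k • r) = k • (a • b • r)
        rw [smul_comm b k r, smul_comm a k (b • r)]
    | add x y hx hy =>
        rw [add_smul, add_smul, smul_add, hx, hy]

instance : IsScalarTower K (Env K s) (Alg K s) where
  smul_assoc k l r := by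
    induction l using TensorProduct.induction_on with
    | zero => simp
    | tmul a b =>
        show ((k • a) ⊗ₜ[K] b) • r = k • (a ⊗ₜ[K] b) • r
        show (k • a) • b • r = k • (a • (b • r))
        rw [smul_assoc]
    | add x y hx hy =>
        rw [smul_add, add_smul, add_smul, hx, hy, smul_add]

/-! ### Projective and simple modules -/

/-- The quotient of a module by a submodule (as a type). -/
def modQuot {R : Type v} [Ring R] {M : Type*} [AddCommGroup M] [Module R M]
    (p : Submodule R M) : Type _ := M ⧸ p

noncomputable instance {R : Type v} [Ring R] {M : Type*} [AddCommGroup M] [Module R M]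
    (p : Submodule R M) : AddCommGroup (modQuot p) :=
  inferInstanceAs (AddCommGroup (M ⧸ p))

noncomputable instance {R : Type v} [Ring R] {M : Type*} [AddCommGroup M] [Module R M]
    (p : Submodule R M) : Module R (modQuot p) :=
  inferInstanceAs (Module R (M ⧸ p))

/-- Right multiplication by a fixed element, as an endomorphism of the left regular module. -/
def rmul (Λ : Type v) [Ring Λ] (x : Λ) : Λ →ₗ[Λ] Λ where
  toFun y := y * x
  map_add' a b := add_mul a b x
  map_smul' r a := mul_assoc r a x

/-- The Jacobson radical of the ring `Λ` times the `Λ`-module `M`, i.e. the submodule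
`rad(Λ)·M` generated by all products `r • x` with `r` in the Jacobson radical of `Λ`
(the Jacobson radical being the intersection of all maximal left ideals). -/
def radSMul (Λ : Type v) [Ring Λ] (M : Type w) [AddCommGroup M] [Module Λ M] :
    Submodule Λ M :=
  Submodule.span Λ {z | ∃ r ∈ (⊥ : Ideal Λ).jacobson, ∃ x : M, z = r • x}

/-- The indecomposable projective left `R_s`-module `P_i = R_s·e_i`. -/
noncomputable def P (i : ZMod (6 * s)) : Submodule (Alg K s) (Alg K s) :=
  LinearMap.range (rmul (Alg K s) (ee K s i))

/-- The simple left `R_s`-module `S_i = P_i / rad(P_i)` at the vertex `i`. -/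
noncomputable def S (i : ZMod (6 * s)) : Type u :=
  modQuot (radSMul (Alg K s) ↥(P K s i))

noncomputable instance (i : ZMod (6 * s)) : AddCommGroup (S K s i) :=
  inferInstanceAs (AddCommGroup (modQuot (radSMul (Alg K s) ↥(P K s i))))

noncomputable instance (i : ZMod (6 * s)) : Module (Alg K s) (S K s i) :=
  inferInstanceAs (Module (Alg K s) (modQuot (radSMul (Alg K s) ↥(P K s i))))

/-- The canonical projection `P_i → S_i`. -/
noncomputable def toS (i : ZMod (6 * s)) : ↥(P K s i) →ₗ[Alg K s] S K s i :=
  (radSMul (Alg K s) ↥(P K s i)).mkQ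

/-- Corestriction of right multiplication by `e_i` to `P_i`. -/
noncomputable def toP (i : ZMod (6 * s)) : Alg K s →ₗ[Alg K s] ↥(P K s i) :=
  LinearMap.codRestrict (P K s i) (rmul (Alg K s) (ee K s i))
    (fun c => LinearMap.mem_range_self _ c)

/-- The homomorphism `P_j → P_i` given by right multiplication with (the class of)
a path `w` from vertex `i` to vertex `j`; concretely it is `x ↦ x * w * e_i`, which
for an actual path `w` from `i` to `j` (so that `w * e_i = w` holds in `R_s`) is just
right multiplication `x ↦ x * w`. -/
noncomputable def pmul (i j : ZMod (6 * s)) (w : Alg K s) :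
    ↥(P K s j) →ₗ[Alg K s] ↥(P K s i) :=
  (toP K s i).comp ((rmul (Alg K s) w).comp (P K s j).subtype)

/-- `α`-arrows of `R_s`, indexed by natural numbers. -/
noncomputable def aN (k : ℕ) : Alg K s := aa K s ((k : ℕ) : ZMod (3 * s))

/-- `β`-arrows of `R_s`, indexed by natural numbers. -/
noncomputable def bN (k : ℕ) : Alg K s := bb K s ((k : ℕ) : ZMod (3 * s))

/-- `γ`-arrows of `R_s`, indexed by natural numbers. -/
noncomputable def gN (k : ℕ) : Alg K s := gg K s ((k : ℕ) : ZMod s)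

/-- The homomorphism `P_j → P_i` (vertices given by natural numbers, taken mod `6s`)
induced by right multiplication with `w`. -/
noncomputable def pmulN (i j : ℕ) (w : Alg K s) :
    ↥(P K s ((j : ℕ) : ZMod (6 * s))) →ₗ[Alg K s] ↥(P K s ((i : ℕ) : ZMod (6 * s))) :=
  pmul K s ((i : ℕ) : ZMod (6 * s)) ((j : ℕ) : ZMod (6 * s)) w

/-- The canonical projection `P_i → S_i` (vertex given by a natural number). -/
noncomputable def toSN (i : ℕ) :
    ↥(P K s ((i : ℕ) : ZMod (6 * s))) →ₗ[Alg K s] S K s ((i : ℕ) : ZMod (6 * s)) :=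
  toS K s ((i : ℕ) : ZMod (6 * s))

/-- The simple module `S_i`, for a vertex given by a natural number. -/
noncomputable def SN (i : ℕ) : Type u := S K s ((i : ℕ) : ZMod (6 * s))

noncomputable instance (i : ℕ) : AddCommGroup (SN K s i) :=
  inferInstanceAs (AddCommGroup (S K s ((i : ℕ) : ZMod (6 * s))))

noncomputable instance (i : ℕ) : Module (Alg K s) (SN K s i) :=
  inferInstanceAs (Module (Alg K s) (S K s ((i : ℕ) : ZMod (6 * s))))

/-! ### Projective resolutions, minimality and syzygies -/

/-- A projective resolution `⋯ → Q 1 → Q 0 → M → 0` of a module `M` over a ring `Λ`. -/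
structure ProjRes (Λ : Type v) [Ring Λ] (M : Type w) [AddCommGroup M] [Module Λ M] where
  /-- The terms of the resolution. -/
  Q : ℕ → Type v
  [acg : ∀ n, AddCommGroup (Q n)]
  [mod : ∀ n, Module Λ (Q n)]
  proj : ∀ n, Module.Projective Λ (Q n)
  /-- The differentials. -/
  d : ∀ n, Q (n + 1) →ₗ[Λ] Q n
  /-- The augmentation. -/
  ε : Q 0 →ₗ[Λ] M
  surj : Function.Surjective ε
  exact₀ : LinearMap.range (d 0) = LinearMap.ker ε
  exact : ∀ n, LinearMap.range (d (n + 1)) = LinearMap.ker (d n)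

attribute [instance] ProjRes.acg ProjRes.mod

/-- A projective resolution is minimal if the image of every differential lies in
`rad(Λ)` times the target. -/
def ProjRes.Minimal {Λ : Type v} [Ring Λ] {M : Type w} [AddCommGroup M]
    [Module Λ M] (res : ProjRes Λ M) : Prop :=
  ∀ n, LinearMap.range (res.d n) ≤ radSMul Λ (res.Q n)

/-- `Ω^p(M) ≅ N` : the `p`-th syzygy of `M` with respect to the projective resolution
`res` is isomorphic to `N` (stated for `p ≥ 1`; here `Ω¹ = ker ε` and
`Ω^p = ker (d (p-2))` for `p ≥ 2`). -/
def ProjRes.SyzygyIso {Λ : Type v} [Ring Λ] {M : Type w} [AddCommGroup M]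
    [Module Λ M] (res : ProjRes Λ M) (p : ℕ) (N : Type*) [AddCommGroup N]
    [Module Λ N] : Prop :=
  (p = 1 ∧ Nonempty (↥(LinearMap.ker res.ε) ≃ₗ[Λ] N)) ∨
  (2 ≤ p ∧ Nonempty (↥(LinearMap.ker (res.d (p - 2))) ≃ₗ[Λ] N))

/-! ### The automorphisms `σ` and `τ`, and twisted bimodules -/

/-- The defining property of the algebra automorphism `σ` of `R_s` :
`σ(e_i) = e_{i+36}` for `i ≡ 0,5 (mod 6)`, `σ(e_i) = e_{i+38}` for `i ≡ 1,2 (mod 6)`,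
`σ(e_i) = e_{i+34}` for `i ≡ 3,4 (mod 6)`; `σ(γ_i) = -γ_{i+6}`;
`σ(α_i) = -β_{i+18}` for `i ≡ 0,1 (mod 3)` and `σ(α_i) = β_{i+18}` for `i ≡ 2 (mod 3)`;
`σ(β_i) = -α_{i+18}` for `i ≡ 1,2 (mod 3)` and `σ(β_i) = α_{i+18}` for `i ≡ 0 (mod 3)`. -/
noncomputable def IsSigma (σ : Alg K s ≃ₐ[K] Alg K s) : Prop :=
  (∀ i : ZMod (6 * s), σ (ee K s i) =
      if i.val % 6 = 0 ∨ i.val % 6 = 5 then ee K s (i + 36)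
      else if i.val % 6 = 1 ∨ i.val % 6 = 2 then ee K s (i + 38)
      else ee K s (i + 34)) ∧
  (∀ i : ZMod s, σ (gg K s i) = -gg K s (i + 6)) ∧
  (∀ i : ZMod (3 * s), σ (aa K s i) =
      if i.val % 3 = 2 then bb K s (i + 18) else -bb K s (i + 18)) ∧
  (∀ i : ZMod (3 * s), σ (bb K s i) =
      if i.val % 3 = 0 then aa K s (i + 18) else -aa K s (i + 18))

/-- The underlying type of the twisted bimodule `₁R_σ` : the linear space `R_s` with
the ordinary left action of `R_s` and the right action twisted by `σ`. -/
def Twisted (_σ : Alg K s ≃ₐ[K] Alg K s) : Type u := Alg K s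

variable {K s} in
/-- The identity map `R_s → ₁R_σ`. -/
def Twisted.mk (σ : Alg K s ≃ₐ[K] Alg K s) (x : Alg K s) : Twisted K s σ := x

variable {K s} in
/-- The identity map `₁R_σ → R_s`. -/
def Twisted.un (σ : Alg K s ≃ₐ[K] Alg K s) (x : Twisted K s σ) : Alg K s := x

section TwistedInstances

variable (σ : Alg K s ≃ₐ[K] Alg K s)

noncomputable instance : AddCommGroup (Twisted K s σ) :=
  inferInstanceAs (AddCommGroup (Alg K s))

noncomputable instance : Module K (Twisted K s σ) :=
  inferInstanceAs (Module K (Alg K s))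

noncomputable instance : Module (Alg K s) (Twisted K s σ) :=
  inferInstanceAs (Module (Alg K s) (Alg K s))

/-- The right action on `₁R_σ` : `(op b) • m = m * σ(b)`. -/
noncomputable instance : Module (Alg K s)ᵐᵒᵖ (Twisted K s σ) :=
  Module.compHom (Alg K s) (RingHom.op (σ : Alg K s →+* Alg K s))

variable {K s σ} in
theorem Twisted.op_smul_def (b : (Alg K s)ᵐᵒᵖ) (m : Twisted K s σ) :
    b • m = Twisted.mk σ (Twisted.un σ m * σ b.unop) :=
  rfl

noncomputable instance : IsScalarTower K (Alg K s) (Twisted K s σ) :=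
  inferInstanceAs (IsScalarTower K (Alg K s) (Alg K s))

noncomputable instance : IsScalarTower K (Alg K s)ᵐᵒᵖ (Twisted K s σ) where
  smul_assoc k b m := by
    rw [Twisted.op_smul_def, Twisted.op_smul_def, MulOpposite.unop_smul, map_smul]
    show Twisted.un σ m * k • σ b.unop = k • (Twisted.un σ m * σ b.unop)
    rw [mul_smul_comm]

noncomputable instance : SMulCommClass (Alg K s) (Alg K s)ᵐᵒᵖ (Twisted K s σ) where
  smul_comm a b m := by
    rw [Twisted.op_smul_def]
    show Twisted.mk σ (a * (Twisted.un σ m * σ b.unop)) =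
      b • Twisted.mk σ (a * Twisted.un σ m)
    rw [Twisted.op_smul_def]
    show Twisted.mk σ (a * (Twisted.un σ m * σ b.unop)) =
      Twisted.mk σ ((a * Twisted.un σ m) * σ b.unop)
    rw [mul_assoc]

/-- The twisted bimodule `₁R_σ` as a module over the enveloping algebra `Λ`. -/
noncomputable instance : Module (Env K s) (Twisted K s σ) :=
  TensorProduct.Algebra.module

end TwistedInstances

/-- The defining property of the automorphism `τ` of `R_s` : `τ` fixes all `e_i`
and all `γ_i`, and `τ(α_i) = -α_i`, `τ(β_i) = -β_i` for `i ≡ 0,2 (mod 3)` while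
`τ(α_i) = α_i`, `τ(β_i) = β_i` for `i ≡ 1 (mod 3)`. -/
noncomputable def IsTau (τ : Alg K s ≃ₐ[K] Alg K s) : Prop :=
  (∀ i : ZMod (6 * s), τ (ee K s i) = ee K s i) ∧
  (∀ i : ZMod s, τ (gg K s i) = gg K s i) ∧
  (∀ i : ZMod (3 * s), τ (aa K s i) =
      if i.val % 3 = 1 then aa K s i else -aa K s i) ∧
  (∀ i : ZMod (3 * s), τ (bb K s i) =
      if i.val % 3 = 1 then bb K s i else -bb K s i)


/-- The `t`-th Hochschild cohomology group `HH^t(R_s) = Ext_Λ^t(R_s, R_s)` of `R_s`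
with coefficients in `R_s`, where `Λ = R_s ⊗ₖ R_sᵐᵒᵖ` is the enveloping algebra. -/
noncomputable def HH (K : Type u) [Field K] (s t : ℕ) : ModuleCat.{u} K :=
  ((Ext K (ModuleCat.{u} (Env K s)) t).obj
      (Opposite.op (ModuleCat.of (Env K s) (Alg K s)))).obj
    (ModuleCat.of (Env K s) (Alg K s))

/-- The dimensions of `HH^t(R_s)` for `s > 1`, as stated (`p` = characteristic of `K`). -/
def hhDim (p s t : ℕ) : ℕ :=
  let L := t / 11
  let r := t % 11
  let m := r / 2
  let c0 : Bool := (6 * L + m) % s == 0 % s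
  let c1 : Bool := (6 * L + m) % s == 1 % s
  let ev : Bool := L % 2 == 0
  if ((r == 0 || r == 6 || r == 7 || r == 8) && c0 && ev) ||
      ((r == 0 || r == 6) && c1 && ev && p == 3) ||
      ((r == 1 || r == 9) && c0) ||
      ((r == 2 || r == 4 || r == 10) && c1 && !ev) ||
      (r == 3 && c0 && ev && p == 2) ||
      (r == 3 && c0 && !ev) ||
      ((r == 4 || r == 10) && c0 && !ev && p == 3) ||
      (r == 4 && c1 && ev && p == 2) ||
      (r == 5 && c0 && p == 3) ||
      ((r == 6 || r == 7) && c0 && !ev && p == 2) then 1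
  else 0

end E6

namespace E6

section Homological

open CategoryTheory

theorem finrank_homology_eq {K : Type u} [Field K] (S : ShortComplex (ModuleCat.{u} K))
    {C : Type*} [AddCommGroup C] [Module K C] (e : S.X₂ ≃ₗ[K] C) (Z B : Submodule K C)
    (hZ : ∀ x, S.g.hom x = 0 ↔ e x ∈ Z) (hB : ∀ x, (∃ y, S.f.hom y = x) ↔ e x ∈ B) :
    Module.finrank K S.homology = Module.finrank K (Z ⧸ B.submoduleOf Z) := by
  have h1 := (S.moduleCatHomologyIso.toLinearEquiv).finrank_eq
  rw [h1]
  have hmap : (LinearMap.ker S.g.hom).map (e : S.X₂ →ₗ[K] C) = Z := by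
    ext c
    constructor
    · rintro ⟨x, hx, rfl⟩
      exact (hZ x).1 hx
    · intro hc
      exact ⟨e.symm c, (hZ _).2 (by simpa using hc), by simp⟩
  let e' : LinearMap.ker S.g.hom ≃ₗ[K] Z := e.ofSubmodules _ _ hmap
  refine LinearEquiv.finrank_eq (Submodule.Quotient.equiv _ _ e' ?_)
  ext z
  constructor
  · rintro ⟨x, ⟨y, rfl⟩, rfl⟩
    exact (hB _).1 ⟨y, rfl⟩
  · intro hz
    obtain ⟨y, hy⟩ := (hB (e.symm z)).2 (by
      rw [e.apply_symm_apply]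
      exact hz)
    refine ⟨S.moduleCatToCycles y, ⟨y, rfl⟩, ?_⟩
    apply Subtype.ext
    change e (S.f.hom y) = z
    rw [hy]
    simp

variable {Λ : Type u} [Ring Λ] {M : Type u} [AddCommGroup M] [Module Λ M]

theorem ProjRes.d_comp_d (res : ProjRes.{u, u} Λ M) (n : ℕ) :
    res.d n ∘ₗ res.d (n + 1) = 0 := by
  ext x
  have : res.d (n + 1) x ∈ LinearMap.ker (res.d n) := by
    rw [← res.exact n]; exact ⟨x, rfl⟩
  exact this

theorem ProjRes.ε_comp_d (res : ProjRes.{u, u} Λ M) : res.ε ∘ₗ res.d 0 = 0 := by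
  ext x
  have : res.d 0 x ∈ LinearMap.ker res.ε := by
    rw [← res.exact₀]; exact ⟨x, rfl⟩
  exact this

/-- The chain complex in the category of modules underlying a projective resolution. -/
noncomputable def ProjRes.chain (res : ProjRes.{u, u} Λ M) : ChainComplex (ModuleCat.{u} Λ) ℕ :=
  ChainComplex.of (fun n => ModuleCat.of Λ (res.Q n)) (fun n => ModuleCat.ofHom (res.d n))
    (fun n => by
      rw [← ModuleCat.ofHom_comp, res.d_comp_d]
      rfl)

theorem ProjRes.chain_d (res : ProjRes.{u, u} Λ M) (n : ℕ) :
    res.chain.d (n + 1) n = ModuleCat.ofHom (res.d n) :=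
  ChainComplex.of_d (fun n => ModuleCat.of Λ (res.Q n)) (fun n => ModuleCat.ofHom (res.d n)) n

/-- A `ProjRes` as a projective resolution in the category of modules. -/
noncomputable def ProjRes.toResolution (res : ProjRes.{u, u} Λ M) :
    ProjectiveResolution (ModuleCat.of Λ M) where
  complex := res.chain
  projective n := by
    have := res.proj n
    exact (inferInstance : Projective (ModuleCat.of Λ (res.Q n)))
  π := (ChainComplex.toSingle₀Equiv _ _).symm ⟨ModuleCat.ofHom res.ε, by
    refine (congrArg (· ≫ ModuleCat.ofHom res.ε) (res.chain_d 0)).trans ?_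
    exact (ModuleCat.ofHom_comp _ _).symm.trans (congrArg ModuleCat.ofHom res.ε_comp_d)⟩
  quasiIso := ⟨fun n => by
    cases n with
    | zero =>
      rw [ChainComplex.quasiIsoAt₀_iff, ShortComplex.quasiIso_iff_of_zeros']
      · have hzero : ModuleCat.ofHom (res.d 0) ≫ ModuleCat.ofHom res.ε = 0 := by
          rw [← ModuleCat.ofHom_comp, res.ε_comp_d]; rfl
        refine (ShortComplex.exact_and_epi_g_iff_of_iso
          (S₂ := ShortComplex.mk (ModuleCat.ofHom (res.d 0)) (ModuleCat.ofHom res.ε) hzero)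
          ?_).2 ⟨?_, ?_⟩
        · exact ShortComplex.isoMk (Iso.refl _) (Iso.refl _) (Iso.refl _)
            ((Category.id_comp (ModuleCat.ofHom (res.d 0))).trans
              ((res.chain_d 0).symm.trans (Category.comp_id (res.chain.d 1 0)).symm))
            ((Category.id_comp (ModuleCat.ofHom res.ε)).trans
              ((ChainComplex.toSingle₀Equiv_symm_apply_f_zero (C := res.chain)
                (X := ModuleCat.of Λ M) (ModuleCat.ofHom res.ε) _).symm.trans
                (Category.comp_id _).symm))
        · rw [ShortComplex.moduleCat_exact_iff_range_eq_ker]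
          exact res.exact₀
        · exact (ModuleCat.epi_iff_surjective _).2 res.surj
      all_goals rfl
    | succ n =>
      rw [quasiIsoAt_iff_exactAt']
      · rw [HomologicalComplex.exactAt_iff' _ (n + 2) (n + 1) n (by simp) (by simp),
          ShortComplex.moduleCat_exact_iff_range_eq_ker]
        exact (congrArg (fun f => LinearMap.range (ModuleCat.Hom.hom f))
          (res.chain_d (n + 1))).trans ((res.exact n).trans
          (congrArg (fun f => LinearMap.ker (ModuleCat.Hom.hom f)) (res.chain_d n)).symm)
      · exact HomologicalComplex.exactAt_single_obj _ _ _ _ (by simp)⟩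

/-- Coboundaries of a sequence of maps. -/
def bdry {K : Type u} [Field K] {C : ℕ → Type v} [∀ n, AddCommGroup (C n)]
    [∀ n, Module K (C n)] (D : ∀ n, C n →ₗ[K] C (n + 1)) : ∀ n, Submodule K (C n)
  | 0 => ⊥
  | n + 1 => LinearMap.range (D n)

theorem ProjRes.finrank_ext {K : Type u} [Field K] [Algebra K Λ]
    (res : ProjRes.{u, u} Λ M) {N : Type u} [AddCommGroup N] [Module Λ N] [Module K N]
    [IsScalarTower K Λ N] [SMulCommClass Λ K N]
    {C : ℕ → Type v} [∀ n, AddCommGroup (C n)] [∀ n, Module K (C n)]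
    (D : ∀ n, C n →ₗ[K] C (n + 1)) (e : ∀ n, (res.Q n →ₗ[Λ] N) ≃ₗ[K] C n)
    (hD : ∀ n φ, e (n + 1) (φ ∘ₗ res.d n) = D n (e n φ)) (n : ℕ) :
    Module.finrank K (((Ext K (ModuleCat.{u} Λ) n).obj (Opposite.op (ModuleCat.of Λ M))).obj
      (ModuleCat.of Λ N)) =
    Module.finrank K (LinearMap.ker (D n) ⧸ (bdry D n).submoduleOf (LinearMap.ker (D n))) := by
  rw [((res.toResolution.isoExt (R := K) n (ModuleCat.of Λ N)).toLinearEquiv).finrank_eq]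
  let e₀ : ∀ n, ((res.toResolution.complex.linearYonedaObj K (ModuleCat.of Λ N)).X n) ≃ₗ[K] C n :=
    fun n => LinearEquiv.trans
      { toFun := fun f => (ModuleCat.Hom.hom f : res.Q n →ₗ[Λ] N)
        invFun := fun f => ModuleCat.ofHom f
        map_add' := fun _ _ => rfl
        map_smul' := fun k f => by
          ext x
          exact algebraMap_smul Λ k ((ModuleCat.Hom.hom f : res.Q n →ₗ[Λ] N) x)
        left_inv := fun _ => rfl
        right_inv := fun _ => rfl } (e n)
  have key : ∀ n x, e₀ (n + 1)
      (((res.toResolution.complex.linearYonedaObj K (ModuleCat.of Λ N)).d n (n + 1)).hom x) =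
      D n (e₀ n x) := by
    intro n x
    refine Eq.trans ?_ (hD n (ModuleCat.Hom.hom x))
    refine congrArg (e (n + 1)) ?_
    exact congrArg (fun f => (ModuleCat.Hom.hom x : res.Q n →ₗ[Λ] N) ∘ₗ ModuleCat.Hom.hom f)
      (res.chain_d n)
  refine finrank_homology_eq _ (e₀ n) _ _ ?_ ?_
  · intro x
    have hn : (ComplexShape.up ℕ).next n = n + 1 := by simp
    change ((res.toResolution.complex.linearYonedaObj K (ModuleCat.of Λ N)).d n
      ((ComplexShape.up ℕ).next n)).hom x = 0 ↔ _
    rw [hn, LinearMap.mem_ker]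
    exact ((e₀ (n + 1)).map_eq_zero_iff.symm).trans (Eq.congr_left (key n x))
  · intro x
    change (∃ y, ((res.toResolution.complex.linearYonedaObj K (ModuleCat.of Λ N)).d
      ((ComplexShape.up ℕ).prev n) n).hom y = x) ↔ _
    cases n with
    | zero =>
      have h0 : (res.toResolution.complex.linearYonedaObj K (ModuleCat.of Λ N)).d
          ((ComplexShape.up ℕ).prev 0) 0 = 0 :=
        HomologicalComplex.shape _ _ _ (by simp)
      rw [h0]
      refine Iff.trans ⟨?_, fun h => ⟨0, h.symm⟩⟩ ((e₀ 0).map_eq_zero_iff.symm)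
      rintro ⟨y, rfl⟩
      rfl
    | succ n =>
      have hn : (ComplexShape.up ℕ).prev (n + 1) = n := by simp
      rw [hn]
      simp only [bdry, LinearMap.mem_range]
      constructor
      · rintro ⟨y, rfl⟩
        exact ⟨e₀ n y, (key n y).symm⟩
      · rintro ⟨c, hc⟩
        refine ⟨(e₀ n).symm c, (e₀ (n + 1)).injective ?_⟩
        exact (key n _).trans ((congrArg (D n) ((e₀ n).apply_symm_apply c)).trans hc)

end Homological

section Paths

/-- Whether there is a nonzero path of degree `d` (number of arrows `γ` it contains)
from a vertex of type `i` to one of type `j` (types being residues modulo `6`). -/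
def ok (i j d : ℕ) : Bool :=
  Nat.blt i 6 && Nat.blt j 6 && Nat.blt d 2 &&
    Nat.beq (4328608424510007403863 / Nat.pow 2 (i * 12 + j * 2 + d) % 2) 1

variable (K : Type u) [Field K] (s : ℕ)

/-- The vertex `6k + i`. -/
def vtx (k : ZMod s) (i : ℕ) : ZMod (6 * s) := ((6 * k.val + i : ℕ) : ZMod (6 * s))

/-- The trivial path at the vertex `6k + i`. -/
noncomputable def ev (k : ZMod s) (i : ℕ) : Alg K s := ee K s (vtx s k i)
/-- The arrow `α_{3k+j}`. -/
noncomputable def al (k : ZMod s) (j : ℕ) : Alg K s := aa K s ((3 * k.val + j : ℕ) : ZMod (3 * s))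
/-- The arrow `β_{3k+j}`. -/
noncomputable def be (k : ZMod s) (j : ℕ) : Alg K s := bb K s ((3 * k.val + j : ℕ) : ZMod (3 * s))

/-- The path of degree `0` in block `k` from type `i` to type `j`, or `0` if there is none. -/
noncomputable def fw (k : ZMod s) : ℕ → ℕ → Alg K s
  | 0, 0 => ev K s k 0
  | 0, 1 => al K s k 0
  | 0, 2 => al K s k 1 * al K s k 0
  | 0, 3 => be K s k 0
  | 0, 4 => be K s k 1 * be K s k 0
  | 0, 5 => al K s k 2 * (al K s k 1 * al K s k 0)
  | 1, 1 => ev K s k 1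
  | 1, 2 => al K s k 1
  | 1, 5 => al K s k 2 * al K s k 1
  | 2, 2 => ev K s k 2
  | 2, 5 => al K s k 2
  | 3, 3 => ev K s k 3
  | 3, 4 => be K s k 1
  | 3, 5 => be K s k 2 * be K s k 1
  | 4, 4 => ev K s k 4
  | 4, 5 => be K s k 2
  | 5, 5 => ev K s k 5
  | _, _ => 0

/-- The path of degree `d` from the vertex `6k + i` to the vertex `6(k+d) + j`, or `0` if
there is none. -/
noncomputable def bs (k : ZMod s) (i j : ℕ) : ℕ → Alg K s
  | 0 => fw K s k i j
  | 1 => if ok i j 1 then fw K s (k + 1) 0 j * (gg K s k * fw K s k i 5) else 0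
  | _ => 0

theorem ok_lt {i j d : ℕ} (h : ok i j d = true) : i < 6 ∧ j < 6 ∧ d < 2 := by
  simp only [ok, Bool.and_eq_true, Nat.blt_eq] at h
  exact ⟨h.1.1.1, h.1.1.2, h.1.2⟩

theorem ok_five {i : ℕ} (hi : i < 6) : ok i 5 0 = true := by
  interval_cases i <;> rfl

theorem ok_zero {i : ℕ} (hi : i < 6) : ok 0 i 0 = true := by
  interval_cases i <;> rfl

theorem ok_refl {i : ℕ} (hi : i < 6) : ok i i 0 = true := by
  interval_cases i <;> rfl

theorem fw_eq_zero {k : ZMod s} {i j : ℕ} (h : ok i j 0 = false) : fw K s k i j = 0 := by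
  by_cases hi : i < 6
  · by_cases hj : j < 6
    · interval_cases i <;> interval_cases j <;> first | rfl | exact absurd h (by decide)
    · match i, j, hi, hj with
      | 0, j + 6, _, _ | 1, j + 6, _, _ | 2, j + 6, _, _ | 3, j + 6, _, _ | 4, j + 6, _, _
      | 5, j + 6, _, _ => rfl
  · match i, hi with
    | i + 6, _ => rfl

theorem bs_eq_zero {k : ZMod s} {i j d : ℕ} (h : ok i j d = false) : bs K s k i j d = 0 := by
  match d with
  | 0 => exact fw_eq_zero K s h
  | 1 => simp [bs, h]
  | d + 2 => rfl

end Paths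

section Relations

variable {K : Type u} [Field K] {s : ℕ}

theorem mk_eq {x y : F K s} (h : Rel K s x y) :
    RingQuot.mkAlgHom K (Rel K s) x = RingQuot.mkAlgHom K (Rel K s) y :=
  RingQuot.mkAlgHom_rel K h

theorem ee_mul_ee (i j : ZMod (6 * s)) :
    ee K s i * ee K s j = if i = j then ee K s i else 0 := by
  have := mk_eq (Rel.idem (K := K) i j)
  rw [map_mul] at this
  split_ifs at this ⊢ with h
  · exact this
  · exact this.trans (map_zero _)

theorem ev_mul_self (k : ZMod s) (i : ℕ) : ev K s k i * ev K s k i = ev K s k i := by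
  rw [ev, ee_mul_ee, if_pos rfl]

theorem gg_mul_ev (k : ZMod s) : gg K s k * ev K s k 5 = gg K s k :=
  (map_mul _ _ _).symm.trans (mk_eq (Rel.g_src _))

/-- The images of the arrows. -/
def IsArrow (x : Alg K s) : Prop := ∃ y ∈ arrows K s, RingQuot.mkAlgHom K (Rel K s) y = x

theorem IsArrow.al (k : ZMod s) (j : ℕ) : IsArrow (al K s k j) :=
  ⟨_, Or.inl (Or.inl ⟨_, rfl⟩), rfl⟩

theorem IsArrow.be (k : ZMod s) (j : ℕ) : IsArrow (be K s k j) :=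
  ⟨_, Or.inl (Or.inr ⟨_, rfl⟩), rfl⟩

theorem IsArrow.gg (k : ZMod s) : IsArrow (gg K s k) :=
  ⟨_, Or.inr ⟨_, rfl⟩, rfl⟩

theorem IsArrow.mul_eq_zero {x₁ x₂ x₃ x₄ x₅ : Alg K s} (h₁ : IsArrow x₁) (h₂ : IsArrow x₂)
    (h₃ : IsArrow x₃) (h₄ : IsArrow x₄) (h₅ : IsArrow x₅) :
    x₁ * (x₂ * (x₃ * (x₄ * x₅))) = 0 := by
  obtain ⟨y₁, m₁, rfl⟩ := h₁
  obtain ⟨y₂, m₂, rfl⟩ := h₂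
  obtain ⟨y₃, m₃, rfl⟩ := h₃
  obtain ⟨y₄, m₄, rfl⟩ := h₄
  obtain ⟨y₅, m₅, rfl⟩ := h₅
  have := mk_eq (Rel.len5 (K := K) y₁ y₂ y₃ y₄ y₅ m₁ m₂ m₃ m₄ m₅)
  simpa only [map_mul, mul_assoc, map_zero] using this

variable [NeZero s]

theorem val_vtx (k : ZMod s) {i : ℕ} (hi : i < 6) : (vtx s k i).val = 6 * k.val + i := by
  have := k.val_lt
  exact ZMod.val_cast_of_lt (by omega)

theorem val_three (k : ZMod s) {j : ℕ} (hj : j < 3) :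
    ((3 * k.val + j : ℕ) : ZMod (3 * s)).val = 3 * k.val + j := by
  have := k.val_lt
  exact ZMod.val_cast_of_lt (by omega)

theorem vtx_inj {k k' : ZMod s} {i i' : ℕ} (hi : i < 6) (hi' : i' < 6) :
    vtx s k i = vtx s k' i' ↔ k = k' ∧ i = i' := by
  constructor
  · intro h
    have h2 := congrArg ZMod.val h
    rw [val_vtx k hi, val_vtx k' hi'] at h2
    exact ⟨ZMod.val_injective s (by omega), by omega⟩
  · rintro ⟨rfl, rfl⟩
    rfl

theorem vtx_succ (k : ZMod s) : vtx s (k + 1) 0 = ((6 * k.val + 6 : ℕ) : ZMod (6 * s)) := by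
  have h : ((k.val + 1 : ℕ) : ZMod s) = k + 1 := by simp
  rw [vtx, ← h, ZMod.val_natCast, ZMod.natCast_eq_natCast_iff, add_zero]
  exact (Nat.mod_modEq (k.val + 1) s).mul_left' 6

theorem three_succ (k : ZMod s) :
    ((3 * (k + 1).val + 0 : ℕ) : ZMod (3 * s)) = ((3 * k.val + 3 : ℕ) : ZMod (3 * s)) := by
  have h : ((k.val + 1 : ℕ) : ZMod s) = k + 1 := by simp
  rw [← h, ZMod.val_natCast, ZMod.natCast_eq_natCast_iff, add_zero]
  exact (Nat.mod_modEq (k.val + 1) s).mul_left' 3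

theorem ev_mul_ev (k k' : ZMod s) {i i' : ℕ} (hi : i < 6) (hi' : i' < 6) :
    ev K s k i * ev K s k' i' = if k = k' ∧ i = i' then ev K s k i else 0 := by
  rw [ev, ev, ee_mul_ee]
  simp only [vtx_inj hi hi']

theorem aTgt_vtx (k : ZMod s) :
    aTgt s ((3 * k.val + 0 : ℕ) : ZMod (3 * s)) = vtx s k 1 ∧
    aTgt s ((3 * k.val + 1 : ℕ) : ZMod (3 * s)) = vtx s k 2 ∧
    aTgt s ((3 * k.val + 2 : ℕ) : ZMod (3 * s)) = vtx s k 5 := by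
  refine ⟨?_, ?_, ?_⟩ <;> rw [aTgt, val_three _ (by norm_num), vtx]
  · rw [if_neg (by omega)]; congr 1; omega
  · rw [if_pos (by omega)]; congr 1; omega
  · rw [if_neg (by omega)]; congr 1; omega

theorem aSrc_vtx (k : ZMod s) :
    aSrc s ((3 * k.val + 0 : ℕ) : ZMod (3 * s)) = vtx s k 0 ∧
    aSrc s ((3 * k.val + 1 : ℕ) : ZMod (3 * s)) = vtx s k 1 ∧
    aSrc s ((3 * k.val + 2 : ℕ) : ZMod (3 * s)) = vtx s k 2 := by
  refine ⟨?_, ?_, ?_⟩ <;> rw [aSrc, val_three _ (by norm_num), vtx] <;> congr 1 <;> omega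

theorem bTgt_vtx (k : ZMod s) :
    bTgt s ((3 * k.val + 0 : ℕ) : ZMod (3 * s)) = vtx s k 3 ∧
    bTgt s ((3 * k.val + 1 : ℕ) : ZMod (3 * s)) = vtx s k 4 ∧
    bTgt s ((3 * k.val + 2 : ℕ) : ZMod (3 * s)) = vtx s k 5 := by
  refine ⟨?_, ?_, ?_⟩ <;> rw [bTgt, val_three _ (by norm_num), vtx] <;> congr 1 <;> omega

theorem bSrc_vtx (k : ZMod s) :
    bSrc s ((3 * k.val + 0 : ℕ) : ZMod (3 * s)) = vtx s k 0 ∧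
    bSrc s ((3 * k.val + 1 : ℕ) : ZMod (3 * s)) = vtx s k 3 ∧
    bSrc s ((3 * k.val + 2 : ℕ) : ZMod (3 * s)) = vtx s k 4 := by
  refine ⟨?_, ?_, ?_⟩ <;> rw [bSrc, val_three _ (by norm_num), vtx]
  · rw [if_neg (by omega)]; congr 1; omega
  · rw [if_pos (by omega)]; congr 1; omega
  · rw [if_neg (by omega)]; congr 1; omega

theorem ev_mul_al (k : ZMod s) : ev K s k 1 * al K s k 0 = al K s k 0 ∧
    ev K s k 2 * al K s k 1 = al K s k 1 ∧ ev K s k 5 * al K s k 2 = al K s k 2 := by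
  obtain ⟨h0, h1, h2⟩ := aTgt_vtx k
  refine ⟨?_, ?_, ?_⟩
  · rw [ev, ← h0]; exact (map_mul _ _ _).symm.trans (mk_eq (Rel.a_tgt _))
  · rw [ev, ← h1]; exact (map_mul _ _ _).symm.trans (mk_eq (Rel.a_tgt _))
  · rw [ev, ← h2]; exact (map_mul _ _ _).symm.trans (mk_eq (Rel.a_tgt _))

theorem al_mul_ev (k : ZMod s) : al K s k 0 * ev K s k 0 = al K s k 0 ∧
    al K s k 1 * ev K s k 1 = al K s k 1 ∧ al K s k 2 * ev K s k 2 = al K s k 2 := by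
  obtain ⟨h0, h1, h2⟩ := aSrc_vtx k
  refine ⟨?_, ?_, ?_⟩
  · rw [ev, ← h0]; exact (map_mul _ _ _).symm.trans (mk_eq (Rel.a_src _))
  · rw [ev, ← h1]; exact (map_mul _ _ _).symm.trans (mk_eq (Rel.a_src _))
  · rw [ev, ← h2]; exact (map_mul _ _ _).symm.trans (mk_eq (Rel.a_src _))

theorem ev_mul_be (k : ZMod s) : ev K s k 3 * be K s k 0 = be K s k 0 ∧
    ev K s k 4 * be K s k 1 = be K s k 1 ∧ ev K s k 5 * be K s k 2 = be K s k 2 := by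
  obtain ⟨h0, h1, h2⟩ := bTgt_vtx k
  refine ⟨?_, ?_, ?_⟩
  · rw [ev, ← h0]; exact (map_mul _ _ _).symm.trans (mk_eq (Rel.b_tgt _))
  · rw [ev, ← h1]; exact (map_mul _ _ _).symm.trans (mk_eq (Rel.b_tgt _))
  · rw [ev, ← h2]; exact (map_mul _ _ _).symm.trans (mk_eq (Rel.b_tgt _))

theorem be_mul_ev (k : ZMod s) : be K s k 0 * ev K s k 0 = be K s k 0 ∧
    be K s k 1 * ev K s k 3 = be K s k 1 ∧ be K s k 2 * ev K s k 4 = be K s k 2 := by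
  obtain ⟨h0, h1, h2⟩ := bSrc_vtx k
  refine ⟨?_, ?_, ?_⟩
  · rw [ev, ← h0]; exact (map_mul _ _ _).symm.trans (mk_eq (Rel.b_src _))
  · rw [ev, ← h1]; exact (map_mul _ _ _).symm.trans (mk_eq (Rel.b_src _))
  · rw [ev, ← h2]; exact (map_mul _ _ _).symm.trans (mk_eq (Rel.b_src _))

theorem ev_mul_gg (k : ZMod s) : ev K s (k + 1) 0 * gg K s k = gg K s k := by
  rw [ev, vtx_succ]; exact (map_mul _ _ _).symm.trans (mk_eq (Rel.g_tgt _))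

theorem al_eq_be (k : ZMod s) : al K s k 2 * (al K s k 1 * al K s k 0) =
    be K s k 2 * (be K s k 1 * be K s k 0) := by
  have := mk_eq (Rel.comm (K := K) (s := s) ⟨k.val, k.val_lt⟩)
  simp only [map_mul, mul_assoc] at this
  exact this

theorem al_gg_be (k : ZMod s) : al K s (k + 1) 0 * (gg K s k * be K s k 2) = 0 := by
  have := mk_eq (Rel.zero_agb (K := K) (s := s) ⟨k.val, k.val_lt⟩)
  simp only [map_mul, mul_assoc, map_zero, ZMod.natCast_val, ZMod.cast_id', id_eq] at this
  rw [al, three_succ]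
  exact this

theorem be_gg_al (k : ZMod s) : be K s (k + 1) 0 * (gg K s k * al K s k 2) = 0 := by
  have := mk_eq (Rel.zero_bga (K := K) (s := s) ⟨k.val, k.val_lt⟩)
  simp only [map_mul, mul_assoc, map_zero, ZMod.natCast_val, ZMod.cast_id', id_eq] at this
  rw [be, three_succ]
  exact this

end Relations

section Products

variable {K : Type u} [Field K] {s : ℕ} [NeZero s]

theorem ev_mul_fw (k : ZMod s) {i j : ℕ} (h : ok i j 0 = true) :
    ev K s k j * fw K s k i j = fw K s k i j := by
  obtain ⟨hi, hj, -⟩ := ok_lt h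
  obtain ⟨a0, a1, a2⟩ := ev_mul_al (K := K) k
  obtain ⟨b0, b1, b2⟩ := ev_mul_be (K := K) k
  interval_cases i <;> interval_cases j <;>
    first
    | exact absurd h (by decide)
    | simp only [fw, ← mul_assoc, a0, a1, a2, b0, b1, b2, ev_mul_self]

theorem fw_mul_ev (k : ZMod s) {i j : ℕ} (h : ok i j 0 = true) :
    fw K s k i j * ev K s k i = fw K s k i j := by
  obtain ⟨hi, hj, -⟩ := ok_lt h
  obtain ⟨a0, a1, a2⟩ := al_mul_ev (K := K) k
  obtain ⟨b0, b1, b2⟩ := be_mul_ev (K := K) k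
  interval_cases i <;> interval_cases j <;>
    first
    | exact absurd h (by decide)
    | simp only [fw, mul_assoc, a0, a1, a2, b0, b1, b2, ev_mul_self]

theorem fw_self (k : ZMod s) {i : ℕ} (hi : i < 6) : fw K s k i i = ev K s k i := by
  interval_cases i <;> rfl

theorem fw_mul (k : ZMod s) {i j l : ℕ} (h : ok i j 0 = true) (h' : ok j l 0 = true) :
    fw K s k j l * fw K s k i j = fw K s k i l := by
  obtain ⟨hi, hj, -⟩ := ok_lt h
  by_cases e1 : i = j
  · subst e1
    rw [fw_self k hi, fw_mul_ev k h']
  by_cases e2 : j = l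
  · subst e2
    rw [fw_self k hj, ev_mul_fw k h]
  obtain ⟨-, hl, -⟩ := ok_lt h'
  interval_cases i <;> interval_cases j <;> try exact absurd h (by decide)
  all_goals interval_cases l <;>
    first
    | exact absurd h' (by decide)
    | exact absurd rfl e1
    | exact absurd rfl e2
    | simp only [fw, mul_assoc, al_eq_be]

theorem fw_gg_fw_eq_zero (k : ZMod s) {i l : ℕ} (hi : i < 6) (hl : l < 6)
    (h : ok i l 1 = false) : fw K s (k + 1) 0 l * (gg K s k * fw K s k i 5) = 0 := by
  have z1 := al_gg_be (K := K) k
  have z2 := be_gg_al (K := K) k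
  have z1' : ∀ x, al K s (k + 1) 0 * (gg K s k * (be K s k 2 * x)) = 0 := fun x => by
    rw [← mul_assoc (gg K s k), ← mul_assoc, z1, zero_mul]
  have z2' : ∀ x, be K s (k + 1) 0 * (gg K s k * (al K s k 2 * x)) = 0 := fun x => by
    rw [← mul_assoc (gg K s k), ← mul_assoc, z2, zero_mul]
  have z3 := fun j₁ j₂ j₃ j₄ => (IsArrow.al (K := K) (k + 1) j₁).mul_eq_zero (.gg k) (.al k j₂)
    (.al k j₃) (.al k j₄)
  have z4 := fun j₁ j₂ j₃ j₄ => (IsArrow.al (K := K) (k + 1) j₁).mul_eq_zero (.al (k + 1) j₂)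
    (.gg k) (.al k j₃) (.al k j₄)
  have z5 := fun j₁ j₂ j₃ j₄ => (IsArrow.al (K := K) (k + 1) j₁).mul_eq_zero (.al (k + 1) j₂)
    (.al (k + 1) j₃) (.gg k) (.al k j₄)
  have z6 := fun j₁ j₂ j₃ j₄ => (IsArrow.be (K := K) (k + 1) j₁).mul_eq_zero (.be (k + 1) j₂)
    (.gg k) (.be k j₃) (.be k j₄)
  interval_cases i <;> interval_cases l <;>
    first
    | exact absurd h (by decide)
    | simp only [fw, mul_assoc, z1, z2, z1', z2', z3, mul_zero, z4, z5, z6]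

theorem bs_one (k : ZMod s) {i j : ℕ} (hi : i < 6) (hj : j < 6) :
    bs K s k i j 1 = fw K s (k + 1) 0 j * (gg K s k * fw K s k i 5) := by
  by_cases h : ok i j 1 = true
  · simp [bs, h]
  · rw [Bool.not_eq_true] at h
    rw [fw_gg_fw_eq_zero k hi hj h]
    simp [bs, h]

theorem gg_fw_gg (k : ZMod s) : gg K s (k + 1) * (fw K s (k + 1) 0 5 * gg K s k) = 0 := by
  simp only [fw, mul_assoc]
  exact (IsArrow.gg (k + 1)).mul_eq_zero (.al _ _) (.al _ _) (.al _ _) (.gg k)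

theorem bs_mul {k k' : ZMod s} {i j l d d' : ℕ} (h : ok i j d = true) (h' : ok j l d' = true)
    (hk : k' = k + d) : bs K s k' j l d' * bs K s k i j d = bs K s k i l (d + d') := by
  subst hk
  obtain ⟨hi, hj, hd⟩ := ok_lt h
  obtain ⟨-, hl, hd'⟩ := ok_lt h'
  interval_cases d <;> interval_cases d'
  · simp only [Nat.cast_zero, add_zero]
    exact fw_mul k h h'
  · simp only [Nat.cast_zero, add_zero, zero_add]
    rw [bs_one k hj hl, bs_one k hi hl, bs, mul_assoc, mul_assoc, fw_mul k h (ok_five hj)]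
  · simp only [Nat.cast_one, add_zero]
    rw [bs_one k hi hj, bs_one k hi hl, bs, ← mul_assoc, fw_mul (k + 1) (ok_zero hj) h']
  · simp only [Nat.cast_one]
    rw [bs_one k hi hj, bs_one (k + 1) hj hl]
    have e : fw K s (k + 1) j 5 * fw K s (k + 1) 0 j = fw K s (k + 1) 0 5 :=
      fw_mul (k + 1) (ok_zero hj) (ok_five hj)
    calc _ = fw K s (k + 1 + 1) 0 l * ((gg K s (k + 1) *
            ((fw K s (k + 1) j 5 * fw K s (k + 1) 0 j) * gg K s k)) * fw K s k i 5) := by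
          simp only [mul_assoc]
      _ = 0 := by rw [e, gg_fw_gg, zero_mul, mul_zero]

theorem bs_self (k : ZMod s) {i : ℕ} (hi : i < 6) : bs K s k i i 0 = ev K s k i := fw_self k hi

theorem bs_mul_ev (k : ZMod s) {i j d : ℕ} (h : ok i j d = true) :
    bs K s k i j d * ev K s k i = bs K s k i j d := by
  obtain ⟨hi, -, -⟩ := ok_lt h
  rw [← bs_self k hi, bs_mul (ok_refl hi) h (by simp), zero_add]

theorem ev_mul_bs {k k' : ZMod s} {i j d : ℕ} (h : ok i j d = true) (hk : k' = k + d) :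
    ev K s k' j * bs K s k i j d = bs K s k i j d := by
  obtain ⟨-, hj, -⟩ := ok_lt h
  rw [← bs_self k' hj, bs_mul h (ok_refl hj) hk, add_zero]

theorem bs_mul_ne {k k' : ZMod s} {i j j' l d d' : ℕ} (h : ok i j d = true)
    (h' : ok j' l d' = true) (hne : ¬(k' = k + d ∧ j' = j)) :
    bs K s k' j' l d' * bs K s k i j d = 0 := by
  rw [← bs_mul_ev k' h', ← ev_mul_bs h rfl, mul_assoc, ← mul_assoc (ev K s k' j'),
    ev_mul_ev _ _ (ok_lt h').1 (ok_lt h).2.1, if_neg hne, zero_mul, mul_zero]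

end Products

section Basis

/-- Indices of the basis of `R_s` formed by the nonzero paths: the block of the source, and the
types of the source and the target together with the degree. -/
abbrev Idx (s : ℕ) : Type := ZMod s × {x : ℕ × ℕ × ℕ // ok x.1 x.2.1 x.2.2 = true}

variable (K : Type u) [Field K] (s : ℕ)

/-- The path attached to an index. -/
noncomputable def path (x : Idx s) : Alg K s := bs K s x.1 x.2.1.1 x.2.1.2.1 x.2.1.2.2

/-- The basis vector of the regular representation attached to a path. -/
noncomputable def sg (k : ZMod s) (i j d : ℕ) : Idx s →₀ K :=
  if h : ok i j d = true then Finsupp.single (k, ⟨(i, j, d), h⟩) 1 else 0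

/-- The action of a path on the regular representation. -/
noncomputable def act (m : ZMod s) (p q e : ℕ) : Module.End K (Idx s →₀ K) :=
  Finsupp.linearCombination K fun x : Idx s =>
    if x.1 + x.2.1.2.2 = m ∧ x.2.1.2.1 = p then sg K s x.1 x.2.1.1 q (x.2.1.2.2 + e) else 0

variable {K s}

theorem sg_of_not_ok {k : ZMod s} {i j d : ℕ} (h : ok i j d = false) : sg K s k i j d = 0 :=
  dif_neg (by simp [h])

theorem act_sg {m k : ZMod s} {p q e i j d : ℕ} (h : ok i j d = true) :
    act K s m p q e (sg K s k i j d) =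
      if k + d = m ∧ j = p then sg K s k i q (d + e) else 0 := by
  rw [act, sg, dif_pos h, Finsupp.linearCombination_single, one_smul]

theorem end_ext {f g : Module.End K (Idx s →₀ K)}
    (h : ∀ k i j d, ok i j d = true → f (sg K s k i j d) = g (sg K s k i j d)) : f = g := by
  refine Finsupp.lhom_ext' fun x => LinearMap.ext_ring ?_
  obtain ⟨k, ⟨⟨i, j, d⟩, hx⟩⟩ := x
  have := h k i j d hx
  rw [sg, dif_pos hx] at this
  exact this

set_option synthInstance.maxSize 512 in
theorem ok_factor {i p q r d e e' : ℕ} (h : ok i p d = true) (h₁ : ok p q e = true)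
    (h₂ : ok q r e' = true) (h₃ : ok i r (d + (e + e')) = true) : ok i q (d + e) = true := by
  have key : ∀ i < 6, ∀ p < 6, ∀ d < 2, ∀ q < 6, ∀ e < 2, ∀ r < 6, ∀ e' < 2,
      (!(ok i p d) || !(ok p q e) || !(ok q r e') || !(ok i r (d + (e + e'))) ||
        ok i q (d + e)) = true := by
    decide +kernel
  obtain ⟨a, b, c⟩ := ok_lt h
  obtain ⟨-, b', c'⟩ := ok_lt h₁
  obtain ⟨-, b'', c''⟩ := ok_lt h₂
  simpa [h, h₁, h₂, h₃] using key i a p b d c q b' e c' r b'' e' c''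

theorem act_mul {m m' : ZMod s} {p q r e e' : ℕ} (h₁ : ok p q e = true) (h₂ : ok q r e' = true)
    (hm : m' = m + e) : act K s m' q r e' * act K s m p q e = act K s m p r (e + e') := by
  refine end_ext fun k i j d h => ?_
  rw [Module.End.mul_apply, act_sg h, act_sg h]
  split_ifs with hc
  · obtain ⟨rfl, rfl⟩ := hc
    by_cases h' : ok i q (d + e) = true
    · rw [act_sg h', if_pos ⟨by rw [hm]; push_cast; ring, rfl⟩, add_assoc]
    · rw [sg_of_not_ok (by simpa using h'), map_zero, sg_of_not_ok]
      rw [← Bool.not_eq_true]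
      exact fun h₃ => h' (ok_factor h h₁ h₂ h₃)
  · rw [map_zero]

theorem act_mul_ne {m m' : ZMod s} {p q q' r e e' : ℕ} (h : ¬(m' = m + e ∧ q = q')) :
    act K s m' q' r e' * act K s m p q e = 0 := by
  refine end_ext fun k i j d h' => ?_
  rw [Module.End.mul_apply, act_sg h']
  split_ifs with hc
  · obtain ⟨rfl, rfl⟩ := hc
    by_cases h'' : ok i q (d + e) = true
    · rw [act_sg h'', if_neg]
      · rfl
      · rintro ⟨hk, hq⟩
        exact h ⟨by rw [← hk]; push_cast; ring, hq⟩
    · rw [sg_of_not_ok (by simpa using h''), map_zero]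
      rfl
  · rw [map_zero]
    rfl

end Basis

section Regular

variable {K : Type u} [Field K] {s : ℕ} [NeZero s]

theorem exists_vtx (i : ZMod (6 * s)) : ∃ k : ZMod s, ∃ j < 6, i = vtx s k j := by
  have h := i.val_lt
  refine ⟨(i.val / 6 : ℕ), i.val % 6, Nat.mod_lt _ (by norm_num), ?_⟩
  rw [vtx, ZMod.val_cast_of_lt (by omega), Nat.div_add_mod, ZMod.natCast_val, ZMod.cast_id', id]

theorem exists_three (i : ZMod (3 * s)) :
    ∃ k : ZMod s, ∃ j < 3, i = ((3 * k.val + j : ℕ) : ZMod (3 * s)) := by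
  have h := i.val_lt
  refine ⟨(i.val / 3 : ℕ), i.val % 3, Nat.mod_lt _ (by norm_num), ?_⟩
  rw [ZMod.val_cast_of_lt (by omega), Nat.div_add_mod, ZMod.natCast_val, ZMod.cast_id', id]

/-- The vertices of the upper branch. -/
def upper : ℕ → ℕ
  | 0 => 0
  | 1 => 1
  | 2 => 2
  | _ => 5

/-- The vertices of the lower branch. -/
def lower : ℕ → ℕ
  | 0 => 0
  | 1 => 3
  | 2 => 4
  | _ => 5

variable (K s) in
/-- The action of the generators on the regular representation. -/
noncomputable def regGen : Gen s → Module.End K (Idx s →₀ K)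
  | .e i => act K s (i.val / 6 : ℕ) (i.val % 6) (i.val % 6) 0
  | .a i => act K s (i.val / 3 : ℕ) (upper (i.val % 3)) (upper (i.val % 3 + 1)) 0
  | .b i => act K s (i.val / 3 : ℕ) (lower (i.val % 3)) (lower (i.val % 3 + 1)) 0
  | .g i => act K s i 5 0 1

variable (K s) in
/-- The regular representation of the free algebra. -/
noncomputable def regF : F K s →ₐ[K] Module.End K (Idx s →₀ K) :=
  FreeAlgebra.lift K (regGen K s)

theorem regF_E (k : ZMod s) {j : ℕ} (hj : j < 6) :
    regF K s (E K s (vtx s k j)) = act K s k j j 0 := by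
  rw [regF, E, FreeAlgebra.lift_ι_apply, regGen, val_vtx k hj,
    show (6 * k.val + j) / 6 = k.val by omega, show (6 * k.val + j) % 6 = j by omega,
    ZMod.natCast_val, ZMod.cast_id', id]

theorem regF_A (k : ZMod s) {j : ℕ} (hj : j < 3) :
    regF K s (A K s ((3 * k.val + j : ℕ) : ZMod (3 * s))) =
      act K s k (upper j) (upper (j + 1)) 0 := by
  rw [regF, A, FreeAlgebra.lift_ι_apply, regGen, val_three k hj,
    show (3 * k.val + j) / 3 = k.val by omega, show (3 * k.val + j) % 3 = j by omega,
    ZMod.natCast_val, ZMod.cast_id', id]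

theorem regF_B (k : ZMod s) {j : ℕ} (hj : j < 3) :
    regF K s (B K s ((3 * k.val + j : ℕ) : ZMod (3 * s))) =
      act K s k (lower j) (lower (j + 1)) 0 := by
  rw [regF, B, FreeAlgebra.lift_ι_apply, regGen, val_three k hj,
    show (3 * k.val + j) / 3 = k.val by omega, show (3 * k.val + j) % 3 = j by omega,
    ZMod.natCast_val, ZMod.cast_id', id]

theorem regF_G (k : ZMod s) : regF K s (G K s k) = act K s k 5 0 1 := by
  rw [regF, G, FreeAlgebra.lift_ι_apply, regGen]

/-- Length of the path from type `0` to a given type. -/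
def height : ℕ → ℕ
  | 0 => 0
  | 1 => 1
  | 2 => 2
  | 3 => 1
  | 4 => 2
  | _ => 3

/-- Vectors that are zero or a basis vector of length at least `n`. -/
def Deep (n : ℕ) (x : Idx s →₀ K) : Prop :=
  x = 0 ∨ ∃ k i j d, ok i j d = true ∧ x = sg K s k i j d ∧ height i + n ≤ height j + 4 * d

theorem Deep.act {n : ℕ} {x : Idx s →₀ K} (h : Deep n x) (m : ZMod s) {p q e : ℕ}
    (hpq : height p + 1 ≤ height q + 4 * e) : Deep (n + 1) (act K s m p q e x) := by
  obtain rfl | ⟨k, i, j, d, h, rfl, hn⟩ := h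
  · exact Or.inl (map_zero _)
  · rw [act_sg h]
    split_ifs with hc
    · obtain ⟨-, rfl⟩ := hc
      by_cases h' : ok i q (d + e) = true
      · exact Or.inr ⟨k, i, q, d + e, h', rfl, by omega⟩
      · exact Or.inl (sg_of_not_ok (by simpa using h'))
    · exact Or.inl rfl

theorem Deep.arrow {n : ℕ} {x : Idx s →₀ K} (h : Deep n x) {y : F K s} (hy : y ∈ arrows K s) :
    Deep (n + 1) (regF K s y x) := by
  obtain (⟨i, rfl⟩ | ⟨i, rfl⟩) | ⟨i, rfl⟩ := hy
  · obtain ⟨k, j, hj, rfl⟩ := exists_three i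
    rw [regF_A k hj]
    exact h.act _ (by interval_cases j <;> decide)
  · obtain ⟨k, j, hj, rfl⟩ := exists_three i
    rw [regF_B k hj]
    exact h.act _ (by interval_cases j <;> decide)
  · rw [regF_G]
    exact h.act _ (by decide)

theorem Deep.eq_zero {x : Idx s →₀ K} (h : Deep 5 x) : x = 0 := by
  obtain h | ⟨k, i, j, d, h, -, hn⟩ := h
  · exact h
  · obtain ⟨hi, hj, hd⟩ := ok_lt h
    have key : ∀ i < 6, ∀ j < 6, ∀ d < 2, ok i j d = true → ¬ height i + 5 ≤ height j + 4 * d := by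
      decide
    exact absurd hn (key i hi j hj d hd h)

theorem act_eq_zero {m : ZMod s} {p q e : ℕ}
    (h : ∀ i < 6, ∀ d < 2, ok i p d = true → ok i q (d + e) = false) : act K s m p q e = 0 := by
  refine end_ext fun k i j d h' => ?_
  rw [act_sg h']
  split_ifs with hc
  · obtain ⟨-, rfl⟩ := hc
    rw [sg_of_not_ok (h i (ok_lt h').1 d (ok_lt h').2.2 h')]
    rfl
  · rfl

theorem regF_rel {x y : F K s} (h : Rel K s x y) : regF K s x = regF K s y := by
  induction h with
  | idem i j =>
    obtain ⟨k, p, hp, rfl⟩ := exists_vtx i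
    obtain ⟨l, q, hq, rfl⟩ := exists_vtx j
    rw [map_mul, regF_E k hp, regF_E l hq]
    split_ifs with hc
    · obtain ⟨rfl, rfl⟩ := (vtx_inj hp hq).1 hc
      rw [act_mul (ok_refl hp) (ok_refl hp) (by simp), regF_E k hp]
    · rw [act_mul_ne, map_zero]
      rintro ⟨rfl, rfl⟩
      exact hc (by simp)
  | sum_one =>
    rw [map_sum, map_one]
    refine end_ext fun k i j d h => ?_
    have hj := (ok_lt h).2.1
    have hk := (k + d).val_lt
    rw [LinearMap.sum_apply, Finset.sum_eq_single (6 * (k + d).val + j)]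
    · rw [show ((6 * (k + d).val + j : ℕ) : ZMod (6 * s)) = vtx s (k + d) j from rfl,
        regF_E _ hj, act_sg h, if_pos ⟨rfl, rfl⟩]
      rfl
    · intro v hv hne
      obtain ⟨l, q, hq, hl⟩ := exists_vtx (v : ZMod (6 * s))
      rw [hl, regF_E _ hq, act_sg h, if_neg]
      rintro ⟨rfl, rfl⟩
      apply hne
      have := congrArg ZMod.val hl
      rwa [ZMod.val_cast_of_lt (Finset.mem_range.1 hv), val_vtx _ hq] at this
    · intro hn
      exact absurd (Finset.mem_range.2 (by omega)) hn
  | a_tgt i =>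
    obtain ⟨k, j, hj, rfl⟩ := exists_three i
    obtain ⟨h0, h1, h2⟩ := aTgt_vtx k
    rw [map_mul, regF_A k hj]
    interval_cases j
    · rw [h0, regF_E _ (by norm_num)]; exact act_mul rfl rfl (by simp)
    · rw [h1, regF_E _ (by norm_num)]; exact act_mul rfl rfl (by simp)
    · rw [h2, regF_E _ (by norm_num)]; exact act_mul rfl rfl (by simp)
  | a_src i =>
    obtain ⟨k, j, hj, rfl⟩ := exists_three i
    obtain ⟨h0, h1, h2⟩ := aSrc_vtx k
    rw [map_mul, regF_A k hj]
    interval_cases j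
    · rw [h0, regF_E _ (by norm_num)]; exact act_mul rfl rfl (by simp)
    · rw [h1, regF_E _ (by norm_num)]; exact act_mul rfl rfl (by simp)
    · rw [h2, regF_E _ (by norm_num)]; exact act_mul rfl rfl (by simp)
  | b_tgt i =>
    obtain ⟨k, j, hj, rfl⟩ := exists_three i
    obtain ⟨h0, h1, h2⟩ := bTgt_vtx k
    rw [map_mul, regF_B k hj]
    interval_cases j
    · rw [h0, regF_E _ (by norm_num)]; exact act_mul rfl rfl (by simp)
    · rw [h1, regF_E _ (by norm_num)]; exact act_mul rfl rfl (by simp)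
    · rw [h2, regF_E _ (by norm_num)]; exact act_mul rfl rfl (by simp)
  | b_src i =>
    obtain ⟨k, j, hj, rfl⟩ := exists_three i
    obtain ⟨h0, h1, h2⟩ := bSrc_vtx k
    rw [map_mul, regF_B k hj]
    interval_cases j
    · rw [h0, regF_E _ (by norm_num)]; exact act_mul rfl rfl (by simp)
    · rw [h1, regF_E _ (by norm_num)]; exact act_mul rfl rfl (by simp)
    · rw [h2, regF_E _ (by norm_num)]; exact act_mul rfl rfl (by simp)
  | g_tgt i =>
    rw [map_mul, regF_G, gTgt, ← vtx_succ, regF_E _ (by norm_num)]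
    exact act_mul rfl rfl (by simp)
  | g_src i =>
    rw [map_mul, regF_G, show gSrc s i = vtx s i 5 from rfl, regF_E _ (by norm_num)]
    exact act_mul rfl rfl (by simp)
  | len5 x₁ x₂ x₃ x₄ x₅ h₁ h₂ h₃ h₄ h₅ =>
    refine end_ext fun k i j d h => ?_
    simp only [map_mul, map_zero, Module.End.mul_apply, LinearMap.zero_apply]
    have h0 : Deep 0 (sg K s k i j d) := by
      refine Or.inr ⟨k, i, j, d, h, rfl, ?_⟩
      obtain ⟨hi, hj, hd⟩ := ok_lt h
      have key : ∀ i < 6, ∀ j < 6, ∀ d < 2, ok i j d = true → height i + 0 ≤ height j + 4 * d := by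
        decide
      exact key i hi j hj d hd h
    exact (((((h0.arrow h₅).arrow h₄).arrow h₃).arrow h₂).arrow h₁).eq_zero
  | comm t =>
    obtain ⟨k, hk⟩ : ∃ k : ZMod s, k.val = t := ⟨(t : ℕ), ZMod.val_cast_of_lt t.2⟩
    rw [← hk, ← add_zero (3 * k.val)]
    simp only [map_mul]
    rw [add_assoc, add_assoc, regF_A k (by norm_num), regF_A k (by norm_num),
      regF_A k (by norm_num), regF_B k (by norm_num), regF_B k (by norm_num),
      regF_B k (by norm_num)]
    simp only [upper, lower, zero_add, Nat.reduceAdd]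
    rw [act_mul rfl rfl (by simp), act_mul rfl rfl (by simp), act_mul rfl rfl (by simp),
      act_mul rfl rfl (by simp)]
  | zero_agb t =>
    obtain ⟨k, hk⟩ : ∃ k : ZMod s, k.val = t := ⟨(t : ℕ), ZMod.val_cast_of_lt t.2⟩
    rw [← hk, ← three_succ, ZMod.natCast_val, ZMod.cast_id', id]
    simp only [map_mul, map_zero]
    rw [regF_A _ (by norm_num), regF_B _ (by norm_num), regF_G, mul_assoc]
    simp only [upper, lower, zero_add, Nat.reduceAdd]
    rw [act_mul rfl rfl (by simp), act_mul rfl rfl (by simp), act_eq_zero (by decide)]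
  | zero_bga t =>
    obtain ⟨k, hk⟩ : ∃ k : ZMod s, k.val = t := ⟨(t : ℕ), ZMod.val_cast_of_lt t.2⟩
    rw [← hk, ← three_succ, ZMod.natCast_val, ZMod.cast_id', id]
    simp only [map_mul, map_zero]
    rw [regF_B _ (by norm_num), regF_A _ (by norm_num), regF_G, mul_assoc]
    simp only [upper, lower, zero_add, Nat.reduceAdd]
    rw [act_mul rfl rfl (by simp), act_mul rfl rfl (by simp), act_eq_zero (by decide)]

variable (K s) in
/-- The regular representation of `R_s`. -/
noncomputable def reg : Alg K s →ₐ[K] Module.End K (Idx s →₀ K) :=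
  RingQuot.liftAlgHom K ⟨regF K s, fun _ _ h => regF_rel h⟩

theorem reg_mk (x : F K s) : reg K s (RingQuot.mkAlgHom K (Rel K s) x) = regF K s x :=
  RingQuot.liftAlgHom_mkAlgHom_apply _ _ _ _

theorem reg_fw (k : ZMod s) {i j : ℕ} (h : ok i j 0 = true) :
    reg K s (fw K s k i j) = act K s k i j 0 := by
  obtain ⟨hi, hj, -⟩ := ok_lt h
  have he : ∀ i < 6, reg K s (ev K s k i) = act K s k i i 0 := fun i hi =>
    (reg_mk _).trans (regF_E k hi)
  have ha : ∀ j < 3, reg K s (al K s k j) = act K s k (upper j) (upper (j + 1)) 0 := fun j hj =>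
    (reg_mk _).trans (regF_A k hj)
  have hb : ∀ j < 3, reg K s (be K s k j) = act K s k (lower j) (lower (j + 1)) 0 := fun j hj =>
    (reg_mk _).trans (regF_B k hj)
  have mul2 {p q r : ℕ} (h₁ : ok p q 0 = true) (h₂ : ok q r 0 = true) :
      act K s k q r 0 * act K s k p q 0 = act K s k p r 0 := act_mul h₁ h₂ (by simp)
  have a0 : reg K s (al K s k 0) = act K s k 0 1 0 := ha 0 (by norm_num)
  have a1 : reg K s (al K s k 1) = act K s k 1 2 0 := ha 1 (by norm_num)
  have a2 : reg K s (al K s k 2) = act K s k 2 5 0 := ha 2 (by norm_num)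
  have b0 : reg K s (be K s k 0) = act K s k 0 3 0 := hb 0 (by norm_num)
  have b1 : reg K s (be K s k 1) = act K s k 3 4 0 := hb 1 (by norm_num)
  have b2 : reg K s (be K s k 2) = act K s k 4 5 0 := hb 2 (by norm_num)
  clear ha hb
  interval_cases i <;> interval_cases j <;> try exact absurd h (by decide)
  all_goals
    rw [fw]
    first
    | exact he _ (by norm_num)
    | (simp only [map_mul, a0, a1, a2, b0, b1, b2]; done)
    | (simp only [map_mul, a0, a1, a2, b0, b1, b2]
       rw [mul2 rfl rfl]
       first
       | done
       | rw [mul2 rfl rfl])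

theorem reg_bs (k : ZMod s) {i j d : ℕ} (h : ok i j d = true) :
    reg K s (bs K s k i j d) = act K s k i j d := by
  obtain ⟨hi, hj, hd⟩ := ok_lt h
  interval_cases d
  · exact reg_fw k h
  · rw [bs_one k hi hj, map_mul, map_mul, reg_fw _ (ok_zero hj), reg_fw _ (ok_five hi),
      show reg K s (gg K s k) = act K s k 5 0 1 from (reg_mk _).trans (regF_G k),
      act_mul (ok_five hi) rfl (by simp), act_mul _ (ok_zero hj) (by simp)]
    interval_cases i <;> rfl

theorem linearIndependent_path : LinearIndependent K (path K s) := by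
  let u : Idx s →₀ K := ∑ x : ZMod s × Fin 6, sg K s x.1 x.2 x.2 0
  let Φ : Alg K s →ₗ[K] (Idx s →₀ K) := (LinearMap.applyₗ u) ∘ₗ (reg K s).toLinearMap
  refine LinearIndependent.of_comp Φ ?_
  have : Φ ∘ path K s = Finsupp.basisSingleOne (R := K) (ι := Idx s) := by
    funext ⟨k, ⟨⟨i, j, d⟩, h⟩⟩
    change reg K s (bs K s k i j d) u = _
    have hi := (ok_lt h).1
    rw [reg_bs k h, map_sum, Finset.sum_eq_single (k, ⟨i, hi⟩)]
    · rw [act_sg (ok_refl hi), if_pos ⟨by simp, rfl⟩, zero_add, sg, dif_pos h]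
      rfl
    · rintro ⟨l, q⟩ - hne
      rw [act_sg (ok_refl q.2), if_neg]
      rintro ⟨rfl, rfl⟩
      exact hne (by simp)
    · exact fun hn => absurd (Finset.mem_univ _) hn
  rw [this]
  exact Module.Basis.linearIndependent _

theorem bs_mem_span (k : ZMod s) (i j d : ℕ) :
    bs K s k i j d ∈ Submodule.span K (Set.range (path K s)) := by
  by_cases h : ok i j d = true
  · exact Submodule.subset_span ⟨(k, ⟨(i, j, d), h⟩), rfl⟩
  · rw [bs_eq_zero K s (by simpa using h)]
    exact zero_mem _

theorem ev_mem_span (k : ZMod s) {i : ℕ} (hi : i < 6) :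
    ev K s k i ∈ Submodule.span K (Set.range (path K s)) :=
  bs_self (K := K) k hi ▸ bs_mem_span k i i 0

theorem sum_ee : ∑ i ∈ Finset.range (6 * s), ee K s (i : ZMod (6 * s)) = 1 := by
  have := mk_eq (Rel.sum_one (K := K) (s := s))
  rwa [map_sum, map_one] at this

theorem span_path : Submodule.span K (Set.range (path K s)) = ⊤ := by
  set W := Submodule.span K (Set.range (path K s)) with hW
  have one : (1 : Alg K s) ∈ W := by
    rw [← sum_ee]
    refine sum_mem fun i _ => ?_
    obtain ⟨k, j, hj, h⟩ := exists_vtx (i : ZMod (6 * s))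
    rw [h]
    exact ev_mem_span k hj
  have mul : ∀ x y, x ∈ W → y ∈ W → x * y ∈ W := by
    intro x y hx hy
    refine Submodule.span_induction₂ (p := fun x y _ _ => x * y ∈ W) ?_ ?_ ?_ ?_ ?_ ?_ ?_ hx hy
    · rintro _ _ ⟨⟨k, ⟨⟨i, j, d⟩, h⟩⟩, rfl⟩ ⟨⟨k', ⟨⟨i', j', d'⟩, h'⟩⟩, rfl⟩
      change bs K s k i j d * bs K s k' i' j' d' ∈ W
      by_cases hc : k = k' + d' ∧ i = j'
      · obtain ⟨hk, rfl⟩ := hc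
        rw [bs_mul h' h hk]
        exact bs_mem_span _ _ _ _
      · rw [bs_mul_ne h' h hc]
        exact zero_mem _
    · intro y _; rw [zero_mul]; exact zero_mem _
    · intro y _; rw [mul_zero]; exact zero_mem _
    · intro x y z _ _ _ h₁ h₂; rw [add_mul]; exact add_mem h₁ h₂
    · intro x y z _ _ _ h₁ h₂; rw [mul_add]; exact add_mem h₁ h₂
    · intro r x y _ _ h; rw [smul_mul_assoc]; exact W.smul_mem _ h
    · intro r x y _ _ h; rw [mul_smul_comm]; exact W.smul_mem _ h
  rw [eq_top_iff]
  rintro x -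
  obtain ⟨y, rfl⟩ := RingQuot.mkAlgHom_surjective K (Rel K s) x
  refine FreeAlgebra.induction K (Gen s)
    (motive := fun y => RingQuot.mkAlgHom K (Rel K s) y ∈ W) ?_ ?_ ?_ ?_ y
  · intro r
    rw [AlgHom.commutes, Algebra.algebraMap_eq_smul_one]
    exact W.smul_mem _ one
  · rintro (i | i | i | i)
    · obtain ⟨k, j, hj, rfl⟩ := exists_vtx i
      exact ev_mem_span k hj
    · obtain ⟨k, j, hj, rfl⟩ := exists_three i
      interval_cases j
      · exact bs_mem_span k 0 1 0
      · exact bs_mem_span k 1 2 0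
      · exact bs_mem_span k 2 5 0
    · obtain ⟨k, j, hj, rfl⟩ := exists_three i
      interval_cases j
      · exact bs_mem_span k 0 3 0
      · exact bs_mem_span k 3 4 0
      · exact bs_mem_span k 4 5 0
    · have := bs_mem_span (K := K) i 5 0 1
      rwa [bs_one i (by norm_num) (by norm_num), fw_self _ (by norm_num),
        fw_self _ (by norm_num), gg_mul_ev, ev_mul_gg] at this
  · intro a b ha hb
    rw [map_mul]
    exact mul _ _ ha hb
  · intro a b ha hb
    rw [map_add]
    exact add_mem ha hb

variable (K s) in
/-- The basis of `R_s` formed by the nonzero paths. -/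
noncomputable def pathBasis : Module.Basis (Idx s) K (Alg K s) :=
  Module.Basis.mk linearIndependent_path span_path.ge

theorem pathBasis_apply (x : Idx s) : pathBasis K s x = path K s x := by
  rw [pathBasis, Module.Basis.mk_apply]

end Regular

section Tables

/-- For each degree below `11`, the generators of the resolution: the type of the left vertex, the
type of the right vertex, and the number of blocks by which the right vertex precedes the left
one. -/
def genTable : List (List (ℕ × ℕ × ℕ)) := [
  [(0, 0, 0), (1, 1, 0), (2, 2, 0), (3, 3, 0), (4, 4, 0), (5, 5, 0)],
  [(1, 0, 0), (3, 0, 0), (2, 1, 0), (5, 2, 0), (4, 3, 0), (5, 4, 0), (0, 5, 1)],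
  [(5, 0, 0), (2, 1, 1), (3, 2, 1), (4, 3, 1), (1, 4, 1), (0, 5, 2)],
  [(2, 0, 1), (4, 0, 1), (5, 1, 1), (0, 2, 2), (5, 3, 1), (0, 4, 2), (1, 5, 2), (3, 5, 2)],
  [(5, 0, 1), (0, 0, 2), (3, 1, 2), (1, 2, 2), (4, 2, 2), (1, 3, 2), (2, 4, 2), (3, 4, 2),
   (5, 5, 2)],
  [(1, 0, 2), (3, 0, 2), (0, 1, 3), (5, 2, 2), (0, 3, 3), (5, 4, 2), (2, 5, 3), (4, 5, 3)],
  [(0, 0, 3), (1, 1, 3), (4, 1, 3), (2, 2, 3), (2, 3, 3), (3, 3, 3), (4, 4, 3), (5, 5, 3),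
   (0, 5, 4)],
  [(2, 0, 3), (4, 0, 3), (5, 1, 3), (0, 2, 4), (5, 3, 3), (0, 4, 4), (1, 5, 4), (3, 5, 4)],
  [(5, 0, 3), (2, 1, 4), (3, 2, 4), (4, 3, 4), (1, 4, 4), (0, 5, 5)],
  [(5, 0, 4), (0, 1, 5), (3, 2, 5), (0, 3, 5), (1, 4, 5), (2, 5, 5), (4, 5, 5)],
  [(0, 0, 5), (3, 1, 5), (4, 2, 5), (1, 3, 5), (2, 4, 5), (5, 5, 5)]]

/-- The differentials of the resolution: each term consists of a generator, the degrees of the left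
and the right path, and the coefficient. -/
def dTable : List (List (List (ℕ × ℕ × ℕ × ℤ))) := [
  [[(1, 0, 0, 1), (0, 0, 0, -1)],
   [(3, 0, 0, 1), (0, 0, 0, -1)],
   [(2, 0, 0, 1), (1, 0, 0, -1)],
   [(5, 0, 0, 1), (2, 0, 0, -1)],
   [(4, 0, 0, 1), (3, 0, 0, -1)],
   [(5, 0, 0, 1), (4, 0, 0, -1)],
   [(5, 1, 0, 1), (0, 0, 1, -1)]],
  [[(5, 0, 0, 1), (4, 0, 0, 1), (3, 0, 0, -1), (2, 0, 0, -1), (1, 0, 0, 1), (0, 0, 0, -1)],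
   [(6, 0, 0, 1), (0, 0, 1, -1), (2, 0, 1, -1), (3, 1, 0, -1), (2, 1, 0, -1)],
   [(6, 0, 0, 1), (1, 0, 1, -1), (3, 1, 0, -1)],
   [(6, 0, 0, 1), (1, 0, 1, -1), (4, 0, 1, -1), (5, 1, 0, -1), (4, 1, 0, -1)],
   [(6, 0, 0, 1), (0, 0, 1, -1), (5, 1, 0, -1)],
   [(6, 0, 1, 1), (6, 1, 0, 1), (3, 1, 1, -1), (2, 1, 1, -1), (0, 1, 1, -1)]],
  [[(4, 0, 0, 1), (1, 0, 0, -1), (0, 1, 0, 1)],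
   [(3, 0, 0, 1), (2, 0, 0, -1), (0, 1, 0, 1)],
   [(2, 0, 0, 1), (1, 0, 0, -1), (0, 0, 1, 1)],
   [(5, 0, 0, 1), (0, 1, 1, -1), (2, 1, 0, -1)],
   [(4, 0, 0, 1), (0, 0, 1, -1), (3, 0, 0, -1)],
   [(5, 0, 0, 1), (4, 1, 0, -1)],
   [(5, 0, 0, 1), (0, 1, 1, -1), (4, 0, 1, -1)],
   [(5, 0, 0, 1), (2, 0, 1, -1)]],
  [[(4, 0, 0, 1), (2, 0, 0, 1), (1, 0, 0, 1), (0, 0, 0, -1)],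
   [(5, 0, 0, 1), (3, 0, 0, -1), (2, 1, 0, -1), (0, 1, 0, 1)],
   [(7, 0, 0, 1), (3, 0, 0, -1), (2, 1, 0, -1)],
   [(6, 0, 0, 1), (3, 0, 0, -1)],
   [(7, 0, 0, 1), (3, 0, 0, -1), (1, 0, 1, -1)],
   [(6, 0, 0, 1), (4, 1, 0, -1), (5, 0, 0, -1)],
   [(6, 0, 0, 1), (0, 0, 1, 1), (5, 0, 0, -1)],
   [(7, 0, 0, 1), (5, 0, 0, -1)],
   [(7, 0, 0, 1), (6, 0, 0, -1), (2, 0, 1, 1), (0, 0, 1, -1)]],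
  [[(5, 0, 0, 1), (3, 0, 0, -1), (1, 0, 0, 1), (0, 1, 0, 1)],
   [(7, 0, 0, 1), (2, 0, 0, -1), (1, 0, 0, 1)],
   [(4, 1, 0, 1), (1, 0, 1, 1), (0, 1, 1, 1), (2, 1, 0, -1)],
   [(8, 0, 0, 1), (0, 0, 1, -1), (4, 0, 0, -1), (3, 0, 0, 1)],
   [(6, 1, 0, 1), (1, 0, 1, -1), (5, 1, 0, -1)],
   [(8, 0, 0, 1), (6, 0, 0, 1), (7, 0, 0, -1)],
   [(8, 1, 0, 1), (3, 0, 1, -1), (1, 0, 1, 1), (6, 0, 1, 1)],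
   [(8, 1, 0, 1), (4, 0, 1, -1), (2, 0, 1, 1)]],
  [[(5, 1, 0, 1), (4, 0, 0, -1), (3, 1, 0, -1), (2, 0, 0, -1), (1, 1, 0, 1), (0, 1, 0, -1)],
   [(2, 0, 0, 1), (0, 0, 1, -1)],
   [(7, 0, 0, 1), (3, 1, 0, -1), (2, 0, 0, -1), (1, 0, 1, 1)],
   [(6, 0, 0, 1), (3, 1, 0, -1), (0, 0, 1, -1)],
   [(6, 0, 0, 1), (4, 0, 0, 1), (5, 1, 0, -1)],
   [(4, 0, 0, 1), (1, 0, 1, 1)],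
   [(7, 0, 0, 1), (5, 1, 0, -1)],
   [(7, 0, 0, 1), (6, 0, 0, -1), (1, 0, 1, 1), (3, 0, 1, -1), (5, 0, 1, 1)],
   [(2, 0, 1, 1), (7, 1, 0, 1)]],
  [[(4, 0, 0, 1), (3, 0, 0, -1), (1, 0, 0, 1), (0, 0, 0, 1)],
   [(6, 0, 0, 1), (5, 0, 0, 1), (2, 0, 0, -1), (0, 0, 0, 1)],
   [(7, 0, 0, 1), (2, 0, 0, -1), (3, 0, 0, 1), (1, 0, 0, -1)],
   [(8, 0, 0, 1), (7, 1, 0, -1), (3, 1, 0, -1), (0, 0, 1, 1)],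
   [(7, 0, 0, 1), (5, 0, 0, -1), (4, 0, 0, 1), (6, 0, 0, -1)],
   [(8, 0, 0, 1), (6, 1, 0, -1)],
   [(8, 0, 0, 1), (1, 0, 1, -1)],
   [(8, 0, 0, 1), (7, 1, 0, -1), (0, 0, 1, 1), (5, 0, 1, 1)]],
  [[(4, 0, 0, 1), (2, 0, 0, -1), (1, 0, 0, 1), (0, 0, 0, -1)],
   [(6, 0, 0, 1), (3, 0, 0, -1), (0, 0, 1, 1), (2, 1, 0, -1)],
   [(7, 0, 0, 1), (3, 0, 0, -1)],
   [(7, 0, 0, 1), (1, 0, 1, -1), (5, 0, 0, -1), (4, 1, 0, 1)],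
   [(6, 0, 0, 1), (5, 0, 0, -1)],
   [(7, 1, 0, 1), (6, 1, 0, -1), (3, 0, 1, 1), (2, 1, 1, 1), (1, 1, 1, -1), (5, 0, 1, -1)]],
  [[(4, 0, 0, 1), (3, 0, 0, -1), (1, 0, 0, -1), (0, 0, 1, -1), (0, 1, 0, 1), (2, 0, 0, 1)],
   [(5, 0, 0, 1), (1, 1, 0, 1), (0, 1, 1, 1), (2, 1, 0, -1)],
   [(5, 0, 0, 1), (0, 1, 1, 1), (2, 0, 1, 1), (2, 1, 0, -1)],
   [(5, 0, 0, 1), (3, 1, 0, -1), (4, 1, 0, 1)],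
   [(5, 0, 0, 1), (4, 0, 1, -1), (4, 1, 0, 1)],
   [(5, 0, 0, 1), (1, 0, 1, 1), (4, 0, 1, -1)],
   [(5, 0, 0, 1), (0, 1, 1, 1), (2, 0, 1, 1), (3, 0, 1, -1)]],
  [[(3, 0, 0, 1), (1, 0, 0, -1), (0, 1, 0, -1)],
   [(2, 0, 0, 1), (1, 0, 0, -1)],
   [(6, 0, 0, 1), (2, 0, 0, -1)],
   [(4, 0, 0, 1), (3, 0, 0, -1)],
   [(5, 0, 0, 1), (4, 0, 0, -1)],
   [(6, 0, 0, 1), (0, 0, 1, -1), (5, 0, 0, -1)]],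
  [[(5, 1, 0, 1), (0, 0, 1, -1), (4, 1, 0, 1), (3, 1, 0, 1), (2, 1, 0, -1), (1, 1, 0, -1),
    (0, 1, 0, 1)],
   [(5, 1, 0, 1), (0, 0, 1, -1), (3, 0, 1, -1), (4, 1, 0, 1), (3, 1, 0, 1)],
   [(5, 1, 0, 1), (0, 0, 1, -1), (3, 0, 1, -1), (4, 0, 1, -1), (4, 1, 0, 1)],
   [(5, 1, 0, 1), (0, 0, 1, -1), (1, 0, 1, 1), (2, 1, 0, -1), (1, 1, 0, -1)],
   [(5, 1, 0, 1), (0, 0, 1, -1), (1, 0, 1, 1), (2, 0, 1, 1), (2, 1, 0, -1)],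
   [(5, 1, 0, 1), (0, 0, 1, -1), (1, 0, 1, 1), (2, 0, 1, 1), (3, 0, 1, -1), (4, 0, 1, -1),
    (5, 0, 1, -1)]]]

/-- The contracting homotopy: each term consists of the type of the source and the degree of the
right path, followed by a generator, the degrees of the left and the right path, and the
coefficient. -/
def hTable : List (List (List (ℕ × ℕ × ℕ × ℕ × ℕ × ℤ))) := [
  [[(0, 1, 6, 0, 0, -1), (0, 1, 0, 1, 0, 1), (0, 1, 2, 1, 0, 1), (0, 1, 3, 1, 0, 1),
    (1, 1, 6, 0, 0, -1), (1, 1, 2, 1, 0, 1), (1, 1, 3, 1, 0, 1), (2, 1, 6, 0, 0, -1),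
    (2, 1, 3, 1, 0, 1), (3, 1, 6, 0, 0, -1), (3, 1, 4, 1, 0, 1), (3, 1, 5, 1, 0, 1),
    (4, 1, 6, 0, 0, -1), (4, 1, 5, 1, 0, 1), (5, 1, 6, 0, 0, -1)],
   [(0, 0, 0, 0, 0, 1), (1, 1, 6, 0, 0, -1), (1, 1, 0, 0, 1, 1), (1, 1, 2, 1, 0, 1),
    (1, 1, 3, 1, 0, 1), (2, 1, 6, 0, 0, -1), (2, 1, 0, 0, 1, 1), (2, 1, 3, 1, 0, 1),
    (5, 1, 6, 0, 0, -1), (5, 1, 0, 0, 1, 1)],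
   [(0, 0, 0, 0, 0, 1), (0, 0, 2, 0, 0, 1), (1, 0, 2, 0, 0, 1), (2, 1, 6, 0, 0, -1),
    (2, 1, 0, 0, 1, 1), (2, 1, 2, 0, 1, 1), (2, 1, 3, 1, 0, 1), (5, 1, 6, 0, 0, -1),
    (5, 1, 0, 0, 1, 1), (5, 1, 2, 0, 1, 1)],
   [(0, 0, 1, 0, 0, 1), (3, 1, 6, 0, 0, -1), (3, 1, 1, 0, 1, 1), (3, 1, 4, 1, 0, 1),
    (3, 1, 5, 1, 0, 1), (4, 1, 6, 0, 0, -1), (4, 1, 1, 0, 1, 1), (4, 1, 5, 1, 0, 1),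
    (5, 1, 6, 0, 0, -1), (5, 1, 1, 0, 1, 1)],
   [(0, 0, 1, 0, 0, 1), (0, 0, 4, 0, 0, 1), (3, 0, 4, 0, 0, 1), (4, 1, 6, 0, 0, -1),
    (4, 1, 1, 0, 1, 1), (4, 1, 4, 0, 1, 1), (4, 1, 5, 1, 0, 1), (5, 1, 6, 0, 0, -1),
    (5, 1, 1, 0, 1, 1), (5, 1, 4, 0, 1, 1)],
   [(0, 0, 0, 0, 0, 1), (0, 0, 2, 0, 0, 1), (0, 0, 3, 0, 0, 1), (1, 0, 2, 0, 0, 1),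
    (1, 0, 3, 0, 0, 1), (2, 0, 3, 0, 0, 1), (3, 0, 4, 0, 0, 1), (3, 0, 5, 0, 0, 1),
    (4, 0, 5, 0, 0, 1), (5, 1, 6, 0, 0, -1), (5, 1, 0, 0, 1, 1), (5, 1, 2, 0, 1, 1),
    (5, 1, 3, 0, 1, 1)]],
  [[(0, 1, 4, 0, 0, -1), (0, 1, 0, 1, 0, -1), (3, 1, 4, 0, 0, -1), (4, 1, 4, 0, 0, -1)],
   [(0, 1, 2, 0, 0, -1), (1, 1, 2, 0, 0, -1), (2, 1, 2, 0, 0, -1)],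
   [(1, 1, 1, 0, 0, -1)],
   [(2, 1, 0, 0, 1, -1), (2, 1, 2, 0, 0, -1)],
   [(3, 1, 3, 0, 0, -1)],
   [(0, 0, 0, 0, 0, 1), (4, 1, 0, 0, 1, 1), (4, 1, 4, 0, 0, -1), (5, 1, 0, 0, 1, 1)],
   [(5, 1, 5, 0, 0, 1)]],
  [[(0, 1, 2, 0, 0, 1), (0, 1, 0, 0, 0, -1), (1, 1, 2, 0, 0, 1), (3, 1, 4, 0, 0, -1)],
   [(0, 0, 0, 0, 0, -1), (1, 1, 0, 0, 1, -1), (1, 1, 2, 1, 0, 1), (2, 1, 0, 0, 1, -1),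
    (5, 1, 6, 0, 0, -1), (5, 1, 0, 0, 1, -1)],
   [(2, 1, 3, 0, 0, 1), (2, 1, 7, 0, 0, -1), (5, 1, 7, 0, 0, -1)],
   [(0, 0, 1, 0, 0, 1), (3, 1, 4, 1, 0, 1), (3, 1, 1, 0, 1, 1), (4, 1, 1, 0, 1, 1),
    (5, 1, 1, 0, 1, 1), (5, 1, 7, 0, 0, -1)],
   [(4, 1, 6, 0, 0, -1), (4, 1, 5, 0, 0, 1), (5, 1, 6, 0, 0, -1)],
   [(0, 0, 5, 0, 0, 1), (1, 0, 3, 0, 0, 1), (1, 0, 2, 1, 0, 1), (2, 0, 3, 0, 0, 1),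
    (3, 0, 5, 0, 0, 1), (4, 0, 5, 0, 0, 1), (5, 1, 6, 1, 0, -1), (5, 1, 3, 0, 1, 1),
    (5, 1, 0, 1, 1, -1), (5, 1, 2, 1, 1, 1)]],
  [[(0, 1, 6, 0, 0, 1), (0, 1, 0, 1, 0, -1), (0, 1, 5, 0, 0, -1), (3, 1, 6, 0, 0, 1),
    (3, 1, 5, 0, 0, -1), (4, 1, 6, 0, 0, 1)],
   [(0, 1, 4, 0, 0, -1), (0, 1, 1, 0, 0, 1), (0, 1, 7, 0, 0, 1), (1, 1, 4, 0, 0, -1),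
    (1, 1, 2, 0, 0, 1), (2, 1, 4, 0, 0, -1)],
   [(1, 1, 0, 0, 1, 1), (1, 1, 4, 0, 0, 1), (1, 1, 2, 0, 0, -1), (2, 1, 0, 0, 1, 1),
    (2, 1, 4, 0, 0, 1), (5, 1, 8, 0, 0, 1)],
   [(0, 0, 1, 0, 0, -1), (2, 1, 4, 1, 0, -1), (2, 1, 1, 0, 1, -1), (2, 1, 0, 1, 1, -1),
    (5, 1, 8, 1, 0, -1)],
   [(0, 0, 0, 0, 0, 1), (3, 1, 6, 0, 0, 1), (3, 1, 0, 0, 1, 1), (3, 1, 5, 0, 0, -1),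
    (4, 1, 6, 0, 0, 1), (4, 1, 0, 0, 1, 1), (5, 1, 8, 0, 0, -1), (5, 1, 0, 0, 1, 1)],
   [(4, 1, 6, 1, 0, -1), (4, 1, 1, 0, 1, 1), (5, 1, 1, 0, 1, 1)],
   [(0, 0, 0, 1, 0, 1), (0, 0, 5, 0, 0, 1), (1, 0, 3, 0, 0, 1), (2, 0, 3, 0, 0, 1),
    (3, 0, 5, 0, 0, 1), (5, 1, 8, 1, 0, -1), (5, 1, 3, 0, 1, 1)],
   [(0, 0, 7, 0, 0, 1), (1, 0, 2, 0, 0, 1), (3, 0, 7, 0, 0, 1), (4, 0, 7, 0, 0, 1),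
    (5, 1, 1, 0, 1, 1), (5, 1, 7, 0, 1, 1)]],
  [[(0, 1, 3, 0, 0, -1), (0, 1, 0, 0, 0, -1), (0, 1, 5, 0, 0, 1)],
   [(0, 1, 4, 0, 0, -1), (1, 1, 2, 0, 0, 1), (3, 1, 4, 0, 0, -1)],
   [(0, 0, 1, 0, 0, -1), (1, 1, 2, 0, 0, 1), (1, 1, 1, 0, 1, -1), (2, 1, 1, 0, 1, -1),
    (5, 1, 1, 0, 1, -1)],
   [(0, 0, 0, 0, 0, -1), (2, 1, 0, 0, 1, -1)],
   [(2, 1, 3, 1, 0, 1), (2, 1, 1, 0, 1, -1), (2, 1, 7, 0, 0, -1), (5, 1, 1, 0, 1, -1),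
    (5, 1, 7, 0, 0, -1)],
   [(3, 1, 0, 0, 1, 1), (3, 1, 4, 0, 0, 1), (4, 1, 0, 0, 1, 1), (5, 1, 0, 0, 1, 1)],
   [(4, 1, 6, 0, 0, 1), (4, 1, 5, 1, 0, -1), (5, 1, 6, 0, 0, 1)],
   [(4, 1, 1, 0, 1, 1)],
   [(0, 0, 5, 0, 0, 1), (1, 0, 3, 0, 0, 1), (2, 0, 3, 0, 0, 1), (3, 0, 5, 0, 0, 1),
    (4, 0, 5, 0, 0, 1), (5, 1, 1, 0, 1, -1), (5, 1, 7, 0, 0, -1), (5, 1, 3, 0, 1, 1)]],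
  [[(0, 1, 1, 0, 0, -1), (0, 1, 0, 0, 0, -1), (1, 1, 1, 0, 0, -1)],
   [(0, 1, 5, 0, 0, 1), (3, 1, 5, 0, 0, 1)],
   [(0, 0, 0, 0, 0, -1), (1, 1, 0, 0, 1, -1), (1, 1, 1, 1, 0, 1), (2, 1, 8, 0, 0, 1),
    (5, 1, 8, 0, 0, 1)],
   [(2, 1, 3, 0, 0, -1), (2, 1, 7, 0, 0, -1)],
   [(3, 1, 0, 0, 1, -1), (3, 1, 5, 1, 0, 1), (4, 1, 0, 0, 1, -1), (4, 1, 6, 1, 0, -1),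
    (4, 1, 7, 1, 0, 1), (5, 1, 0, 0, 1, -1), (5, 1, 7, 1, 0, 1), (5, 1, 8, 0, 0, -1)],
   [(4, 1, 7, 0, 0, 1), (4, 1, 6, 0, 0, -1), (5, 1, 7, 0, 0, 1)],
   [(0, 0, 4, 0, 0, 1), (1, 0, 3, 0, 0, 1), (1, 0, 1, 0, 0, -1), (2, 0, 3, 0, 0, 1),
    (3, 0, 4, 0, 0, 1), (5, 1, 3, 0, 1, 1)],
   [(0, 0, 6, 0, 0, 1), (1, 0, 2, 0, 0, 1), (3, 0, 6, 0, 0, 1), (4, 0, 6, 0, 0, 1),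
    (5, 1, 2, 0, 1, 1), (5, 1, 8, 0, 0, 1)]],
  [[(0, 1, 3, 0, 0, 1), (0, 1, 1, 1, 0, -1), (0, 1, 5, 0, 0, -1), (0, 1, 2, 1, 0, 1),
    (2, 1, 3, 0, 0, 1)],
   [(1, 1, 3, 0, 0, 1), (1, 1, 6, 0, 0, -1), (1, 1, 2, 1, 0, 1), (2, 1, 6, 0, 0, -1),
    (5, 1, 6, 0, 0, -1)],
   [(0, 0, 1, 0, 0, -1), (1, 1, 1, 0, 1, -1), (2, 1, 3, 0, 0, 1), (2, 1, 1, 0, 1, -1)],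
   [(0, 0, 0, 0, 0, -1), (2, 1, 3, 0, 0, 1), (2, 1, 0, 0, 1, -1), (2, 1, 6, 0, 0, -1)],
   [(3, 1, 0, 0, 1, 1), (4, 1, 0, 0, 1, 1), (5, 1, 0, 0, 1, 1), (5, 1, 6, 0, 0, 1)],
   [(3, 1, 7, 0, 0, 1), (3, 1, 4, 1, 0, 1), (3, 1, 5, 0, 0, -1), (4, 1, 7, 0, 0, 1),
    (4, 1, 5, 0, 0, -1), (5, 1, 7, 0, 0, 1)],
   [(4, 1, 7, 0, 0, -1), (4, 1, 1, 0, 1, 1), (4, 1, 5, 0, 0, 1), (5, 1, 7, 0, 0, -1),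
    (5, 1, 1, 0, 1, 1)],
   [(0, 0, 2, 0, 0, 1), (0, 0, 1, 0, 0, -1), (0, 0, 0, 0, 0, 1), (1, 0, 2, 0, 0, 1),
    (3, 0, 4, 0, 0, 1), (5, 1, 2, 0, 1, 1), (5, 1, 6, 0, 0, -1)],
   [(0, 0, 5, 0, 0, 1), (1, 0, 3, 0, 0, 1), (1, 0, 2, 1, 0, 1), (3, 0, 5, 0, 0, 1),
    (4, 0, 5, 0, 0, 1), (5, 1, 1, 1, 1, 1), (5, 1, 7, 1, 0, -1), (5, 1, 5, 0, 1, 1)]],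
  [[(0, 1, 1, 0, 0, 1), (0, 1, 4, 0, 0, -1), (1, 1, 1, 0, 0, 1)],
   [(0, 1, 3, 0, 0, -1), (0, 1, 0, 1, 0, 1), (0, 1, 2, 0, 0, 1), (3, 1, 3, 0, 0, -1)],
   [(1, 1, 1, 0, 0, -1), (1, 1, 0, 0, 1, -1), (2, 1, 0, 0, 1, -1)],
   [(2, 1, 0, 1, 1, 1), (2, 1, 5, 0, 0, 1), (2, 1, 2, 1, 0, -1), (5, 1, 5, 0, 0, 1)],
   [(0, 0, 0, 0, 0, 1), (3, 1, 0, 0, 1, 1), (3, 1, 3, 0, 0, 1), (4, 1, 0, 0, 1, 1),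
    (5, 1, 0, 0, 1, 1)],
   [(4, 1, 5, 0, 0, -1), (4, 1, 4, 1, 0, -1)],
   [(0, 0, 4, 0, 0, 1), (3, 0, 4, 0, 0, 1), (4, 0, 4, 0, 0, 1), (5, 1, 4, 0, 1, 1)],
   [(0, 0, 2, 0, 0, 1), (1, 0, 2, 0, 0, 1), (2, 0, 2, 0, 0, 1), (5, 1, 2, 0, 1, 1),
    (5, 1, 5, 0, 0, 1)]],
  [[(0, 1, 0, 0, 0, -1)],
   [(1, 1, 1, 0, 0, -1), (1, 1, 5, 0, 0, 1), (2, 1, 5, 0, 0, 1), (5, 1, 5, 0, 0, 1)],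
   [(2, 1, 2, 0, 0, 1)],
   [(3, 1, 6, 0, 0, -1), (3, 1, 3, 0, 0, 1), (4, 1, 6, 0, 0, -1), (5, 1, 6, 0, 0, -1)],
   [(4, 1, 4, 0, 0, -1)],
   [(0, 0, 3, 0, 0, 1), (1, 0, 1, 0, 0, 1), (3, 0, 3, 0, 0, 1), (5, 1, 5, 1, 0, -1),
    (5, 1, 1, 0, 1, 1)]],
  [[(0, 1, 5, 0, 0, -1), (0, 1, 0, 0, 0, -1), (0, 1, 1, 0, 0, 1), (0, 1, 2, 0, 0, 1),
    (0, 1, 3, 0, 0, -1), (0, 1, 4, 0, 0, -1), (1, 1, 5, 0, 0, -1), (1, 1, 1, 0, 0, 1),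
    (1, 1, 2, 0, 0, 1), (2, 1, 5, 0, 0, -1), (2, 1, 2, 0, 0, 1), (3, 1, 5, 0, 0, -1),
    (3, 1, 3, 0, 0, -1), (3, 1, 4, 0, 0, -1), (4, 1, 5, 0, 0, -1), (4, 1, 4, 0, 0, -1),
    (5, 1, 5, 0, 0, -1)],
   [(0, 0, 0, 0, 0, -1), (1, 1, 5, 1, 0, 1), (1, 1, 0, 0, 1, -1), (1, 1, 1, 1, 0, -1),
    (1, 1, 2, 1, 0, -1), (2, 1, 5, 1, 0, 1), (2, 1, 0, 0, 1, -1), (2, 1, 2, 1, 0, -1)],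
   [(0, 0, 0, 0, 0, -1), (0, 0, 1, 0, 0, 1), (1, 0, 1, 0, 0, 1), (2, 1, 5, 1, 0, 1),
    (2, 1, 0, 0, 1, -1), (2, 1, 1, 0, 1, 1), (2, 1, 2, 1, 0, -1), (5, 1, 1, 0, 1, 1)],
   [(3, 1, 5, 1, 0, -1), (3, 1, 0, 0, 1, 1), (3, 1, 3, 1, 0, -1), (3, 1, 4, 1, 0, -1),
    (4, 1, 5, 1, 0, -1), (4, 1, 0, 0, 1, 1), (4, 1, 4, 1, 0, -1), (5, 1, 5, 1, 0, -1),
    (5, 1, 0, 0, 1, 1)],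
   [(0, 0, 3, 0, 0, 1), (3, 0, 3, 0, 0, 1), (4, 1, 5, 1, 0, -1), (4, 1, 0, 0, 1, 1),
    (4, 1, 3, 0, 1, 1), (4, 1, 4, 1, 0, -1), (5, 1, 0, 0, 1, 1), (5, 1, 5, 1, 0, -1),
    (5, 1, 3, 0, 1, 1)],
   [(0, 0, 3, 0, 0, 1), (0, 0, 4, 0, 0, 1), (3, 0, 3, 0, 0, 1), (3, 0, 4, 0, 0, 1),
    (4, 0, 4, 0, 0, 1), (5, 1, 0, 0, 1, 1), (5, 1, 5, 1, 0, -1), (5, 1, 3, 0, 1, 1),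
    (5, 1, 4, 0, 1, 1)],
   [(0, 0, 0, 0, 0, -1), (0, 0, 1, 0, 0, 1), (0, 0, 2, 0, 0, 1), (1, 0, 1, 0, 0, 1),
    (1, 0, 2, 0, 0, 1), (2, 0, 2, 0, 0, 1), (5, 1, 1, 0, 1, 1), (5, 1, 2, 0, 1, 1)]],
  [[(0, 1, 0, 0, 0, -1)],
   [(1, 1, 3, 0, 0, 1)],
   [(2, 1, 4, 0, 0, 1)],
   [(3, 1, 1, 0, 0, -1)],
   [(4, 1, 2, 0, 0, -1)],
   [(5, 1, 5, 0, 0, -1)]]]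

/-- The automorphism of the quiver exchanging the arrows `α` and `β`, on types. -/
def theta (i : ℕ) : ℕ := [0, 3, 4, 1, 2, 5].getD i i

/-- Whether the resolution is twisted in degree `n`. -/
def odd11 (n : ℕ) : Bool := Nat.beq (n / 11 % 2) 1

/-- The data attached to a generator of degree `n`. -/
def gen (n c : ℕ) : ℕ × ℕ × ℕ := (genTable.getD (n % 11) []).getD c (6, 6, 0)

/-- The type of the left vertex of a generator of degree `n`. -/
def cl (n c : ℕ) : ℕ := (gen n c).1

/-- The type of the right vertex of a generator of degree `n`. -/
def cr (n c : ℕ) : ℕ := if odd11 n then theta (gen n c).2.1 else (gen n c).2.1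

/-- The block of the right vertex of a generator of degree `n`, relative to the left vertex. -/
def cM (n c : ℕ) : ℤ := -((gen n c).2.2 : ℤ) - 6 * ((n / 11 : ℕ) : ℤ)

/-- The sign `(-1) ^ k`. -/
def altSign (k : ℕ) : ℤ := if Nat.beq (k % 2) 1 then -1 else 1

/-- Formal linear combinations: each term consists of a generator, the degrees of the left and the
right path, and the coefficient. -/
abbrev Comb : Type := List (ℕ × ℕ × ℕ × ℤ)

/-- The differential of a generator of degree `n + 1`. -/
def dRow (n c : ℕ) : Comb :=
  let row := (dTable.getD (n % 11) []).getD c []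
  if odd11 n then row.map fun x => (x.1, x.2.1, x.2.2.1, altSign x.2.2.1 * x.2.2.2) else row

/-- The contracting homotopy on a generator of degree `n` multiplied by a path of degree `v` from
a vertex of type `j`. -/
def hRow (n c j v : ℕ) : Comb :=
  let row := (hTable.getD (n % 11) []).getD c []
  if odd11 n then
    (row.filter fun x => Nat.beq x.1 (theta j) && Nat.beq x.2.1 v).map
      fun x => (x.2.2.1, x.2.2.2.1, x.2.2.2.2.1, altSign (v + x.2.2.2.2.1) * x.2.2.2.2.2)
  else (row.filter fun x => Nat.beq x.1 j && Nat.beq x.2.1 v).map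
      fun x => (x.2.2.1, x.2.2.2.1, x.2.2.2.2.1, x.2.2.2.2.2)

/-- Evaluation of a function, organised so that the kernel reduces the argument first. -/
def force {α : Type*} (n : ℕ) (f : ℕ → α) : α :=
  match n with
  | 0 => f 0
  | m + 1 => f (m + 1)

@[simp] theorem force_eq {α : Type*} (n : ℕ) (f : ℕ → α) : force n f = f n := by
  cases n <;> rfl

/-- Evaluation of a function, organised so that the kernel reduces the argument first. -/
def forceInt {α : Type*} (a : ℤ) (f : ℤ → α) : α :=
  match a with
  | Int.ofNat n => force n fun n => f (Int.ofNat n)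
  | Int.negSucc n => force n fun n => f (Int.negSucc n)

@[simp] theorem forceInt_eq {α : Type*} (a : ℤ) (f : ℤ → α) : forceInt a f = f a := by
  cases a <;> simp [forceInt]

/-- Concatenation of formal linear combinations, organised so that the kernel reduces all the
entries. -/
def evalAppend : Comb → Comb → Comb
  | [], acc => acc
  | x :: L, acc => force x.1 fun c => force x.2.1 fun u => force x.2.2.1 fun v =>
      forceInt x.2.2.2 fun a => evalAppend L ((c, u, v, a) :: acc)

theorem evalAppend_eq (L acc : Comb) : evalAppend L acc = L.reverse ++ acc := by
  induction L generalizing acc with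
  | nil => rfl
  | cons x L ih => simp [evalAppend, ih]

/-- Whether a generator can be multiplied by paths of degrees `u` and `v`, ending at a vertex of
type `i` and starting at one of type `j`. -/
def okk (n i j : ℕ) (c u v : ℕ) : Bool :=
  force (cl n c) fun l => force (cr n c) fun r => force u fun u => force v fun v =>
    ok l i u && ok j r v

/-- The differential on formal linear combinations. -/
def fd (n i j : ℕ) (L : Comb) : Comb :=
  evalAppend (L.flatMap fun t => if okk (n + 1) i j t.1 t.2.1 t.2.2.1 then
    (dRow n t.1).map fun x => (x.1, t.2.1 + x.2.1, t.2.2.1 + x.2.2.1, t.2.2.2 * x.2.2.2) else []) []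

/-- The contracting homotopy on formal linear combinations. -/
def fh (n i j : ℕ) (L : Comb) : Comb :=
  evalAppend (L.flatMap fun t => if okk n i j t.1 t.2.1 t.2.2.1 then
    (hRow n t.1 j t.2.2.1).map fun x => (x.1, t.2.1 + x.2.1, x.2.2.1, t.2.2.2 * x.2.2.2) else []) []

/-- Whether two terms involve the same basis element. -/
def sameKey (x y : ℕ × ℕ × ℕ × ℤ) : Bool :=
  Nat.beq x.1 y.1 && Nat.beq x.2.1 y.2.1 && Nat.beq x.2.2.1 y.2.2.1

/-- Whether a formal linear combination vanishes. -/
def vanish (n i j : ℕ) (L : Comb) : Bool :=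
  L.all fun t => !okk n i j t.1 t.2.1 t.2.2.1 ||
    (((L.filter (sameKey t)).map fun x => x.2.2.2).sum == 0)

/-- The rows of the differential are homogeneous. -/
def chkD (n c : ℕ) : Bool :=
  (dRow n c).all fun x => ok (cl n x.1) (cl (n + 1) c) x.2.1 &&
    ok (cr (n + 1) c) (cr n x.1) x.2.2.1 &&
    (cM n x.1 == cM (n + 1) c + (x.2.1 : ℤ) + (x.2.2.1 : ℤ))

/-- The rows of the contracting homotopy are homogeneous. -/
def chkH (n c j v : ℕ) : Bool :=
  (hRow n c j v).all fun x => ok (cl (n + 1) x.1) (cl n c) x.2.1 && ok j (cr (n + 1) x.1) x.2.2.1 &&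
    (cM (n + 1) x.1 == cM n c + (x.2.2.1 : ℤ) + (x.2.1 : ℤ) - (v : ℤ))

/-- The composite of two differentials vanishes. -/
def chkDD (n c : ℕ) : Bool :=
  vanish n (cl (n + 2) c) (cr (n + 2) c) (fd n (cl (n + 2) c) (cr (n + 2) c) (dRow (n + 1) c))

/-- The homotopy contracts the complex in positive degrees. -/
def chkA (n j c v : ℕ) : Bool :=
  !ok j (cr (n + 1) c) v || vanish (n + 1) (cl (n + 1) c) j
    ((c, 0, v, -1) :: (fd (n + 1) (cl (n + 1) c) j (fh (n + 1) (cl (n + 1) c) j [(c, 0, v, 1)]) ++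
      fh n (cl (n + 1) c) j (fd n (cl (n + 1) c) j [(c, 0, v, 1)])))

/-- The homotopy contracts the complex in degree zero. -/
def chkB (j c v : ℕ) : Bool :=
  !ok j (cr 0 c) v || vanish 0 (cl 0 c) j
    ((c, 0, v, -1) :: (j, v, 0, 1) :: fd 0 (cl 0 c) j (fh 0 (cl 0 c) j [(c, 0, v, 1)]))

/-- Bounded universal quantification. -/
def allBelow (n : ℕ) (p : ℕ → Bool) : Bool := (List.range n).all p

theorem allBelow_iff {n : ℕ} {p : ℕ → Bool} : allBelow n p = true ↔ ∀ k < n, p k = true := by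
  simp [allBelow]

theorem chkD_small : (allBelow 22 fun n => allBelow 9 fun c => chkD n c) = true := by
  decide +kernel

theorem chkH_small : (allBelow 22 fun n => allBelow 9 fun c => allBelow 6 fun j =>
    allBelow 2 fun v => chkH n c j v) = true := by
  decide +kernel

theorem chkDD_small : (allBelow 22 fun n => allBelow 9 fun c => chkDD n c) = true := by
  decide +kernel

theorem chkA_small : (allBelow 22 fun n => allBelow 6 fun j =>
    allBelow 9 fun c => allBelow 2 fun v => chkA n j c v) = true := by
  decide +kernel

theorem chkB_small : (allBelow 6 fun j =>
    allBelow 9 fun c => allBelow 2 fun v => chkB j c v) = true := by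
  decide +kernel

end Tables

section Checks

variable {n m : ℕ}

theorem odd11_congr (h : n % 22 = m % 22) : odd11 n = odd11 m := by
  have : n / 11 % 2 = m / 11 % 2 := by omega
  rw [odd11, odd11, this]

theorem gen_congr (h : n % 22 = m % 22) : gen n = gen m := by
  have : n % 11 = m % 11 := by omega
  funext c
  rw [gen, gen, this]

theorem cl_congr (h : n % 22 = m % 22) : cl n = cl m := by
  funext c
  rw [cl, cl, gen_congr h]

theorem cr_congr (h : n % 22 = m % 22) : cr n = cr m := by
  funext c
  rw [cr, cr, gen_congr h, odd11_congr h]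

theorem dRow_congr (h : n % 22 = m % 22) : dRow n = dRow m := by
  have : n % 11 = m % 11 := by omega
  funext c
  rw [dRow, dRow, this, odd11_congr h]

theorem hRow_congr (h : n % 22 = m % 22) : hRow n = hRow m := by
  have : n % 11 = m % 11 := by omega
  funext c j v
  rw [hRow, hRow, this, odd11_congr h]

theorem okk_congr (h : n % 22 = m % 22) : okk n = okk m := by
  funext i j c u v
  rw [okk, okk, cl_congr h, cr_congr h]

theorem fd_congr (h : n % 22 = m % 22) : fd n = fd m := by
  funext i j L
  rw [fd, fd, okk_congr (show (n + 1) % 22 = (m + 1) % 22 by omega), dRow_congr h]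

theorem fh_congr (h : n % 22 = m % 22) : fh n = fh m := by
  funext i j L
  rw [fh, fh, okk_congr h, hRow_congr h]

theorem vanish_congr (h : n % 22 = m % 22) : vanish n = vanish m := by
  funext i j L
  rw [vanish, vanish, okk_congr h]

theorem cM_add (n c k : ℕ) : cM (n % 22 + k) c = cM (n + k) c + 12 * ((n / 22 : ℕ) : ℤ) := by
  have h : (n % 22 + k) % 22 = (n + k) % 22 := by omega
  have h' : ((n % 22 + k) / 11 : ℕ) + 2 * (n / 22) = (n + k) / 11 := by omega
  rw [cM, cM, gen_congr h, ← h']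
  push_cast
  ring

theorem lt_nine {c : ℕ} (h : cl n c < 6) : c < 9 := by
  have key : ∀ k < 11, (genTable.getD k []).length ≤ 9 := by decide
  by_contra! hc
  have h1 := key (n % 11) (Nat.mod_lt _ (by norm_num))
  rw [cl, gen, List.getD_eq_default _ _ (by omega)] at h
  simp at h

theorem lt_nine_of_ok {c i u : ℕ} (h : ok (cl n c) i u = true) : c < 9 := lt_nine (ok_lt h).1

theorem okk_iff {i j c u v : ℕ} :
    okk n i j c u v = true ↔ ok (cl n c) i u = true ∧ ok j (cr n c) v = true := by
  simp [okk]

theorem dRow_spec {c : ℕ} (hc : c < 9) {x : ℕ × ℕ × ℕ × ℤ} (hx : x ∈ dRow n c) :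
    ok (cl n x.1) (cl (n + 1) c) x.2.1 = true ∧ ok (cr (n + 1) c) (cr n x.1) x.2.2.1 = true ∧
      cM n x.1 = cM (n + 1) c + x.2.1 + x.2.2.1 := by
  have h0 : n % 22 % 22 = n % 22 := by omega
  have h1 : (n % 22 + 1) % 22 = (n + 1) % 22 := by omega
  have h := chkD_small
  simp only [allBelow_iff] at h
  have h2 := h (n % 22) (Nat.mod_lt _ (by norm_num)) c hc
  rw [chkD, List.all_eq_true] at h2
  have h3 := h2 x (by rwa [dRow_congr h0])
  simp only [Bool.and_eq_true, beq_iff_eq, cl_congr h0, cl_congr h1, cr_congr h0, cr_congr h1] at h3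
  have e0 := cM_add n x.1 0
  have e1 := cM_add n c 1
  simp only [add_zero] at e0
  exact ⟨h3.1.1, h3.1.2, by linarith [h3.2]⟩

theorem hRow_spec {c j v : ℕ} (hc : c < 9) (hj : j < 6) (hv : v < 2) {x : ℕ × ℕ × ℕ × ℤ}
    (hx : x ∈ hRow n c j v) :
    ok (cl (n + 1) x.1) (cl n c) x.2.1 = true ∧ ok j (cr (n + 1) x.1) x.2.2.1 = true ∧
      cM (n + 1) x.1 = cM n c + x.2.2.1 + x.2.1 - v := by
  have h0 : n % 22 % 22 = n % 22 := by omega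
  have h1 : (n % 22 + 1) % 22 = (n + 1) % 22 := by omega
  have h := chkH_small
  simp only [allBelow_iff] at h
  have h2 := h (n % 22) (Nat.mod_lt _ (by norm_num)) c hc j hj v hv
  rw [chkH, List.all_eq_true] at h2
  have h3 := h2 x (by rwa [hRow_congr h0])
  simp only [Bool.and_eq_true, beq_iff_eq, cl_congr h0, cl_congr h1, cr_congr h1] at h3
  have e0 := cM_add n c 0
  have e1 := cM_add n x.1 1
  simp only [add_zero] at e0
  exact ⟨h3.1.1, h3.1.2, by linarith [h3.2]⟩

theorem vanish_fd_dRow {c : ℕ} (hc : c < 9) :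
    vanish n (cl (n + 2) c) (cr (n + 2) c)
      (fd n (cl (n + 2) c) (cr (n + 2) c) (dRow (n + 1) c)) = true := by
  have h0 : n % 22 % 22 = n % 22 := by omega
  have h1 : (n % 22 + 1) % 22 = (n + 1) % 22 := by omega
  have h2 : (n % 22 + 2) % 22 = (n + 2) % 22 := by omega
  have h := chkDD_small
  simp only [allBelow_iff] at h
  have h3 := h (n % 22) (Nat.mod_lt _ (by norm_num)) c hc
  rwa [chkDD, vanish_congr h0, fd_congr h0, dRow_congr h1, cl_congr h2, cr_congr h2] at h3

theorem vanish_homotopy {c j v : ℕ} (hc : c < 9) (h : ok j (cr (n + 1) c) v = true) :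
    vanish (n + 1) (cl (n + 1) c) j
      ((c, 0, v, -1) :: (fd (n + 1) (cl (n + 1) c) j (fh (n + 1) (cl (n + 1) c) j [(c, 0, v, 1)]) ++
        fh n (cl (n + 1) c) j (fd n (cl (n + 1) c) j [(c, 0, v, 1)]))) = true := by
  have h0 : n % 22 % 22 = n % 22 := by omega
  have h1 : (n % 22 + 1) % 22 = (n + 1) % 22 := by omega
  have h2 := chkA_small
  simp only [allBelow_iff] at h2
  have h3 := h2 (n % 22) (Nat.mod_lt _ (by norm_num)) j (ok_lt h).1 c hc v (ok_lt h).2.2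
  rwa [chkA, vanish_congr h1, fd_congr h0, fd_congr h1, fh_congr h0, fh_congr h1, cl_congr h1,
    cr_congr h1, h, Bool.not_true, Bool.false_or] at h3

theorem vanish_homotopy_zero {c j v : ℕ} (hc : c < 9) (h : ok j (cr 0 c) v = true) :
    vanish 0 (cl 0 c) j
      ((c, 0, v, -1) :: (j, v, 0, 1) ::
        fd 0 (cl 0 c) j (fh 0 (cl 0 c) j [(c, 0, v, 1)])) = true := by
  have h2 := chkB_small
  simp only [allBelow_iff] at h2
  have h3 := h2 j (ok_lt h).1 c hc v (ok_lt h).2.2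
  rwa [chkB, h, Bool.not_true, Bool.false_or] at h3

end Checks

section Eval

variable {V W : Type*} [AddCommGroup V] [AddCommGroup W]

/-- The value of a formal linear combination, given the values of the basis elements. -/
def evalL (f : ℕ → ℕ → ℕ → V) (L : Comb) : V :=
  (L.map fun t => t.2.2.2 • f t.1 t.2.1 t.2.2.1).sum

variable (f : ℕ → ℕ → ℕ → V)

theorem evalL_nil : evalL f [] = 0 := rfl

theorem evalL_cons (t : ℕ × ℕ × ℕ × ℤ) (L : Comb) :
    evalL f (t :: L) = t.2.2.2 • f t.1 t.2.1 t.2.2.1 + evalL f L := by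
  simp [evalL]

theorem evalL_append (L L' : Comb) : evalL f (L ++ L') = evalL f L + evalL f L' := by
  simp [evalL]

theorem evalL_reverse (L : Comb) : evalL f L.reverse = evalL f L := by
  rw [evalL, evalL, List.map_reverse, List.sum_reverse]

theorem evalL_flatMap (L : Comb) (g : ℕ × ℕ × ℕ × ℤ → Comb) :
    evalL f (L.flatMap g) = (L.map fun t => evalL f (g t)).sum := by
  induction L with
  | nil => rfl
  | cons t L ih => simp [evalL_append, ih]

theorem map_evalL (g : V →+ W) (L : Comb) :
    g (evalL f L) = evalL (fun c u v => g (f c u v)) L := by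
  induction L with
  | nil => simp [evalL_nil]
  | cons t L ih => simp [evalL_cons, ih]

theorem evalL_congr {f g : ℕ → ℕ → ℕ → V} {L : Comb}
    (h : ∀ t ∈ L, f t.1 t.2.1 t.2.2.1 = g t.1 t.2.1 t.2.2.1) : evalL f L = evalL g L := by
  rw [evalL, evalL]
  congr 1
  exact List.map_congr_left fun t ht => by rw [h t ht]

theorem evalL_eq_sum (L : Comb) :
    evalL f L = ((L.map fun t => (Finsupp.single (t.1, t.2.1, t.2.2.1) t.2.2.2 :
      (ℕ × ℕ × ℕ) →₀ ℤ)).sum).sum fun k a => a • f k.1 k.2.1 k.2.2 := by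
  induction L with
  | nil => simp [evalL]
  | cons t L ih =>
    rw [evalL_cons, ih, List.map_cons, List.sum_cons, Finsupp.sum_add_index',
      Finsupp.sum_single_index]
    · simp
    · simp
    · intro k a b
      exact add_smul a b _

theorem sameKey_iff (x y : ℕ × ℕ × ℕ × ℤ) :
    sameKey x y = true ↔ (x.1, x.2.1, x.2.2.1) = (y.1, y.2.1, y.2.2.1) := by
  simp [sameKey, and_assoc]

theorem sum_single_apply (L : Comb) (t : ℕ × ℕ × ℕ × ℤ) :
    ((L.map fun t => (Finsupp.single (t.1, t.2.1, t.2.2.1) t.2.2.2 :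
      (ℕ × ℕ × ℕ) →₀ ℤ)).sum) (t.1, t.2.1, t.2.2.1) =
      ((L.filter (sameKey t)).map fun x => x.2.2.2).sum := by
  induction L with
  | nil => simp
  | cons x L ih =>
    rw [List.map_cons, List.sum_cons, Finsupp.add_apply, ih, List.filter_cons, Finsupp.single_apply]
    by_cases h : sameKey t x = true
    · rw [if_pos h, if_pos ((sameKey_iff t x).1 h).symm, List.map_cons, List.sum_cons]
    · rw [if_neg h, if_neg fun h' => h ((sameKey_iff t x).2 h'.symm), zero_add]

theorem evalL_eq_zero {L : Comb}
    (h : ∀ t ∈ L, f t.1 t.2.1 t.2.2.1 = 0 ∨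
      ((L.filter (sameKey t)).map fun x => x.2.2.2).sum = 0) : evalL f L = 0 := by
  rw [evalL_eq_sum]
  set F := (L.map fun t => (Finsupp.single (t.1, t.2.1, t.2.2.1) t.2.2.2 :
      (ℕ × ℕ × ℕ) →₀ ℤ)).sum with hF
  refine Finset.sum_eq_zero fun k hk => ?_
  have hk' : ∃ t ∈ L, k = (t.1, t.2.1, t.2.2.1) := by
    by_contra! hne
    refine Finsupp.mem_support_iff.1 hk ?_
    have : ∀ L' : Comb, (∀ t ∈ L', k ≠ (t.1, t.2.1, t.2.2.1)) →
        ((L'.map fun t => (Finsupp.single (t.1, t.2.1, t.2.2.1) t.2.2.2 :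
          (ℕ × ℕ × ℕ) →₀ ℤ)).sum) k = 0 := by
      intro L' hL'
      induction L' with
      | nil => simp
      | cons x L' ih =>
        rw [List.map_cons, List.sum_cons, Finsupp.add_apply,
          ih fun t ht => hL' t (List.mem_cons_of_mem _ ht), Finsupp.single_apply,
          if_neg (hL' x List.mem_cons_self).symm, add_zero]
    exact this L hne
  obtain ⟨t, ht, rfl⟩ := hk'
  rcases h t ht with h1 | h1
  · simp [h1]
  · rw [hF, sum_single_apply, h1]
    exact zero_smul ℤ _

theorem evalL_eq_zero_of_vanish {n i j : ℕ} {L : Comb} (h : vanish n i j L = true)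
    (hf : ∀ c u v, okk n i j c u v = false → f c u v = 0) : evalL f L = 0 := by
  refine evalL_eq_zero f fun t ht => ?_
  have := List.all_eq_true.1 h t ht
  simp only [Bool.or_eq_true, Bool.not_eq_true', beq_iff_eq] at this
  exact this.imp_left (hf _ _ _)

theorem evalL_evalAppend (L : Comb) : evalL f (evalAppend L []) = evalL f L := by
  rw [evalAppend_eq, List.append_nil, evalL_reverse]

/-- A product formula for formal linear combinations. -/
theorem evalL_map (L : Comb) (c u v : ℕ → ℕ → ℕ → ℕ) (b : ℤ) :
    evalL f (L.map fun x => (c x.1 x.2.1 x.2.2.1, u x.1 x.2.1 x.2.2.1, v x.1 x.2.1 x.2.2.1,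
      b * x.2.2.2)) = b • evalL (fun x y z => f (c x y z) (u x y z) (v x y z)) L := by
  induction L with
  | nil => simp [evalL_nil]
  | cons t L ih => simp only [List.map_cons, evalL_cons, ih, smul_add, mul_smul]

theorem evalL_fd (n i j : ℕ) (L : Comb) :
    evalL f (fd n i j L) = evalL (fun c u v => if okk (n + 1) i j c u v = true then
      evalL (fun c' u' v' => f c' (u + u') (v + v')) (dRow n c) else 0) L := by
  rw [fd, evalL_evalAppend, evalL_flatMap, evalL]
  congr 1
  refine List.map_congr_left fun t _ => ?_
  split_ifs
  · exact evalL_map f (dRow n t.1) (fun c _ _ => c) (fun _ u _ => t.2.1 + u)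
      (fun _ _ v => t.2.2.1 + v) t.2.2.2
  · simp [evalL_nil]

theorem evalL_fh (n i j : ℕ) (L : Comb) :
    evalL f (fh n i j L) = evalL (fun c u v => if okk n i j c u v = true then
      evalL (fun c' u' v' => f c' (u + u') v') (hRow n c j v) else 0) L := by
  rw [fh, evalL_evalAppend, evalL_flatMap, evalL]
  congr 1
  refine List.map_congr_left fun t _ => ?_
  split_ifs
  · exact evalL_map f (hRow n t.1 j t.2.2.1) (fun c _ _ => c) (fun _ u _ => t.2.1 + u)
      (fun _ _ v => v) t.2.2.2
  · simp [evalL_nil]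

end Eval

section Ambient

variable (K : Type u) [Field K] (s : ℕ)

/-- The element `x ⊗ y` of the enveloping algebra. -/
noncomputable def tn (x y : Alg K s) : Env K s := x ⊗ₜ[K] MulOpposite.op y

variable {K s} in
theorem tn_mul (x y x' y' : Alg K s) : tn K s x y * tn K s x' y' = tn K s (x * x') (y' * y) := by
  rw [tn, tn, tn, MulOpposite.op_mul]
  exact Algebra.TensorProduct.tmul_mul_tmul _ _ _ _

variable {K s} in
theorem tn_zero_left (y : Alg K s) : tn K s 0 y = 0 := TensorProduct.zero_tmul _ _

variable {K s} in
theorem tn_zero_right (x : Alg K s) : tn K s x 0 = 0 := TensorProduct.tmul_zero _ _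

variable {K s} in
theorem tn_smul (x y r : Alg K s) : tn K s x y • r = x * r * y := by
  change x • (MulOpposite.op y • r) = _
  rw [op_smul_eq_mul, smul_eq_mul, mul_assoc]

noncomputable instance : AddCommGroup (Env K s) := Ring.toAddCommGroup

/-- The free module containing the terms of the resolution. -/
abbrev Amb : Type u := (ℕ × ZMod s) →₀ Env K s

/-- The generator `c` of degree `n`, multiplied by the paths of degrees `u` and `v` ending at the
vertex of type `i` in block `a` and starting at the vertex of type `j` in block `b`. -/
noncomputable def elem (n : ℕ) (a : ZMod s) (i : ℕ) (b : ZMod s) (j c u v : ℕ) : Amb K s :=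
  if a - u + (cM n c : ZMod s) = b + v then
    Finsupp.single (c, a - u) (tn K s (bs K s (a - u) (cl n c) i u) (bs K s b j (cr n c) v))
  else 0

/-- The idempotent endomorphism whose image is the term of degree `n` of the resolution. -/
noncomputable def proj (n : ℕ) : Amb K s →ₗ[Env K s] Amb K s :=
  Finsupp.linearCombination (Env K s) fun x : ℕ × ZMod s =>
    elem K s n x.2 (cl n x.1) (x.2 + cM n x.1) (cr n x.1) x.1 0 0

/-- The differential of the resolution, on the ambient free modules. -/
noncomputable def diff (n : ℕ) : Amb K s →ₗ[Env K s] Amb K s :=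
  Finsupp.linearCombination (Env K s) fun x : ℕ × ZMod s =>
    evalL (elem K s n x.2 (cl (n + 1) x.1) (x.2 + cM (n + 1) x.1) (cr (n + 1) x.1)) (dRow n x.1)

/-- The augmentation of the resolution, on the ambient free module. -/
noncomputable def augm : Amb K s →ₗ[Env K s] Alg K s :=
  Finsupp.linearCombination (Env K s) fun x : ℕ × ZMod s => if x.1 < 6 then ev K s x.2 x.1 else 0

variable [NeZero s]

/-- The basis of the enveloping algebra formed by pairs of paths. -/
noncomputable def envBasis : Module.Basis (Idx s × Idx s) K (Env K s) :=
  (pathBasis K s).tensorProduct ((pathBasis K s).map (MulOpposite.opLinearEquiv K))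

/-- The contracting homotopy. -/
noncomputable def htpy (n : ℕ) : Amb K s →ₗ[K] Amb K s :=
  Finsupp.lsum K fun x : ℕ × ZMod s => (envBasis K s).constr K fun y =>
    if x.2 = y.1.1 ∧ cl n x.1 = y.1.2.1.1 ∧ cr n x.1 = y.2.2.1.2.1 ∧
        x.2 + (cM n x.1 : ZMod s) = y.2.1 + (y.2.2.1.2.2 : ZMod s) then
      evalL (fun c u v => elem K s (n + 1) (y.1.1 + (y.1.2.1.2.2 : ZMod s)) y.1.2.1.2.1 y.2.1
        y.2.2.1.1 c (y.1.2.1.2.2 + u) v) (hRow n x.1 y.2.2.1.1 y.2.2.1.2.2)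
    else 0

/-- The contracting homotopy in degree `-1`. -/
noncomputable def sect : Alg K s →ₗ[K] Amb K s :=
  (pathBasis K s).constr K fun x =>
    elem K s 0 (x.1 + (x.2.1.2.2 : ZMod s)) x.2.1.2.1 x.1 x.2.1.1 x.2.1.1 x.2.1.2.2 0

variable {K s}

theorem envBasis_apply (x y : Idx s) : envBasis K s (x, y) = tn K s (path K s x) (path K s y) := by
  rw [envBasis, Module.Basis.tensorProduct_apply, Module.Basis.map_apply, pathBasis_apply,
    pathBasis_apply]
  rfl

theorem elem_of_eq {n : ℕ} {a : ZMod s} {i : ℕ} {b : ZMod s} {j c u v : ℕ}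
    (h : a - u + (cM n c : ZMod s) = b + v) : elem K s n a i b j c u v =
      Finsupp.single (c, a - u) (tn K s (bs K s (a - u) (cl n c) i u) (bs K s b j (cr n c) v)) :=
  if_pos h

theorem elem_of_ne {n : ℕ} {a : ZMod s} {i : ℕ} {b : ZMod s} {j c u v : ℕ}
    (h : ¬ a - u + (cM n c : ZMod s) = b + v) : elem K s n a i b j c u v = 0 :=
  if_neg h

theorem elem_eq_zero {n : ℕ} {a : ZMod s} {i : ℕ} {b : ZMod s} {j c u v : ℕ}
    (h : okk n i j c u v = false) : elem K s n a i b j c u v = 0 := by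
  rw [elem]
  split_ifs with h'
  · rw [← Bool.not_eq_true, okk_iff, not_and_or, Bool.not_eq_true, Bool.not_eq_true] at h
    rcases h with h | h
    · rw [bs_eq_zero K s h, tn_zero_left, Finsupp.single_zero]
    · rw [bs_eq_zero K s h, tn_zero_right, Finsupp.single_zero]
  · rfl

theorem tn_smul_elem {n : ℕ} {a a' b b' : ZMod s} {i i' j j' c u u' v v' : ℕ}
    (hu : ok i i' u' = true) (hv : ok j' j v' = true) (h : okk n i j c u v = true)
    (ha : a' = a + u') (hb : b = b' + v') :
    tn K s (bs K s a i i' u') (bs K s b' j' j v') • elem K s n a i b j c u v =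
      elem K s n a' i' b' j' c (u + u') (v + v') := by
  obtain ⟨h1, h2⟩ := okk_iff.1 h
  subst ha hb
  have e : a + (u' : ZMod s) - ((u + u' : ℕ) : ZMod s) = a - u := by push_cast; ring
  by_cases hg : a - u + (cM n c : ZMod s) = b' + v' + v
  · rw [elem_of_eq hg, elem_of_eq (by rw [e, hg]; push_cast; ring), e, Finsupp.smul_single,
      smul_eq_mul, tn_mul, bs_mul h1 hu (by ring), bs_mul hv h2 rfl, Nat.add_comm v v']
  · rw [elem_of_ne hg, elem_of_ne, smul_zero]
    rw [e]
    push_cast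
    intro h'
    exact hg (by rw [h']; ring)

theorem proj_elem {n : ℕ} {a b : ZMod s} {i j c u v : ℕ} (h : okk n i j c u v = true) :
    proj K s n (elem K s n a i b j c u v) = elem K s n a i b j c u v := by
  obtain ⟨h1, h2⟩ := okk_iff.1 h
  by_cases hg : a - u + (cM n c : ZMod s) = b + v
  · conv_lhs => rw [elem_of_eq hg]
    rw [proj, Finsupp.linearCombination_single, tn_smul_elem (a' := a) h1 h2 _ (by ring) hg,
      zero_add, zero_add]
    exact okk_iff.2 ⟨ok_refl (ok_lt h1).1, ok_refl (ok_lt h2).2.1⟩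
  · rw [elem_of_ne hg, map_zero]

theorem diff_elem {n : ℕ} {a b : ZMod s} {i j c u v : ℕ} (h : okk (n + 1) i j c u v = true) :
    diff K s n (elem K s (n + 1) a i b j c u v) =
      evalL (fun c' u' v' => elem K s n a i b j c' (u + u') (v + v')) (dRow n c) := by
  obtain ⟨h1, h2⟩ := okk_iff.1 h
  have hc := lt_nine_of_ok h1
  by_cases hg : a - u + (cM (n + 1) c : ZMod s) = b + v
  · rw [elem_of_eq hg, diff, Finsupp.linearCombination_single,
      ← DistribSMul.toAddMonoidHom_apply, map_evalL]
    refine evalL_congr fun t ht => ?_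
    obtain ⟨h3, h4, -⟩ := dRow_spec hc ht
    rw [DistribSMul.toAddMonoidHom_apply, tn_smul_elem (a' := a) h1 h2 (okk_iff.2 ⟨h3, h4⟩)
      (by ring) hg, Nat.add_comm u, Nat.add_comm v]
  · rw [elem_of_ne hg, map_zero, eq_comm]
    refine evalL_eq_zero _ fun t ht => Or.inl (elem_of_ne ?_)
    rw [(dRow_spec hc ht).2.2]
    push_cast
    intro h'
    exact hg (by linear_combination h')

theorem htpy_elem {n : ℕ} {a b : ZMod s} {i j c u v : ℕ} (h : okk n i j c u v = true) :
    htpy K s n (elem K s n a i b j c u v) =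
      evalL (fun c' u' v' => elem K s (n + 1) a i b j c' (u + u') v') (hRow n c j v) := by
  obtain ⟨h1, h2⟩ := okk_iff.1 h
  have hc := lt_nine_of_ok h1
  by_cases hg : a - u + (cM n c : ZMod s) = b + v
  · have e : tn K s (bs K s (a - u) (cl n c) i u) (bs K s b j (cr n c) v) =
        envBasis K s ((a - u, ⟨(cl n c, i, u), h1⟩), (b, ⟨(j, cr n c, v), h2⟩)) :=
      by rw [envBasis_apply]; rfl
    rw [elem_of_eq hg, htpy, Finsupp.lsum_single, e, Module.Basis.constr_basis,
      if_pos ⟨rfl, rfl, rfl, hg⟩]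
    simp only [sub_add_cancel]
  · rw [elem_of_ne hg, map_zero, eq_comm]
    refine evalL_eq_zero _ fun t ht => Or.inl (elem_of_ne ?_)
    rw [(hRow_spec hc (ok_lt h2).1 (ok_lt h2).2.2 ht).2.2]
    push_cast
    intro h'
    exact hg (by linear_combination h')

theorem augm_elem {a b : ZMod s} {i j c u v : ℕ} (h : okk 0 i j c u v = true)
    (hg : a - u + (cM 0 c : ZMod s) = b + v) :
    augm K s (elem K s 0 a i b j c u v) = bs K s b j i (u + v) := by
  obtain ⟨h1, h2⟩ := okk_iff.1 h
  have hc := lt_nine_of_ok h1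
  have key : ∀ c < 9, cl 0 c < 6 → c < 6 ∧ cl 0 c = c ∧ cr 0 c = c ∧ cM 0 c = 0 := by decide
  obtain ⟨hc6, e1, e2, e3⟩ := key c hc (ok_lt h1).1
  rw [elem_of_eq hg, augm, Finsupp.linearCombination_single, if_pos hc6, tn_smul]
  rw [e3, Int.cast_zero, add_zero] at hg
  rw [e1] at h1 ⊢
  rw [e2] at h2 ⊢
  rw [bs_mul_ev _ h1, bs_mul h2 h1 hg, Nat.add_comm]

theorem sect_bs {b : ZMod s} {i j w : ℕ} (h : j < 6) :
    sect K s (bs K s b j i w) = elem K s 0 (b + w) i b j j w 0 := by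
  have key : ∀ c < 6, cl 0 c = c := by decide
  by_cases hok : ok j i w = true
  · have e : bs K s b j i w = pathBasis K s (b, ⟨(j, i, w), hok⟩) := by rw [pathBasis_apply]; rfl
    rw [e, sect, Module.Basis.constr_basis]
  · rw [bs_eq_zero K s (by simpa using hok), map_zero, elem_eq_zero]
    rw [← Bool.not_eq_true, okk_iff, key j h]
    tauto

end Ambient

section Resolution

attribute [local irreducible] elem proj diff htpy augm sect

variable {K : Type u} [Field K] {s : ℕ} [NeZero s]

theorem proj_elem' {n : ℕ} (a : ZMod s) (i : ℕ) (b : ZMod s) (j c u v : ℕ) :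
    proj K s n (elem K s n a i b j c u v) = elem K s n a i b j c u v := by
  by_cases h : okk n i j c u v = true
  · exact proj_elem h
  · rw [elem_eq_zero (by simpa using h), map_zero]

theorem amb_ext {V : Type*} [AddCommGroup V] [Module K V] {n : ℕ} {f g : Amb K s →ₗ[K] V}
    (h : ∀ a i b j c u v, okk n i j c u v = true →
      f (elem K s n a i b j c u v) = g (elem K s n a i b j c u v)) (x : Amb K s) :
    f (proj K s n x) = g (proj K s n x) := by
  suffices f ∘ₗ (proj K s n).restrictScalars K = g ∘ₗ (proj K s n).restrictScalars K from
    LinearMap.congr_fun this x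
  refine Finsupp.lhom_ext' fun ck => (envBasis K s).ext fun y => ?_
  obtain ⟨c, k⟩ := ck
  obtain ⟨⟨a, ⟨l, i, u⟩, hx⟩, ⟨b, ⟨j, r, v⟩, hy⟩⟩ := y
  simp only at hx hy
  rw [envBasis_apply]
  change f (proj K s n (Finsupp.single (c, k) (tn K s (bs K s a l i u) (bs K s b j r v)))) =
    g (proj K s n (Finsupp.single (c, k) (tn K s (bs K s a l i u) (bs K s b j r v))))
  rw [proj, Finsupp.linearCombination_single]
  dsimp only
  by_cases hc : okk n (cl n c) (cr n c) c 0 0 = true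
  · obtain ⟨hl, hr⟩ := okk_iff.1 hc
    by_cases hk : k = a ∧ cl n c = l
    · obtain ⟨rfl, rfl⟩ := hk
      by_cases hk' : k + (cM n c : ZMod s) = b + v ∧ cr n c = r
      · obtain ⟨hk', rfl⟩ := hk'
        rw [tn_smul_elem hx hy hc rfl hk', h]
        rw [okk_iff, zero_add, zero_add]
        exact ⟨hx, hy⟩
      · rw [elem_of_eq (by simp), Finsupp.smul_single, smul_eq_mul, tn_mul,
          bs_mul_ne hy hr hk', tn_zero_right, Finsupp.single_zero, map_zero, map_zero]
    · rw [elem_of_eq (by simp), Finsupp.smul_single, smul_eq_mul, tn_mul, bs_mul_ne hl hx,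
        tn_zero_left, Finsupp.single_zero, map_zero, map_zero]
      rintro ⟨h1, h2⟩
      exact hk ⟨by rw [h1]; simp, h2.symm⟩
  · rw [elem_eq_zero (by simpa using hc), smul_zero, map_zero, map_zero]

theorem amb_ext_zero {V : Type*} [AddCommGroup V] [Module K V] {n : ℕ} {f : Amb K s →ₗ[K] V}
    (h : ∀ a i b j c u v, okk n i j c u v = true → f (elem K s n a i b j c u v) = 0)
    (x : Amb K s) : f (proj K s n x) = 0 :=
  amb_ext (g := 0) (fun a i b j c u v h' => h a i b j c u v h') x

theorem proj_proj (n : ℕ) (x : Amb K s) : proj K s n (proj K s n x) = proj K s n x :=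
  amb_ext (f := (proj K s n).restrictScalars K) (g := LinearMap.id)
    (fun _ _ _ _ _ _ _ h => proj_elem h) x

theorem diff_evalL {n : ℕ} {a b : ZMod s} {i j : ℕ} (L : Comb) :
    diff K s n (evalL (elem K s (n + 1) a i b j) L) =
      evalL (elem K s n a i b j) (fd n i j L) := by
  rw [← LinearMap.toAddMonoidHom_coe, map_evalL, evalL_fd]
  refine evalL_congr fun t _ => ?_
  rw [LinearMap.toAddMonoidHom_coe]
  split_ifs with h
  · exact diff_elem h
  · rw [elem_eq_zero (by simpa using h), map_zero]

theorem htpy_evalL {n : ℕ} {a b : ZMod s} {i j : ℕ} (L : Comb) :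
    htpy K s n (evalL (elem K s n a i b j) L) =
      evalL (elem K s (n + 1) a i b j) (fh n i j L) := by
  rw [← LinearMap.toAddMonoidHom_coe, map_evalL, evalL_fh]
  refine evalL_congr fun t _ => ?_
  rw [LinearMap.toAddMonoidHom_coe]
  split_ifs with h
  · exact htpy_elem h
  · rw [elem_eq_zero (by simpa using h), map_zero]

theorem elem_eq_evalL {n : ℕ} {a b : ZMod s} {i j c u v : ℕ} :
    elem K s n a i b j c u v = evalL (elem K s n a i b j) [(c, u, v, 1)] := by
  simp [evalL]

theorem proj_evalL {n : ℕ} {a b : ZMod s} {i j : ℕ} (L : Comb) :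
    proj K s n (evalL (elem K s n a i b j) L) = evalL (elem K s n a i b j) L := by
  rw [← LinearMap.toAddMonoidHom_coe, map_evalL]
  exact evalL_congr fun t _ => proj_elem' ..

theorem proj_diff (n : ℕ) (x : Amb K s) :
    proj K s n (diff K s n (proj K s (n + 1) x)) = diff K s n (proj K s (n + 1) x) :=
  amb_ext (f := (proj K s n ∘ₗ diff K s n).restrictScalars K)
    (g := (diff K s n).restrictScalars K)
    (fun a i b j c u v h => by
      change proj K s n (diff K s n _) = diff K s n _
      rw [elem_eq_evalL, diff_evalL, proj_evalL]) x

theorem proj_htpy (n : ℕ) (x : Amb K s) :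
    proj K s (n + 1) (htpy K s n (proj K s n x)) = htpy K s n (proj K s n x) :=
  amb_ext (f := (proj K s (n + 1)).restrictScalars K ∘ₗ htpy K s n)
    (g := htpy K s n)
    (fun a i b j c u v h => by
      change proj K s (n + 1) (htpy K s n _) = htpy K s n _
      rw [elem_eq_evalL, htpy_evalL, proj_evalL]) x

theorem elem_eq_smul {n : ℕ} {a b : ZMod s} {i j c u v : ℕ} (h : okk n i j c u v = true) :
    elem K s n a i b j c u v = tn K s (bs K s (a - u) (cl n c) i u) (bs K s b j (cr n c) v) •
      elem K s n (a - u) (cl n c) (b + v) (cr n c) c 0 0 := by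
  obtain ⟨h1, h2⟩ := okk_iff.1 h
  rw [tn_smul_elem (a' := a) h1 h2 _ (by ring) rfl, zero_add, zero_add]
  exact okk_iff.2 ⟨ok_refl (ok_lt h1).1, ok_refl (ok_lt h2).2.1⟩

theorem diff_diff (n : ℕ) (x : Amb K s) :
    diff K s n (diff K s (n + 1) (proj K s (n + 2) x)) = 0 := by
  refine amb_ext_zero (n := n + 2) (f := (diff K s n ∘ₗ diff K s (n + 1)).restrictScalars K)
    (fun a i b j c u v h => ?_) x
  change diff K s n (diff K s (n + 1) _) = 0
  have hc := lt_nine_of_ok (okk_iff.1 h).1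
  rw [elem_eq_smul h, map_smul, map_smul, diff_elem (n := n + 1)]
  · simp only [zero_add]
    rw [diff_evalL, evalL_eq_zero_of_vanish _ (vanish_fd_dRow hc), smul_zero]
    exact fun _ _ _ h => elem_eq_zero h
  · obtain ⟨h1, h2⟩ := okk_iff.1 h
    exact okk_iff.2 ⟨ok_refl (ok_lt h1).1, ok_refl (ok_lt h2).2.1⟩

set_option synthInstance.maxSize 512 in
theorem ok_factor' {i p q r d e e' : ℕ} (h : ok i p d = true) (h₁ : ok p q e = true)
    (h₂ : ok q r e' = true) (h₃ : ok i r (d + (e + e')) = true) : ok p r (e + e') = true := by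
  have key : ∀ i < 6, ∀ p < 6, ∀ d < 2, ∀ q < 6, ∀ e < 2, ∀ r < 6, ∀ e' < 2,
      (!(ok i p d) || !(ok p q e) || !(ok q r e') || !(ok i r (d + (e + e'))) ||
        ok p r (e + e')) = true := by
    decide +kernel
  obtain ⟨a, b, c⟩ := ok_lt h
  obtain ⟨-, b', c'⟩ := ok_lt h₁
  obtain ⟨-, b'', c''⟩ := ok_lt h₂
  simpa [h, h₁, h₂, h₃] using key i a p b d c q b' e c' r b'' e' c''

theorem htpy_smul_elem {n : ℕ} {a b : ZMod s} {l i j u : ℕ} (hu : ok l i u = true) (hj : j < 6)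
    (c u' v : ℕ) :
    htpy K s n (tn K s (bs K s a l i u) (bs K s b j j 0) • elem K s n a l b j c u' v) =
      tn K s (bs K s a l i u) (bs K s b j j 0) • htpy K s n (elem K s n a l b j c u' v) := by
  by_cases h : okk n l j c u' v = true
  · obtain ⟨h1, h2⟩ := okk_iff.1 h
    have hc := lt_nine_of_ok h1
    rw [tn_smul_elem hu (ok_refl hj) h rfl (by simp), htpy_elem h,
      ← DistribSMul.toAddMonoidHom_apply, map_evalL, add_zero]
    have e : ∀ t ∈ hRow n c j v, okk (n + 1) l j t.1 (u' + t.2.1) t.2.2.1 = true →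
        tn K s (bs K s a l i u) (bs K s b j j 0) •
          elem K s (n + 1) a l b j t.1 (u' + t.2.1) t.2.2.1 =
        elem K s (n + 1) (a + u) i b j t.1 (u' + u + t.2.1) t.2.2.1 := fun t _ h' => by
      rw [tn_smul_elem hu (ok_refl hj) h' rfl (by simp), add_zero, add_right_comm]
    have e' : ∀ t ∈ hRow n c j v, okk n i j c (u' + u) v = true ∨
          okk (n + 1) i j t.1 (u' + u + t.2.1) t.2.2.1 = false := fun t ht => by
      obtain ⟨h3, h4, -⟩ := hRow_spec hc hj (ok_lt h2).2.2 ht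
      by_contra! h5
      rw [Ne, Ne, Bool.not_eq_false] at h5
      refine h5.1 (okk_iff.2 ⟨?_, h2⟩)
      exact ok_factor' (d := _) h3 h1 hu (by rw [add_comm t.2.1]; exact (okk_iff.1 h5.2).1)
    by_cases h5 : okk n i j c (u' + u) v = true
    · rw [htpy_elem h5]
      refine evalL_congr fun t ht => ?_
      rw [DistribSMul.toAddMonoidHom_apply]
      by_cases h' : okk (n + 1) l j t.1 (u' + t.2.1) t.2.2.1 = true
      · rw [e t ht h']
      · obtain ⟨h3, h4, -⟩ := hRow_spec hc hj (ok_lt h2).2.2 ht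
        rw [elem_eq_zero ((Bool.not_eq_true _).mp h'), smul_zero,
          elem_eq_zero]
        rw [← Bool.not_eq_true]
        intro h6
        refine h' (okk_iff.2 ⟨?_, h4⟩)
        rw [add_comm u']
        refine ok_factor h3 h1 hu ?_
        rw [add_comm t.2.1]
        exact (okk_iff.1 h6).1
    · rw [elem_eq_zero (by simpa using h5), map_zero]
      refine (evalL_eq_zero _ fun t ht => Or.inl ?_).symm
      rw [DistribSMul.toAddMonoidHom_apply]
      by_cases h' : okk (n + 1) l j t.1 (u' + t.2.1) t.2.2.1 = true
      · rw [e t ht h', elem_eq_zero ((e' t ht).resolve_left h5)]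
      · rw [elem_eq_zero (by simpa using h'), smul_zero]
  · rw [elem_eq_zero (by simpa using h), smul_zero, map_zero, smul_zero]

end Resolution

section Exactness

attribute [local irreducible] elem proj diff htpy augm sect

variable {K : Type u} [Field K] {s : ℕ} [NeZero s]

theorem htpy_smul_evalL {n : ℕ} {a b : ZMod s} {l i j u : ℕ} (hu : ok l i u = true) (hj : j < 6)
    (L : Comb) :
    htpy K s n (tn K s (bs K s a l i u) (bs K s b j j 0) • evalL (elem K s n a l b j) L) =
      tn K s (bs K s a l i u) (bs K s b j j 0) • htpy K s n (evalL (elem K s n a l b j) L) := by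
  rw [← DistribSMul.toAddMonoidHom_apply, map_evalL, ← LinearMap.toAddMonoidHom_coe, map_evalL,
    map_evalL, ← DistribSMul.toAddMonoidHom_apply, map_evalL]
  exact evalL_congr fun t _ => htpy_smul_elem hu hj ..

theorem elem_eq_smul_left {n : ℕ} {a b : ZMod s} {i j c u v : ℕ} (h : okk n i j c u v = true) :
    elem K s n a i b j c u v = tn K s (bs K s (a - u) (cl n c) i u) (bs K s b j j 0) •
      elem K s n (a - u) (cl n c) b j c 0 v := by
  obtain ⟨h1, h2⟩ := okk_iff.1 h
  rw [tn_smul_elem (a' := a) h1 (ok_refl (ok_lt h2).1) _ (by ring) (by simp), zero_add, add_zero]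
  exact okk_iff.2 ⟨ok_refl (ok_lt h1).1, h2⟩

theorem diff_htpy_elem {n : ℕ} {a b : ZMod s} {i j c u v : ℕ}
    (h : okk (n + 1) i j c u v = true) :
    diff K s (n + 1) (htpy K s (n + 1) (elem K s (n + 1) a i b j c u v)) +
      htpy K s n (diff K s n (elem K s (n + 1) a i b j c u v)) =
        elem K s (n + 1) a i b j c u v := by
  obtain ⟨h1, h2⟩ := okk_iff.1 h
  have hc := lt_nine_of_ok h1
  have key := evalL_eq_zero_of_vanish (f := elem K s (n + 1) (a - u) (cl (n + 1) c) b j)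
    (vanish_homotopy hc h2) fun _ _ _ h => elem_eq_zero h
  rw [evalL_cons, evalL_append, neg_smul, one_smul, neg_add_eq_zero] at key
  dsimp only at key
  rw [elem_eq_smul_left h, elem_eq_evalL (n := n + 1), htpy_smul_evalL h1 (ok_lt h2).1, map_smul,
    map_smul, diff_evalL, htpy_smul_evalL h1 (ok_lt h2).1, htpy_evalL, diff_evalL, htpy_evalL,
    ← smul_add, ← key, elem_eq_evalL (n := n + 1)]

theorem diff_htpy (n : ℕ) (x : Amb K s) :
    diff K s (n + 1) (htpy K s (n + 1) (proj K s (n + 1) x)) +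
      htpy K s n (diff K s n (proj K s (n + 1) x)) = proj K s (n + 1) x :=
  amb_ext (f := (diff K s (n + 1)).restrictScalars K ∘ₗ htpy K s (n + 1) +
    htpy K s n ∘ₗ (diff K s n).restrictScalars K) (g := LinearMap.id)
    (fun _ _ _ _ _ _ _ h => diff_htpy_elem h) x

theorem cr_zero {c : ℕ} (h : cl 0 c < 6) : c < 6 ∧ cl 0 c = c ∧ cr 0 c = c ∧ cM 0 c = 0 := by
  have key : ∀ c < 9, cl 0 c < 6 → c < 6 ∧ cl 0 c = c ∧ cr 0 c = c ∧ cM 0 c = 0 := by decide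
  exact key c (lt_nine h) h

theorem cl_zero {c : ℕ} (h : c < 6) : cl 0 c = c ∧ cr 0 c = c ∧ cM 0 c = 0 := by
  have key : ∀ c < 6, cl 0 c = c ∧ cr 0 c = c ∧ cM 0 c = 0 := by decide
  exact key c h

theorem sect_augm_elem {a b : ZMod s} {i j c u v : ℕ} (h : okk 0 i j c u v = true) :
    sect K s (augm K s (elem K s 0 a i b j c u v)) =
      tn K s (bs K s (a - u) (cl 0 c) i u) (bs K s b j j 0) •
        elem K s 0 (a - u) (cl 0 c) b j j v 0 := by
  obtain ⟨h1, h2⟩ := okk_iff.1 h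
  have hj := (ok_lt h2).1
  obtain ⟨hc6, e1, e2, e3⟩ := cr_zero (ok_lt h1).1
  obtain ⟨e1', e2', e3'⟩ := cl_zero hj
  have hok : okk 0 (cl 0 c) j j v 0 = true := by
    rw [okk_iff, e1', e2', e1]
    rw [e2] at h2
    exact ⟨h2, ok_refl hj⟩
  rw [tn_smul_elem (a' := a) h1 (ok_refl hj) hok (by ring) (by simp), add_zero]
  by_cases hg : a - u + (cM 0 c : ZMod s) = b + v
  · rw [augm_elem h hg, sect_bs hj, add_comm v u]
    congr 1
    rw [e3] at hg
    push_cast at hg ⊢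
    linear_combination -hg
  · rw [elem_of_ne hg, map_zero, map_zero, elem_of_ne]
    rw [e3] at hg
    rw [e3']
    push_cast at hg ⊢
    exact fun h' => hg (by linear_combination h')

theorem diff_htpy_zero_elem {a b : ZMod s} {i j c u v : ℕ} (h : okk 0 i j c u v = true) :
    diff K s 0 (htpy K s 0 (elem K s 0 a i b j c u v)) +
      sect K s (augm K s (elem K s 0 a i b j c u v)) = elem K s 0 a i b j c u v := by
  obtain ⟨h1, h2⟩ := okk_iff.1 h
  have hc := lt_nine_of_ok h1
  have key := evalL_eq_zero_of_vanish (f := elem K s 0 (a - u) (cl 0 c) b j)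
    (vanish_homotopy_zero hc h2) fun _ _ _ h => elem_eq_zero h
  rw [evalL_cons, evalL_cons, neg_smul, one_smul, one_smul, neg_add_eq_zero] at key
  dsimp only at key
  rw [sect_augm_elem h, elem_eq_smul_left h, elem_eq_evalL (c := c),
    htpy_smul_evalL h1 (ok_lt h2).1, map_smul, htpy_evalL, diff_evalL, ← smul_add, add_comm,
    ← key, elem_eq_evalL (c := c)]

theorem diff_htpy_zero (x : Amb K s) :
    diff K s 0 (htpy K s 0 (proj K s 0 x)) + sect K s (augm K s (proj K s 0 x)) = proj K s 0 x :=
  amb_ext (f := (diff K s 0).restrictScalars K ∘ₗ htpy K s 0 +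
    sect K s ∘ₗ (augm K s).restrictScalars K) (g := LinearMap.id)
    (fun _ _ _ _ _ _ _ h => diff_htpy_zero_elem h) x

theorem augm_sect (x : Alg K s) : augm K s (sect K s x) = x := by
  suffices (augm K s).restrictScalars K ∘ₗ sect K s = LinearMap.id from LinearMap.congr_fun this x
  refine (pathBasis K s).ext fun y => ?_
  obtain ⟨k, ⟨j, i, w⟩, h⟩ := y
  simp only at h
  obtain ⟨hj, -⟩ := ok_lt h
  obtain ⟨e1, e2, e3⟩ := cl_zero hj
  rw [pathBasis_apply]
  change augm K s (sect K s (bs K s k j i w)) = bs K s k j i w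
  rw [sect_bs hj, augm_elem, add_zero]
  · rw [okk_iff, e1, e2]
    exact ⟨h, ok_refl hj⟩
  · rw [e3]
    simp

theorem proj_sect (x : Alg K s) : proj K s 0 (sect K s x) = sect K s x := by
  suffices (proj K s 0).restrictScalars K ∘ₗ sect K s = sect K s from LinearMap.congr_fun this x
  refine (pathBasis K s).ext fun y => ?_
  obtain ⟨k, ⟨j, i, w⟩, h⟩ := y
  simp only at h
  rw [pathBasis_apply]
  change proj K s 0 (sect K s (bs K s k j i w)) = sect K s (bs K s k j i w)
  rw [sect_bs (ok_lt h).1, proj_elem']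

theorem augm_dRow {c : ℕ} (hc : c < 9) :
    ∀ t ∈ (dRow 0 c).map (fun x => (0, x.2.1 + x.2.2.1, 0, 1 * x.2.2.2)),
      ok (cr 1 c) (cl 1 c) t.2.1 = false ∨
        ((((dRow 0 c).map fun x => (0, x.2.1 + x.2.2.1, 0, 1 * x.2.2.2)).filter
          (sameKey t)).map fun x => x.2.2.2).sum = 0 := by
  revert hc
  revert c
  decide

theorem augm_diff (x : Amb K s) : augm K s (diff K s 0 (proj K s 1 x)) = 0 := by
  refine amb_ext_zero (n := 1) (f := (augm K s).restrictScalars K ∘ₗ (diff K s 0).restrictScalars K)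
    (fun a i b j c u v h => ?_) x
  change augm K s (diff K s 0 (elem K s 1 a i b j c u v)) = 0
  obtain ⟨h1, h2⟩ := okk_iff.1 h
  have hc := lt_nine_of_ok h1
  by_cases hg : a - u + (cM 1 c : ZMod s) = b + v
  · have h0 : okk 1 (cl 1 c) (cr 1 c) c 0 0 = true :=
      okk_iff.2 ⟨ok_refl (ok_lt h1).1, ok_refl (ok_lt h2).2.1⟩
    rw [elem_eq_smul h, map_smul, map_smul, diff_elem (n := 0) h0, ← LinearMap.toAddMonoidHom_coe,
      map_evalL]
    have key := evalL_eq_zero (fun _ w _ => bs K s (b + v) (cr 1 c) (cl 1 c) w) fun t ht =>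
      (augm_dRow hc t ht).imp_left (bs_eq_zero K s)
    rw [evalL_map _ _ (fun _ _ _ => 0) (fun _ u v => u + v) (fun _ _ _ => 0) 1, one_smul] at key
    rw [evalL_congr fun t ht => ?_, key, smul_zero]
    obtain ⟨h3, h4, h5⟩ := dRow_spec hc ht
    rw [zero_add, zero_add, LinearMap.toAddMonoidHom_coe, augm_elem (okk_iff.2 ⟨h3, h4⟩)]
    rw [h5]
    push_cast
    linear_combination hg
  · rw [elem_of_ne hg, map_zero, map_zero]

end Exactness

section ProjRes

attribute [local irreducible] elem proj diff htpy augm sect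

variable (K : Type u) [Field K] (s : ℕ) [NeZero s]

/-- The terms of the projective resolution of `R_s` as a bimodule. -/
noncomputable abbrev resQ (n : ℕ) : Submodule (Env K s) (Amb K s) := LinearMap.range (proj K s n)

variable {K s} in
theorem proj_coe {n : ℕ} (x : resQ K s n) : proj K s n x = x := by
  obtain ⟨_, y, rfl⟩ := x
  exact proj_proj n y

/-- The differential of the resolution. -/
noncomputable def resD (n : ℕ) : resQ K s (n + 1) →ₗ[Env K s] resQ K s n :=
  (proj K s n).rangeRestrict ∘ₗ diff K s n ∘ₗ (resQ K s (n + 1)).subtype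

variable {K s} in
theorem resD_coe {n : ℕ} (x : resQ K s (n + 1)) : (resD K s n x : Amb K s) = diff K s n x := by
  change proj K s n (diff K s n x) = diff K s n x
  rw [← proj_coe x, proj_diff]

/-- The projective resolution of `R_s` as a bimodule over itself. -/
noncomputable def res : ProjRes.{u, u} (Env K s) (Alg K s) where
  Q n := resQ K s n
  proj n := Module.Projective.of_split (resQ K s n).subtype (proj K s n).rangeRestrict
    (LinearMap.ext fun x => Subtype.ext (proj_coe x))
  d := resD K s
  ε := augm K s ∘ₗ (resQ K s 0).subtype
  surj x := ⟨⟨sect K s x, sect K s x, proj_sect x⟩, augm_sect x⟩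
  exact₀ := by
    refine le_antisymm ?_ fun x hx => ?_
    · rintro _ ⟨x, rfl⟩
      change augm K s (resD K s 0 x) = 0
      rw [resD_coe, ← proj_coe x, augm_diff]
    · change augm K s x = 0 at hx
      refine ⟨⟨htpy K s 0 x, htpy K s 0 x, ?_⟩, Subtype.ext ?_⟩
      · rw [← proj_coe x, proj_htpy]
      · rw [resD_coe]
        have h := diff_htpy_zero (x : Amb K s)
        rw [proj_coe, hx, map_zero, add_zero] at h
        exact h
  exact n := by
    refine le_antisymm ?_ fun x hx => ?_
    · rintro _ ⟨x, rfl⟩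
      refine Subtype.ext ?_
      rw [resD_coe, resD_coe, ← proj_coe x, diff_diff]
      rfl
    · have hx' : diff K s n x = 0 := by
        rw [← resD_coe, LinearMap.mem_ker.1 hx]
        rfl
      refine ⟨⟨htpy K s (n + 1) x, htpy K s (n + 1) x, ?_⟩, Subtype.ext ?_⟩
      · rw [← proj_coe x, proj_htpy]
      · rw [resD_coe]
        have h := diff_htpy n (x : Amb K s)
        rw [proj_coe, hx', map_zero, add_zero] at h
        exact h

end ProjRes

section Cochains

/-- The cell `2 * c + w` of degree `n` stands for the parallel path of degree `w` at the
generator `c`; it exists when this path is nonzero. -/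
def okX (n a : ℕ) : Bool := ok (cr n (a / 2)) (cl n (a / 2)) (a % 2)

/-- The total degree of a cell. -/
def qX (n a : ℕ) : ℤ := cM n (a / 2) + ((a % 2 : ℕ) : ℤ)

/-- The cell obtained by dividing a path of degree `w` by a pair of paths of total degree `d`. -/
def cellOf (c d w : ℕ) : ℕ := 2 * c + (w - d)

/-- The row of the matrix of the coboundary map. -/
def dL (n a : ℕ) : Comb :=
  if okX (n + 1) a then (dRow n (a / 2)).flatMap fun t =>
    if t.2.1 + t.2.2.1 ≤ a % 2 ∧ okX n (cellOf t.1 (t.2.1 + t.2.2.1) (a % 2)) = true then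
      [(cellOf t.1 (t.2.1 + t.2.2.1) (a % 2), t.2.1, 0, t.2.2.2)] else []
  else []

theorem okX_lt {n a : ℕ} (h : okX n a = true) : a < 18 := by
  have := lt_nine (ok_lt h).2.1
  omega

theorem cellOf_div {c d w : ℕ} (hw : w < 2) : cellOf c d w / 2 = c := by
  rw [cellOf]
  omega

theorem cellOf_mod {c d w : ℕ} (hw : w < 2) : cellOf c d w % 2 = w - d := by
  rw [cellOf]
  omega

theorem dL_spec {n a : ℕ} {t : ℕ × ℕ × ℕ × ℤ} (ht : t ∈ dL n a) :
    okX (n + 1) a = true ∧ okX n t.1 = true ∧ qX n t.1 = qX (n + 1) a := by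
  rw [dL] at ht
  split_ifs at ht with h
  · obtain ⟨x, hx, hxt⟩ := List.mem_flatMap.1 ht
    split_ifs at hxt with h'
    · rw [List.mem_singleton] at hxt
      subst hxt
      refine ⟨h, h'.2, ?_⟩
      have hw : a % 2 < 2 := Nat.mod_lt _ two_pos
      have h3 := (dRow_spec (lt_nine (ok_lt h).2.1) hx).2.2
      rw [qX, qX, cellOf_div hw, cellOf_mod hw, h3]
      push_cast [h'.1]
      ring
    · simp at hxt
  · simp at ht

variable (K : Type u) [Field K] (s : ℕ)

/-- Matrices of formal linear combinations of translations, acting on families of functions. -/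
def app (M : ℕ → Comb) : (ℕ → ZMod s → K) →ₗ[K] (ℕ → ZMod s → K) where
  toFun f a k := evalL (fun b u v => f b (k - u + v)) (M a)
  map_add' f g := by
    funext a k
    simp only [evalL, Pi.add_apply, smul_add, List.sum_map_add]
  map_smul' r f := by
    funext a k
    have := map_evalL (fun b u v => f b (k - u + v)) (AddMonoidHom.mulLeft r) (M a)
    simpa using this.symm

/-- The cells which contribute to the cochains. -/
def Active (okC : ℕ → Bool) (q : ℕ → ℤ) (a : ℕ) : Prop := okC a = true ∧ (q a : ZMod s) = 0

/-- The families of functions supported by the active cells. -/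
def supp (okC : ℕ → Bool) (q : ℕ → ℤ) : Submodule K (ℕ → ZMod s → K) where
  carrier := {f | ∀ a, ¬ Active s okC q a → f a = 0}
  add_mem' hf hg a ha := by rw [Pi.add_apply, hf a ha, hg a ha, add_zero]
  zero_mem' _ _ := rfl
  smul_mem' r f hf a ha := by rw [Pi.smul_apply, hf a ha, smul_zero]

/-- Homogeneity of a matrix with respect to the degrees of cells. -/
def Homog (M : ℕ → Comb) (okC okC' : ℕ → Bool) (q q' : ℕ → ℤ) : Prop :=
  ∀ a, ∀ t ∈ M a, okC' a = true ∧ okC t.1 = true ∧ q t.1 = q' a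

variable {K s} in
theorem Homog.app_mem {M : ℕ → Comb} {okC okC' : ℕ → Bool} {q q' : ℕ → ℤ}
    (h : Homog M okC okC' q q') {f : ℕ → ZMod s → K} (hf : f ∈ supp K s okC q) :
    app K s M f ∈ supp K s okC' q' := by
  intro a ha
  funext k
  change evalL (fun b u v => f b (k - u + v)) (M a) = 0
  refine evalL_eq_zero _ fun t ht => Or.inl ?_
  obtain ⟨h1, -, h3⟩ := h a t ht
  rw [hf t.1 fun h' => ha ⟨h1, h3 ▸ h'.2⟩]
  rfl

/-- The cochains of degree `n`. -/
abbrev Coch (n : ℕ) : Submodule K (ℕ → ZMod s → K) := supp K s (okX n) (qX n)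

theorem homog_dL (n : ℕ) : Homog (dL n) (okX n) (okX (n + 1)) (qX n) (qX (n + 1)) :=
  fun _ _ ht => dL_spec ht

/-- The coboundary map. -/
noncomputable def cobdry (n : ℕ) : Coch K s n →ₗ[K] Coch K s (n + 1) :=
  (app K s (dL n)).restrict fun _ hf => (homog_dL n).app_mem hf

end Cochains

section Coefficients

variable (K : Type u) [Field K] (s : ℕ) [NeZero s]

/-- The coefficient of a path. -/
noncomputable def coef (k : ZMod s) (r l w : ℕ) : Alg K s →ₗ[K] K :=
  if h : ok r l w = true then (pathBasis K s).coord (k, ⟨(r, l, w), h⟩) else 0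

variable {K s}

theorem coef_bs {k k' : ZMod s} {r l w r' l' w' : ℕ} (h : ok r l w = true) :
    coef K s k' r' l' w' (bs K s k r l w) =
      if (k, r, l, w) = (k', r', l', w') then 1 else 0 := by
  have e : bs K s k r l w = pathBasis K s (k, ⟨(r, l, w), h⟩) := by
    rw [pathBasis_apply]
    rfl
  rw [coef]
  split_ifs with h1 h2 h3
  · simp only [Prod.mk.injEq] at h2
    obtain ⟨rfl, rfl, rfl, rfl⟩ := h2
    rw [e, Module.Basis.coord_apply, Module.Basis.repr_self, Finsupp.single_eq_same]
  · rw [e, Module.Basis.coord_apply, Module.Basis.repr_self, Finsupp.single_eq_of_ne]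
    intro h4
    apply h2
    simp only [Prod.mk.injEq, Subtype.mk.injEq] at h4 ⊢
    exact ⟨h4.1.symm, h4.2.1.symm, h4.2.2.1.symm, h4.2.2.2.symm⟩
  · simp only [Prod.mk.injEq] at h3
    obtain ⟨rfl, rfl, rfl, rfl⟩ := h3
    exact absurd h h1
  · rfl

theorem coef_of_not_ok {k : ZMod s} {r l w : ℕ} (h : ¬ ok r l w = true) : coef K s k r l w = 0 :=
  dif_neg h

theorem ev_mul_ev_eq (k k' : ZMod s) {l r : ℕ} (hl : l < 6) (hr : r < 6) (x : Alg K s) :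
    ev K s k l * x * ev K s k' r = ∑ w ∈ Finset.range 2,
      (if k' + (w : ZMod s) = k then coef K s k' r l w x else 0) • bs K s k' r l w := by
  suffices LinearMap.mulRight K (ev K s k' r) ∘ₗ LinearMap.mulLeft K (ev K s k l) =
      ∑ w ∈ Finset.range 2, (if k' + (w : ZMod s) = k then coef K s k' r l w else 0).smulRight
        (bs K s k' r l w) by
    have h := LinearMap.congr_fun this x
    simp only [LinearMap.comp_apply, LinearMap.mulRight_apply, LinearMap.mulLeft_apply,
      LinearMap.sum_apply, LinearMap.smulRight_apply] at h
    rw [h]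
    refine Finset.sum_congr rfl fun w _ => ?_
    split_ifs <;> rfl
  refine (pathBasis K s).ext fun y => ?_
  obtain ⟨m, ⟨i, j, d⟩, h⟩ := y
  simp only at h
  have e : pathBasis K s (m, ⟨(i, j, d), h⟩) = bs K s m i j d := pathBasis_apply _
  rw [e]
  simp only [LinearMap.comp_apply, LinearMap.mulRight_apply, LinearMap.mulLeft_apply,
      LinearMap.sum_apply, LinearMap.smulRight_apply]
  by_cases h1 : (k' = m ∧ r = i) ∧ (k = m + d ∧ l = j)
  · obtain ⟨⟨rfl, rfl⟩, rfl, rfl⟩ := h1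
    rw [ev_mul_bs h rfl, bs_mul_ev _ h, Finset.sum_eq_single_of_mem d
      (Finset.mem_range.2 (ok_lt h).2.2), if_pos rfl, coef_bs h, if_pos rfl, one_smul]
    intro w _ hw
    split_ifs
    · rw [coef_bs h, if_neg (by simpa using hw.symm), zero_smul]
    · simp
  · rw [Finset.sum_eq_zero]
    · rw [not_and_or] at h1
      rcases h1 with h1 | h1
      · have h2 : bs K s m i j d * ev K s k' r = 0 := by
          rw [← bs_self k' hr]
          refine bs_mul_ne (ok_refl hr) h ?_
          rwa [Nat.cast_zero, add_zero, eq_comm, eq_comm (a := i)]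
        rw [mul_assoc, h2, mul_zero]
      · have h2 : ev K s k l * bs K s m i j d = 0 := by
          rw [← bs_self k hl]
          exact bs_mul_ne h (ok_refl hl) h1
        rw [h2, zero_mul]
    · intro w _
      split_ifs with h2
      · rw [coef_bs h, if_neg, zero_smul]
        simp only [Prod.mk.injEq]
        rintro ⟨rfl, rfl, rfl, rfl⟩
        exact h1 ⟨⟨rfl, rfl⟩, h2.symm, rfl⟩
      · simp

end Coefficients

section HomEquiv

attribute [local irreducible] elem proj diff htpy augm sect

variable (K : Type u) [Field K] (s : ℕ) [NeZero s]

/-- The value at a generator of the bimodule map given by a cochain. -/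
noncomputable def genVal (n : ℕ) (f : ℕ → ZMod s → K) (c : ℕ) (k : ZMod s) : Alg K s :=
  ∑ w ∈ Finset.range 2, f (2 * c + w) k • bs K s (k + cM n c) (cr n c) (cl n c) w

/-- The generators of the terms of the resolution. -/
noncomputable def gnr (n c : ℕ) (k : ZMod s) : resQ K s n :=
  (proj K s n).rangeRestrict (Finsupp.single (c, k) 1)

variable {K s}

omit [NeZero s] in
theorem one_smul_amb (x : Amb K s) : (1 : Env K s) • x = x := by
  refine Finsupp.ext fun a => ?_
  rw [Finsupp.smul_apply]
  exact one_mul _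

theorem gnr_coe (n c : ℕ) (k : ZMod s) :
    (gnr K s n c k : Amb K s) = elem K s n k (cl n c) (k + cM n c) (cr n c) c 0 0 := by
  change proj K s n (Finsupp.single (c, k) 1) = _
  rw [proj, Finsupp.linearCombination_single]
  exact one_smul_amb _

theorem mul_genVal_mul {n : ℕ} {f : ℕ → ZMod s → K} (hf : f ∈ Coch K s n) {c : ℕ} {k b : ZMod s}
    {i j u v : ℕ} (hu : ok (cl n c) i u = true) (hv : ok j (cr n c) v = true)
    (hb : k + cM n c = b + v) :
    bs K s k (cl n c) i u * genVal K s n f c k * bs K s b j (cr n c) v =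
      ∑ w ∈ Finset.range 2, f (2 * c + w) k • bs K s b j i (v + w + u) := by
  rw [genVal, Finset.mul_sum, Finset.sum_mul]
  refine Finset.sum_congr rfl fun w hw => ?_
  have hw2 := Finset.mem_range.1 hw
  have e1 : (2 * c + w) / 2 = c := by omega
  have e2 : (2 * c + w) % 2 = w := by omega
  by_cases h : Active s (okX n) (qX n) (2 * c + w)
  · obtain ⟨h1, h2⟩ := h
    rw [okX, e1, e2] at h1
    rw [qX, e1, e2] at h2
    push_cast at h2
    rw [mul_smul_comm, smul_mul_assoc, mul_assoc, bs_mul hv h1 hb]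
    by_cases h3 : ok j (cl n c) (v + w) = true
    · rw [bs_mul h3 hu]
      push_cast
      linear_combination hb - h2
    · rw [Bool.not_eq_true] at h3
      rw [bs_eq_zero K s h3, mul_zero]
      by_cases h4 : ok j i (v + w + u) = true
      · rw [ok_factor hv h1 hu (by rwa [← Nat.add_assoc])] at h3
        exact absurd h3 (by decide)
      · rw [Bool.not_eq_true] at h4
        rw [bs_eq_zero K s h4]
  · rw [hf _ h]
    simp

theorem genVal_sandwich {n : ℕ} {f : ℕ → ZMod s → K} (hf : f ∈ Coch K s n) {c : ℕ} {k : ZMod s}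
    (h : cl n c < 6 ∧ cr n c < 6) :
    ev K s k (cl n c) * genVal K s n f c k * ev K s (k + cM n c) (cr n c) = genVal K s n f c k := by
  rw [← bs_self k h.1, ← bs_self _ h.2, mul_genVal_mul hf (ok_refl h.1) (ok_refl h.2) (by simp)]
  simp only [zero_add, add_zero]
  rfl

theorem coef_genVal {n : ℕ} {f : ℕ → ZMod s → K} (hf : f ∈ Coch K s n) (a : ℕ) (k : ZMod s) :
    coef K s (k + cM n (a / 2)) (cr n (a / 2)) (cl n (a / 2)) (a % 2) (genVal K s n f (a / 2) k) =
      f a k := by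
  by_cases h : okX n a = true
  · rw [genVal, map_sum, Finset.sum_eq_single_of_mem (a % 2)
      (Finset.mem_range.2 (Nat.mod_lt _ two_pos)), map_smul, coef_bs h, if_pos rfl,
      Nat.div_add_mod, smul_eq_mul, mul_one]
    intro w _ hw
    by_cases h1 : ok (cr n (a / 2)) (cl n (a / 2)) w = true
    · rw [map_smul, coef_bs h1, if_neg (by simpa using hw), smul_zero]
    · rw [bs_eq_zero K s (by simpa using h1), smul_zero, map_zero]
  · rw [coef_of_not_ok h, hf a fun h' => h h'.1]
    rfl

theorem genVal_eq_zero {n : ℕ} {f : ℕ → ZMod s → K} {c : ℕ} {k : ZMod s}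
    (h : ¬(cl n c < 6 ∧ cr n c < 6)) : genVal K s n f c k = 0 := by
  refine Finset.sum_eq_zero fun w _ => ?_
  rw [bs_eq_zero, smul_zero]
  by_contra h'
  have := ok_lt (by simpa using h')
  exact h ⟨this.2.1, this.1⟩

theorem gnr_eq_smul (n : ℕ) {c : ℕ} (k : ZMod s) (h : cl n c < 6 ∧ cr n c < 6) :
    gnr K s n c k = tn K s (ev K s k (cl n c)) (ev K s (k + cM n c) (cr n c)) • gnr K s n c k := by
  refine Subtype.ext ?_
  change _ = tn K s (ev K s k (cl n c)) (ev K s (k + cM n c) (cr n c)) • (gnr K s n c k : Amb K s)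
  rw [gnr_coe, ← bs_self k h.1, ← bs_self _ h.2]
  exact (tn_smul_elem (ok_refl h.1) (ok_refl h.2) (okk_iff.2 ⟨ok_refl h.1, ok_refl h.2⟩)
    (by simp) (by simp)).symm

theorem gnr_eq_zero (n : ℕ) {c : ℕ} (k : ZMod s) (h : ¬(cl n c < 6 ∧ cr n c < 6)) :
    gnr K s n c k = 0 := by
  refine Subtype.ext ?_
  rw [gnr_coe, elem_eq_zero]
  · rfl
  · by_contra h'
    have := okk_iff.1 (by simpa using h')
    exact h ⟨(ok_lt this.1).1, (ok_lt this.2).2.1⟩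

variable (K s)

/-- The cochain given by a bimodule map. -/
noncomputable def homCoch (n : ℕ) : (resQ K s n →ₗ[Env K s] Alg K s) →ₗ[K] Coch K s n where
  toFun φ := ⟨fun a k => if (qX n a : ZMod s) = 0 then
      coef K s (k + cM n (a / 2)) (cr n (a / 2)) (cl n (a / 2)) (a % 2) (φ (gnr K s n (a / 2) k))
    else 0, fun a ha => by
      funext k
      change (if _ then _ else _) = _
      split_ifs with h
      · rw [coef_of_not_ok fun h' => ha ⟨h', h⟩]
        rfl
      · rfl⟩
  map_add' φ ψ := by
    refine Subtype.ext (funext fun a => funext fun k => ?_)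
    simp only [LinearMap.add_apply, map_add, Submodule.coe_add, Pi.add_apply]
    split_ifs
    · rfl
    · rw [add_zero]
  map_smul' r φ := by
    refine Subtype.ext (funext fun a => funext fun k => ?_)
    simp only [LinearMap.smul_apply, map_smul, RingHom.id_apply, Submodule.coe_smul_of_tower,
      Pi.smul_apply, smul_ite, smul_zero]

variable {K s}

theorem homCoch_apply (n : ℕ) (φ : resQ K s n →ₗ[Env K s] Alg K s) (a : ℕ) (k : ZMod s) :
    (homCoch K s n φ : ℕ → ZMod s → K) a k = if (qX n a : ZMod s) = 0 then
      coef K s (k + cM n (a / 2)) (cr n (a / 2)) (cl n (a / 2)) (a % 2) (φ (gnr K s n (a / 2) k))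
    else 0 := rfl

theorem apply_gnr (n : ℕ) (φ : resQ K s n →ₗ[Env K s] Alg K s) (c : ℕ) (k : ZMod s) :
    φ (gnr K s n c k) = genVal K s n (homCoch K s n φ : ℕ → ZMod s → K) c k := by
  by_cases h : cl n c < 6 ∧ cr n c < 6
  · conv_lhs => rw [gnr_eq_smul n k h, map_smul, tn_smul, ev_mul_ev_eq _ _ h.1 h.2]
    refine Finset.sum_congr rfl fun w hw => ?_
    have hw2 := Finset.mem_range.1 hw
    have e1 : (2 * c + w) / 2 = c := by omega
    have e2 : (2 * c + w) % 2 = w := by omega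
    rw [homCoch_apply, qX, e1, e2]
    congr 1
    refine if_congr ?_ rfl rfl
    push_cast
    rw [add_assoc, add_eq_left]
  · rw [gnr_eq_zero n k h, map_zero, genVal_eq_zero h]

theorem hom_ext_gnr {n : ℕ} {φ ψ : resQ K s n →ₗ[Env K s] Alg K s}
    (h : ∀ c k, φ (gnr K s n c k) = ψ (gnr K s n c k)) : φ = ψ := by
  have : φ ∘ₗ (proj K s n).rangeRestrict = ψ ∘ₗ (proj K s n).rangeRestrict :=
    Finsupp.lhom_ext' fun x => LinearMap.ext_ring (h x.1 x.2)
  refine LinearMap.ext fun x => ?_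
  obtain ⟨_, y, rfl⟩ := x
  exact LinearMap.congr_fun this y

variable (K s) in
/-- The bimodule map given by a cochain. -/
noncomputable def cochHom (n : ℕ) (f : ℕ → ZMod s → K) : resQ K s n →ₗ[Env K s] Alg K s :=
  (Finsupp.linearCombination (Env K s) fun x : ℕ × ZMod s => genVal K s n f x.1 x.2) ∘ₗ
    (resQ K s n).subtype

theorem cochHom_gnr {n : ℕ} {f : ℕ → ZMod s → K} (hf : f ∈ Coch K s n) (c : ℕ) (k : ZMod s) :
    cochHom K s n f (gnr K s n c k) = genVal K s n f c k := by
  by_cases h : cl n c < 6 ∧ cr n c < 6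
  · change Finsupp.linearCombination (Env K s) _ (gnr K s n c k : Amb K s) = _
    rw [gnr_coe, elem_of_eq (by simp), Finsupp.linearCombination_single, tn_smul,
      bs_self _ h.1, bs_self _ h.2, Nat.cast_zero, sub_zero, genVal_sandwich hf h]
  · rw [gnr_eq_zero n k h, map_zero, genVal_eq_zero h]

variable (K s) in
/-- Bimodule maps from the terms of the resolution correspond to cochains. -/
noncomputable def homEquiv (n : ℕ) : (resQ K s n →ₗ[Env K s] Alg K s) ≃ₗ[K] Coch K s n :=
  { homCoch K s n with
    invFun := fun f => cochHom K s n f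
    left_inv := fun φ => hom_ext_gnr fun c k => by
      rw [apply_gnr n φ]
      exact cochHom_gnr (homCoch K s n φ).2 c k
    right_inv := fun f => by
      refine Subtype.ext (funext fun a => funext fun k => ?_)
      change (homCoch K s n (cochHom K s n f) : ℕ → ZMod s → K) a k = (f : ℕ → ZMod s → K) a k
      rw [homCoch_apply, cochHom_gnr f.2, coef_genVal f.2]
      split_ifs with h
      · rfl
      · rw [f.2 a fun h' => h h'.2]
        rfl }

theorem map_evalL' {V W : Type*} [AddCommGroup V] [AddCommGroup W] (g : V → W)
    (hg : ∀ x y, g (x + y) = g x + g y) (f : ℕ → ℕ → ℕ → V) (L : Comb) :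
    g (evalL f L) = evalL (fun c u v => g (f c u v)) L :=
  map_evalL f (AddMonoidHom.mk' g hg) L

theorem resD_gnr {n c : ℕ} (k : ZMod s) (h : cl (n + 1) c < 6 ∧ cr (n + 1) c < 6) :
    resD K s n (gnr K s (n + 1) c k) = evalL (fun c' u v =>
      tn K s (bs K s (k - u) (cl n c') (cl (n + 1) c) u)
        (bs K s (k + cM (n + 1) c) (cr (n + 1) c) (cr n c') v) • gnr K s n c' (k - u))
      (dRow n c) := by
  refine Subtype.ext ?_
  rw [resD_coe, gnr_coe, diff_elem (okk_iff.2 ⟨ok_refl h.1, ok_refl h.2⟩)]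
  refine Eq.trans ?_ (map_evalL' (fun x : resQ K s n => (x : Amb K s)) (fun _ _ => rfl) _ _).symm
  refine evalL_congr fun t ht => ?_
  obtain ⟨h3, h4, h5⟩ := dRow_spec (lt_nine h.1) ht
  rw [zero_add, zero_add, elem_eq_smul (okk_iff.2 ⟨h3, h4⟩)]
  change _ = _ • (gnr K s n t.1 (k - t.2.1) : Amb K s)
  rw [gnr_coe, h5]
  congr 2
  push_cast
  ring

theorem coef_sum_bs {F : ℕ → ZMod s → K} {b k : ZMod s} {r l w c u v : ℕ} (h : ok r l w = true) :
    coef K s b r l w (∑ x ∈ Finset.range 2, F (2 * c + x) k • bs K s b r l (v + x + u)) =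
      if u + v ≤ w then F (cellOf c (u + v) w) k else 0 := by
  have key : ∀ x, coef K s b r l w (F (2 * c + x) k • bs K s b r l (v + x + u)) =
      if v + x + u = w then F (2 * c + x) k else 0 := fun x => by
    split_ifs with h1
    · rw [h1, map_smul, coef_bs h, if_pos rfl, smul_eq_mul, mul_one]
    · by_cases h2 : ok r l (v + x + u) = true
      · rw [map_smul, coef_bs h2, if_neg (by simpa using h1), smul_zero]
      · rw [bs_eq_zero K s (by simpa using h2), smul_zero, map_zero]
  have hw := (ok_lt h).2.2
  rw [map_sum]
  simp only [key]
  split_ifs with h1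
  · rw [Finset.sum_eq_single_of_mem (w - (u + v)) (Finset.mem_range.2 (by omega)),
      if_pos (by omega), cellOf]
    intro x _ hx
    exact if_neg (by omega)
  · exact Finset.sum_eq_zero fun x _ => if_neg (by omega)

theorem homEquiv_comp (n : ℕ) (φ : resQ K s n →ₗ[Env K s] Alg K s) :
    homEquiv K s (n + 1) (φ ∘ₗ resD K s n) = cobdry K s n (homEquiv K s n φ) := by
  refine Subtype.ext (funext fun a => funext fun k => ?_)
  change (homCoch K s (n + 1) (φ ∘ₗ resD K s n) : ℕ → ZMod s → K) a k =
    app K s (dL n) (homCoch K s n φ : ℕ → ZMod s → K) a k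
  by_cases h : Active s (okX (n + 1)) (qX (n + 1)) a
  · rw [homCoch_apply, if_pos h.2]
    change coef K s (k + cM (n + 1) (a / 2)) (cr (n + 1) (a / 2)) (cl (n + 1) (a / 2)) (a % 2)
      (φ (resD K s n (gnr K s (n + 1) (a / 2) k))) =
      evalL (fun b u v => (homCoch K s n φ : ℕ → ZMod s → K) b (k - u + v)) (dL n a)
    have h1 := ok_lt h.1
    rw [resD_gnr _ ⟨h1.2.1, h1.1⟩]
    refine (map_evalL' (fun x => coef K s (k + cM (n + 1) (a / 2)) (cr (n + 1) (a / 2))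
      (cl (n + 1) (a / 2)) (a % 2) (φ x)) (fun x y => by rw [map_add, map_add]) _ _).trans ?_
    rw [dL, if_pos h.1, evalL_flatMap, evalL]
    congr 1
    refine List.map_congr_left fun t ht => ?_
    obtain ⟨h3, h4, h5⟩ := dRow_spec (lt_nine h1.2.1) ht
    rw [map_smul, tn_smul, apply_gnr,
      mul_genVal_mul (homCoch K s n φ).2 h3 h4 (by rw [h5]; push_cast; ring), coef_sum_bs h.1]
    split_ifs with h6 h7 h7
    · simp [evalL_cons, evalL_nil, cellOf]
    · rw [evalL_nil, (homCoch K s n φ).2 _ fun h8 => h7 ⟨h6, h8.1⟩]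
      exact smul_zero _
    · exact absurd h7.1 h6
    · rw [evalL_nil, smul_zero]
  · rw [(homCoch K s (n + 1) (φ ∘ₗ resD K s n)).2 a h, (homog_dL n).app_mem (homCoch K s n φ).2 a h]

end HomEquiv

section Compare

variable {K : Type u} [Field K] {V : Type v} {V' : Type*} [AddCommGroup V] [Module K V]
  [AddCommGroup V'] [Module K V']

/-- Maps inducing mutually inverse isomorphisms of subquotients. -/
theorem finrank_subquotient_eq {Z B : Submodule K V} {Z' B' : Submodule K V'}
    (F : V →ₗ[K] V') (G : V' →ₗ[K] V) (hF : ∀ z ∈ Z, F z ∈ Z') (hFB : ∀ z ∈ B, F z ∈ B')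
    (hG : ∀ z ∈ Z', G z ∈ Z) (hGB : ∀ z ∈ B', G z ∈ B)
    (hGF : ∀ z ∈ Z, G (F z) - z ∈ B) (hFG : ∀ z ∈ Z', F (G z) - z ∈ B') :
    Module.finrank K (Z ⧸ B.submoduleOf Z) = Module.finrank K (Z' ⧸ B'.submoduleOf Z') := by
  refine LinearEquiv.finrank_eq (LinearEquiv.ofLinearMap
    (Submodule.mapQ _ _ (F.restrict hF) fun z hz => hFB _ hz)
    (Submodule.mapQ _ _ (G.restrict hG) fun z hz => hGB _ hz) ?_ ?_)
  · refine Submodule.linearMap_qext _ (LinearMap.ext fun z => ?_)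
    exact (Submodule.Quotient.eq _).2 (hFG z z.2)
  · refine Submodule.linearMap_qext _ (LinearMap.ext fun z => ?_)
    exact (Submodule.Quotient.eq _).2 (hGF z z.2)

theorem finrank_subquotient_eq_zero {Z B : Submodule K V} (h : ∀ z ∈ Z, z ∈ B) :
    Module.finrank K (Z ⧸ B.submoduleOf Z) = 0 := by
  have : B.submoduleOf Z = ⊤ := eq_top_iff.2 fun z _ => h z z.2
  rw [this]
  exact Module.finrank_zero_of_subsingleton

theorem finrank_subquotient_bot (Z : Submodule K V) :
    Module.finrank K (Z ⧸ (⊥ : Submodule K V).submoduleOf Z) = Module.finrank K Z := by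
  have : (⊥ : Submodule K V).submoduleOf Z = ⊥ := Submodule.ker_subtype Z
  rw [this]
  exact (Submodule.quotEquivOfEqBot ⊥ rfl).finrank_eq

theorem finrank_subquotient_top (B : Submodule K V) :
    Module.finrank K ((⊤ : Submodule K V) ⧸ B.submoduleOf ⊤) = Module.finrank K (V ⧸ B) :=
  LinearEquiv.finrank_eq (Submodule.Quotient.equiv _ _ Submodule.topEquiv (by
    rw [Submodule.submoduleOf]
    exact Submodule.map_comap_eq_of_surjective Submodule.topEquiv.surjective B))

end Compare

section HH

variable {K : Type u} [Field K] {s : ℕ} [NeZero s] {V' : Type*} [AddCommGroup V'] [Module K V']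

theorem finrank_HH_eq {n : ℕ} {Z' B' : Submodule K V'} (F : Coch K s n →ₗ[K] V')
    (G : V' →ₗ[K] Coch K s n) (hF : ∀ z, cobdry K s n z = 0 → F z ∈ Z')
    (hFB : ∀ z ∈ bdry (cobdry K s) n, F z ∈ B') (hG : ∀ z ∈ Z', cobdry K s n (G z) = 0)
    (hGB : ∀ z ∈ B', G z ∈ bdry (cobdry K s) n)
    (hGF : ∀ z, cobdry K s n z = 0 → G (F z) - z ∈ bdry (cobdry K s) n)
    (hFG : ∀ z ∈ Z', F (G z) - z ∈ B') :
    Module.finrank K (HH K s n) = Module.finrank K (Z' ⧸ B'.submoduleOf Z') := by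
  refine ((res K s).finrank_ext (cobdry K s) (homEquiv K s) homEquiv_comp n).trans ?_
  exact finrank_subquotient_eq F G hF hFB hG hGB hGF hFG

theorem finrank_HH_eq_zero {n : ℕ} 
    (h : ∀ z, cobdry K s n z = 0 → z ∈ bdry (cobdry K s) n) :
    Module.finrank K (HH K s n) = 0 := by
  refine ((res K s).finrank_ext (cobdry K s) (homEquiv K s) homEquiv_comp n).trans ?_
  exact finrank_subquotient_eq_zero h

end HH

section ReducedTables

/-- The source (`0`) and target (`1`) cells of the reduced complex, with their degrees. -/
def yTable : List (List (ℕ × ℤ)) := [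
  [(0, 0), (1, 1)],
  [(1, 0)],
  [],
  [(0, -1)],
  [(1, -1)],
  [(0, -2)],
  [(0, -3), (1, -2)],
  [(1, -3)],
  [(0, -4)],
  [(1, -4)],
  [(0, -5)],
  [(1, -5)],
  [(0, -6)],
  [(1, -6)],
  [(0, -7)],
  [(0, -8), (1, -7)],
  [(1, -8)],
  [(0, -9)],
  [(1, -9)],
  [],
  [(0, -10)],
  [(0, -11), (1, -10)]]

/-- The differentials of the reduced complex. -/
def pTable : List Comb := [
  [(0, 0, 0, -1), (0, 1, 0, 1)],
  [],
  [],
  [(0, 0, 0, 1), (0, 1, 0, 1)],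
  [],
  [(0, 0, 1, -1), (0, 0, 0, -1), (0, 1, 0, -1)],
  [(0, 0, 1, 1), (0, 0, 0, -1), (0, 1, 0, 1), (0, 2, 0, -1)],
  [],
  [(0, 0, 0, 1), (0, 1, 0, -1)],
  [],
  [(0, 0, 1, -1), (0, 0, 0, 1), (0, 1, 0, -1)],
  [],
  [(0, 0, 0, -1), (0, 1, 0, 1)],
  [],
  [(0, 0, 1, 1), (0, 0, 0, -1), (0, 1, 0, 1), (0, 2, 0, -1)],
  [(0, 0, 1, 1), (0, 0, 0, 1), (0, 1, 0, 1)],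
  [],
  [(0, 0, 0, 1), (0, 1, 0, 1)],
  [],
  [],
  [(0, 0, 0, 1), (0, 1, 0, -1)],
  [(0, 0, 5, -1), (0, 0, 4, -1), (0, 0, 2, 1), (0, 0, 0, -1), (0, 1, 0, -1)]]

/-- Exponents `e`, and cofactors of the differentials in `T ^ e - 1`. -/
def rTable : List (ℕ × Comb) := [
  (1, [(0, 0, 0, 1)]),
  (1, []),
  (1, []),
  (2, [(0, 0, 0, -1), (0, 1, 0, 1)]),
  (1, []),
  (3, [(0, 1, 0, 1), (0, 2, 0, -1)]),
  (4, [(0, 1, 0, -1), (0, 2, 0, -1)]),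
  (1, []),
  (1, [(0, 0, 0, -1)]),
  (1, []),
  (6, [(0, 1, 0, 1), (0, 2, 0, 1), (0, 4, 0, -1), (0, 5, 0, -1)]),
  (1, []),
  (1, [(0, 0, 0, 1)]),
  (1, []),
  (4, [(0, 1, 0, -1), (0, 2, 0, -1)]),
  (3, [(0, 1, 0, -1), (0, 2, 0, 1)]),
  (1, []),
  (2, [(0, 0, 0, -1), (0, 1, 0, 1)]),
  (1, []),
  (1, []),
  (1, [(0, 0, 0, -1)]),
  (12, [(0, 5, 0, 1), (0, 6, 0, -1), (0, 7, 0, 1), (0, 9, 0, -1), (0, 10, 0, 1), (0, 11, 0, -1)])]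

/-- The projection of the cochains to the reduced complex. -/
def fTable : List (List (ℕ × Comb)) := [
  [(0, [(0, 0, 0, 1)]), (1, [(11, 0, 2, 1), (11, 0, 1, 1), (11, 0, 0, 1), (1, 0, 4, 1),
    (1, 0, 3, 1), (1, 0, 2, 1), (3, 0, 5, 1), (3, 0, 3, -1), (3, 0, 2, -1), (5, 0, 5, -1),
    (5, 0, 4, -1), (5, 0, 1, -1), (5, 0, 0, -1), (7, 0, 2, -1), (7, 0, 1, -1), (9, 0, 3, -1),
    (9, 0, 2, -1)])],
  [(1, [(13, 0, 0, 1), (6, 1, 0, -1), (4, 1, 0, -1), (0, 1, 0, -1)])],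
  [],
  [(0, [(4, 0, 0, 1), (0, 0, 0, -1)])],
  [(1, [(17, 0, 0, 1), (7, 0, 0, 1), (15, 0, 0, -1), (3, 0, 0, -1)])],
  [(0, [(2, 0, 0, 1), (0, 0, 0, -1)])],
  [(0, [(10, 0, 0, 1)]), (1, [(15, 0, 0, 1), (1, 0, 1, -1), (1, 0, 0, -1), (3, 0, 1, -1),
    (3, 0, 0, -1), (7, 0, 0, 1), (11, 0, 1, -1), (11, 0, 0, -1), (13, 0, 0, -1)])],
  [(1, [(13, 0, 0, 1), (7, 0, 1, -1), (4, 1, 0, -1), (4, 2, 0, 1), (11, 1, 0, -1), (2, 2, 0, -1),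
    (15, 0, 1, 1), (15, 0, 0, -1), (15, 1, 0, 1), (0, 0, 0, 1), (0, 1, 0, -1), (0, 2, 0, 1)])],
  [(0, [(2, 0, 0, 1)])],
  [(1, [(11, 0, 0, 1), (3, 0, 0, -1)])],
  [(0, [(0, 0, 0, 1)])],
  [(1, [(11, 0, 0, 1), (1, 0, 1, 1), (1, 0, 0, -1)])],
  [(0, [(2, 0, 0, 1), (0, 0, 0, -1)])],
  [(1, [(9, 0, 0, 1), (0, 1, 0, 1), (5, 0, 0, -1)])],
  [(0, [(2, 0, 0, 1)])],
  [(0, [(2, 0, 0, 1)]), (1, [(13, 0, 0, 1), (9, 0, 1, 1), (9, 0, 0, -1), (9, 1, 0, 1),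
    (5, 0, 1, -1), (11, 1, 0, -1), (0, 2, 0, -1), (17, 0, 0, 1), (17, 1, 0, -1), (3, 0, 0, 1),
    (3, 1, 0, -1)])],
  [(1, [(13, 0, 0, 1), (6, 1, 0, -1), (5, 0, 0, -1), (2, 1, 0, 1), (9, 0, 1, 1), (0, 0, 0, 1)])],
  [(0, [(0, 0, 0, 1)])],
  [(1, [(11, 0, 0, 1), (7, 0, 0, -1), (4, 1, 0, -1), (2, 1, 0, 1)])],
  [],
  [(0, [(0, 0, 0, 1)])],
  [(0, [(8, 0, 0, 1)]), (1, [(11, 0, 0, 1), (5, 0, 0, -1), (3, 0, 0, -1), (9, 0, 0, 1),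
    (7, 0, 0, 1), (1, 0, 0, 1)])]]

/-- The inclusion of the reduced complex into the cochains. -/
def gTable : List (List (ℕ × Comb)) := [
  [(0, [(0, 0, 0, 1)]), (2, [(0, 0, 0, 1)]), (4, [(0, 0, 0, 1)]), (6, [(0, 0, 0, 1)]),
    (8, [(0, 0, 0, 1)]), (9, [(1, 1, 0, 1)]), (10, [(0, 0, 0, 1)]), (11, [(1, 0, 0, 1)])],
  [(13, [(1, 0, 0, 1)])],
  [],
  [(4, [(0, 0, 0, 1)]), (8, [(0, 0, 0, -1)]), (11, [(0, 1, 0, 1)]), (15, [(0, 1, 0, 1)])],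
  [(17, [(1, 0, 0, 1)])],
  [(2, [(0, 0, 0, 1)]), (9, [(0, 0, 0, -1)]), (10, [(0, 0, 1, -1), (0, 0, 0, -1)]),
    (15, [(0, 0, 0, -1), (0, 1, 0, -1)])],
  [(0, [(0, 0, 0, -1), (0, 1, 0, 1)]), (2, [(0, 0, 1, -1), (0, 0, 0, 1), (0, 1, 0, -1)]),
    (6, [(0, 0, 1, -1)]), (10, [(0, 0, 0, 1)]), (12, [(0, 1, 0, -1)]), (14, [(0, 0, 0, 1),
    (0, 1, 0, -1)]), (15, [(1, 0, 0, 1)]), (17, [(0, 2, 0, -1)])],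
  [(13, [(1, 0, 0, 1)])],
  [(2, [(0, 0, 0, 1)]), (6, [(0, 0, 0, -1)]), (11, [(0, 1, 0, -1)])],
  [(11, [(1, 0, 0, 1)]), (13, [(1, 0, 0, 1)])],
  [(0, [(0, 0, 0, 1)]), (10, [(0, 0, 1, 1), (0, 0, 0, -1)])],
  [(11, [(1, 0, 0, 1)])],
  [(2, [(0, 0, 0, 1)]), (10, [(0, 0, 0, -1)]), (13, [(0, 0, 0, -1)])],
  [(9, [(1, 0, 0, 1)])],
  [(0, [(0, 0, 1, -1), (0, 0, 0, 1), (0, 1, 0, -1)]), (2, [(0, 0, 0, 1)]), (4, [(0, 0, 1, -1)]),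
    (8, [(0, 1, 0, -1)]), (11, [(0, 1, 0, -1), (0, 2, 0, 1)]), (13, [(0, 1, 0, -1)]),
    (15, [(0, 0, 0, -1)])],
  [(2, [(0, 0, 0, 1)]), (4, [(0, 0, 0, 1)]), (8, [(0, 0, 1, 1), (0, 0, 0, 1)]),
    (10, [(0, 0, 0, -1)]), (12, [(0, 0, 1, -1), (0, 0, 0, -1)]), (13, [(1, 0, 0, 1)]),
    (16, [(0, 0, 1, 1), (0, 0, 0, 1)])],
  [(13, [(1, 0, 0, 1)]), (15, [(1, 0, 0, 1)])],
  [(0, [(0, 0, 0, 1)]), (4, [(0, 0, 0, 1)]), (8, [(0, 0, 0, -1)]), (14, [(0, 0, 0, 1)]),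
    (17, [(0, 0, 0, 1), (0, 1, 0, 1)])],
  [(11, [(1, 0, 0, 1)]), (13, [(1, 0, 0, 1)])],
  [],
  [(0, [(0, 0, 0, 1)]), (7, [(0, 1, 0, 1)]), (9, [(0, 1, 0, 1)]), (11, [(0, 1, 0, 1)])],
  [(0, [(0, 0, 4, 1), (0, 0, 1, -1)]), (2, [(0, 0, 3, -1), (0, 1, 0, -1)]), (4, [(0, 0, 4, 1),
    (0, 0, 3, 1), (0, 0, 2, -1), (0, 0, 1, -1), (0, 1, 0, 1)]), (6, [(0, 0, 1, 1)]),
    (8, [(0, 0, 0, 1)]), (10, [(0, 0, 5, -1), (0, 0, 1, -1), (0, 0, 0, -1)]),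
    (11, [(1, 0, 0, 1)])]]

/-- The homotopy contracting the cochains to the reduced complex. -/
def hhTable : List (List (ℕ × Comb)) := [
  [(2, [(0, 0, 0, -1)]), (4, [(4, 0, 0, -1), (0, 0, 0, -1)]), (6, [(2, 0, 0, -1)]),
    (8, [(8, 0, 0, -1), (2, 0, 0, -1)]), (10, [(6, 0, 0, -1), (4, 0, 0, -1), (0, 0, 0, -1)])],
  [(10, [(0, 0, 0, -1)])],
  [(2, [(0, 0, 0, 1)]), (6, [(2, 0, 0, -1)]), (11, [(7, 0, 0, -1)])],
  [(8, [(0, 0, 0, -1)]), (11, [(3, 0, 0, -1)]), (13, [(7, 0, 0, -1)]), (15, [(15, 0, 0, -1),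
    (3, 0, 0, -1)])],
  [(2, [(0, 0, 0, -1)]), (16, [(6, 0, 0, -1)])],
  [(5, [(3, 0, 0, -1)]), (9, [(11, 0, 0, -1)]), (10, [(1, 0, 1, -1), (3, 0, 1, -1),
    (11, 0, 1, -1)]), (13, [(7, 0, 0, -1)]), (15, [(13, 0, 0, -1), (1, 0, 0, -1), (3, 0, 0, -1),
    (11, 0, 0, -1)])],
  [(0, [(15, 0, 0, -1), (0, 1, 0, -1), (11, 0, 0, 1), (2, 1, 0, 1), (4, 1, 0, -1)]),
    (2, [(11, 0, 0, -1), (2, 1, 0, -1), (7, 0, 1, 1), (4, 1, 0, 1), (15, 0, 1, -1), (15, 0, 0, 1),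
    (0, 0, 0, -1), (0, 1, 0, 1)]), (6, [(7, 0, 1, 1), (15, 0, 1, -1)]), (12, [(2, 0, 0, -1),
    (2, 1, 0, -1), (15, 0, 0, 1), (0, 1, 0, 1), (11, 0, 0, -1), (4, 1, 0, 1)]),
    (14, [(4, 0, 0, -1), (4, 1, 0, 1), (0, 0, 0, -1), (0, 1, 0, 1), (15, 0, 0, 1), (11, 0, 0, -1),
    (2, 1, 0, -1)]), (17, [(11, 0, 0, -1), (11, 1, 0, -1), (2, 1, 0, -1), (2, 2, 0, -1),
    (15, 1, 0, 1), (0, 2, 0, 1), (4, 2, 0, 1)])],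
  [(8, [(0, 0, 0, -1)])],
  [(6, [(0, 0, 0, 1)]), (11, [(3, 0, 0, -1)])],
  [(7, [(1, 0, 0, -1)]), (13, [(11, 0, 0, -1)])],
  [(10, [(1, 0, 1, -1)])],
  [(0, [(0, 0, 0, 1)]), (10, [(6, 0, 0, -1)])],
  [(10, [(0, 0, 0, -1)]), (13, [(5, 0, 0, -1)])],
  [(11, [(7, 0, 0, -1)])],
  [(0, [(17, 0, 0, -1), (5, 0, 1, 1), (9, 0, 1, -1), (9, 0, 0, 1), (11, 0, 0, -1), (0, 1, 0, -1),
    (3, 0, 0, -1)]), (4, [(9, 0, 1, -1), (5, 0, 1, 1)]), (8, [(0, 0, 0, -1), (0, 1, 0, -1),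
    (9, 0, 0, 1), (17, 0, 0, -1), (11, 0, 0, -1), (3, 0, 0, -1)]), (11, [(3, 0, 0, -1),
    (3, 1, 0, 1), (9, 1, 0, -1), (17, 1, 0, 1), (11, 1, 0, 1), (0, 2, 0, 1)]),
    (13, [(11, 0, 0, -1), (0, 1, 0, -1), (3, 0, 0, -1)]), (15, [(9, 0, 0, -1)])],
  [(4, [(2, 0, 0, 1)]), (8, [(5, 0, 1, -1), (2, 0, 0, 1)]), (10, [(0, 0, 0, -1)]),
    (12, [(9, 0, 1, -1), (0, 0, 0, -1)]), (16, [(6, 0, 0, -1), (5, 0, 1, -1), (2, 0, 0, 1)])],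
  [(10, [(1, 0, 1, -1)]), (15, [(15, 0, 0, -1), (1, 0, 1, -1)])],
  [(4, [(2, 0, 0, 1)]), (8, [(0, 0, 0, -1)]), (14, [(4, 0, 0, -1), (2, 0, 0, 1)]),
    (17, [(7, 0, 0, -1), (4, 1, 0, -1), (2, 1, 0, 1)])],
  [(8, [(0, 0, 0, -1)]), (13, [(9, 0, 0, -1)]), (15, [(5, 0, 0, -1)])],
  [(11, [(3, 0, 0, -1)])],
  [(5, [(3, 0, 0, -1)]), (7, [(1, 0, 0, -1)]), (9, [(7, 0, 0, -1), (1, 0, 0, -1)]),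
    (11, [(9, 0, 0, -1), (7, 0, 0, -1), (1, 0, 0, -1)]), (13, [(5, 0, 0, -1), (3, 0, 0, -1)])],
  [(0, [(3, 0, 4, -1), (3, 0, 3, 1), (3, 0, 1, 1), (1, 0, 3, -1), (1, 0, 1, -1), (5, 0, 4, 1),
    (7, 0, 1, 1), (9, 0, 2, 1), (11, 0, 1, -1)]), (2, [(9, 0, 1, -1), (3, 0, 3, 1), (3, 0, 2, -1),
    (5, 0, 3, -1), (5, 0, 0, -1), (11, 0, 0, 1), (1, 0, 2, 1)]), (4, [(7, 0, 1, 1), (3, 0, 4, -1),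
    (3, 0, 2, 2), (5, 0, 4, 1), (5, 0, 3, 1), (5, 0, 2, -1), (5, 0, 0, 1), (9, 0, 2, 1),
    (9, 0, 1, 1), (11, 0, 1, -1), (11, 0, 0, -1), (1, 0, 3, -1), (1, 0, 2, -1)]),
    (6, [(5, 0, 1, 1), (3, 0, 1, -1)]), (10, [(1, 0, 4, 1), (1, 0, 2, 1), (5, 0, 5, -1),
    (5, 0, 2, -1), (5, 0, 1, -1), (7, 0, 2, -1), (9, 0, 3, -1), (3, 0, 5, 1), (3, 0, 4, -1),
    (11, 0, 2, 1)])]]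

/-- A row of a sparse matrix. -/
def sparseRow (T : List (List (ℕ × Comb))) (n a : ℕ) : Comb :=
  ((T.getD (n % 22) []).filter fun x => Nat.beq x.1 a).flatMap fun x => x.2

/-- The map from the complex of cochains to the reduced complex. -/
def fL (n a : ℕ) : Comb := sparseRow fTable n a

/-- The map from the reduced complex to the complex of cochains. -/
def gL (n a : ℕ) : Comb := sparseRow gTable n a

/-- The homotopy between the composite of `gL` after `fL` and the identity. -/
def hL (n a : ℕ) : Comb := sparseRow hhTable n a

/-- The polynomial by which the differential of the reduced complex acts. -/
def pPoly (n : ℕ) : Comb := pTable.getD (n % 22) []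

/-- The differential of the reduced complex. -/
def pL (n y : ℕ) : Comb := if Nat.beq y 1 then pPoly n else []

/-- A number `d` with a cofactor of `pPoly` whose product with it is the shift by `d` minus the
identity. -/
def rPoly (n : ℕ) : ℕ × Comb := rTable.getD (n % 22) (1, [])

/-- The cells of the reduced complex in a degree, with their weights. -/
def yRow (n : ℕ) : List (ℕ × ℤ) := yTable.getD (n % 22) []

/-- Whether a cell of the reduced complex exists. -/
def okY (n y : ℕ) : Bool := (yRow n).any fun x => Nat.beq x.1 y

/-- The total degree of a cell of the reduced complex. -/
def qY (n y : ℕ) : ℤ :=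
  (((yRow n).filter fun x => Nat.beq x.1 y).map fun x => x.2).sum - 12 * ((n / 22 : ℕ) : ℤ)

/-- The product of two matrices of formal linear combinations. -/
def comp (M N : ℕ → Comb) (a : ℕ) : Comb :=
  (M a).flatMap fun t => (N t.1).map fun x =>
    (x.1, t.2.1 + x.2.1, t.2.2.1 + x.2.2.1, t.2.2.2 * x.2.2.2)

/-- A formal linear combination of translations, with terms brought to normal form. -/
def normTerms (L : Comb) : Comb :=
  L.map fun x => (x.1, x.2.1 - x.2.2.1, x.2.2.1 - x.2.1, 1 * x.2.2.2)

/-- Whether the coefficients of all terms cancel. -/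
def cancels (L : Comb) : Bool :=
  L.all fun t => ((L.filter (sameKey t)).map fun x => x.2.2.2).sum == 0

/-- Whether two formal linear combinations of translations agree. -/
def agree (L L' : Comb) : Bool :=
  cancels (evalAppend (normTerms (L ++ L'.map fun x => (x.1, x.2.1, x.2.2.1, -1 * x.2.2.2))) [])

/-- Whether a combination is homogeneous for the given weights. -/
def homogRow (L : Comb) (okC : ℕ → Bool) (b : Bool) (q : ℕ → ℤ) (q' : ℤ) : Bool :=
  L.all fun t => b && okC t.1 && q t.1 == q'

theorem fL_homog_small : (allBelow 22 fun n => allBelow 2 fun y =>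
    homogRow (fL n y) (okX n) (okY n y) (qX n) (qY n y)) = true := by
  decide +kernel

theorem gL_homog_small : (allBelow 22 fun n => allBelow 18 fun a =>
    homogRow (gL n a) (okY n) (okX n a) (qY n) (qX n a)) = true := by
  decide +kernel

theorem hL_homog_small : (allBelow 22 fun n => allBelow 18 fun a =>
    homogRow (hL n a) (okX (n + 1)) (okX n a) (qX (n + 1)) (qX n a)) = true := by
  decide +kernel

theorem pL_homog_small : (allBelow 22 fun n => allBelow 2 fun y =>
    homogRow (pL n y) (okY n) (okY (n + 1) y) (qY n) (qY (n + 1) y)) = true := by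
  decide +kernel

theorem fL_dL_small : (allBelow 22 fun n => allBelow 2 fun y =>
    agree (comp (fL (n + 1)) (dL n) y) (comp (pL n) (fL n) y)) = true := by
  decide +kernel

theorem dL_gL_small : (allBelow 22 fun n => allBelow 18 fun a =>
    agree (comp (dL n) (gL n) a) (comp (gL (n + 1)) (pL n) a)) = true := by
  decide +kernel

theorem fL_gL_small : (allBelow 22 fun n => allBelow 2 fun y =>
    !okY n y || agree (comp (fL n) (gL n) y) [(y, 0, 0, 1)]) = true := by
  decide +kernel

theorem gL_fL_small : (allBelow 22 fun n => allBelow 18 fun a =>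
    !okX (n + 1) a || agree (comp (gL (n + 1)) (fL (n + 1)) a)
      ((a, 0, 0, 1) :: (comp (dL n) (hL n) a ++ comp (hL (n + 1)) (dL (n + 1)) a))) = true := by
  decide +kernel

theorem gL_fL_zero_small : (allBelow 18 fun a => Nat.beq (a % 2) 1 || !okX 0 a ||
    agree (comp (gL 0) (fL 0) a) ((a, 0, 0, 1) :: comp (hL 0) (dL 0) a)) = true := by
  decide +kernel

theorem qX_zero_small :
    (allBelow 18 fun a => !okX 0 a || qX 0 a == ((a % 2 : ℕ) : ℤ)) = true := by
  decide +kernel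

theorem tables_bounded : ((fTable.all fun r => r.all fun x => Nat.blt x.1 2) &&
    (gTable.all fun r => r.all fun x => Nat.blt x.1 18) &&
    (hhTable.all fun r => r.all fun x => Nat.blt x.1 18)) = true := by
  decide +kernel

theorem yTable_bounded : (yTable.all fun r => r.all fun x => Nat.blt x.1 2) = true := by
  decide +kernel

theorem qY_small : (allBelow 22 fun n => !okY n 0 || !okY n 1 || qY n 1 == qY n 0 + 1) = true := by
  decide +kernel

theorem qY_target_small : (allBelow 22 fun n => !okY (n + 1) 1 ||
    (okY n 0 && qY n 0 == qY (n + 1) 1)) = true := by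
  decide +kernel

theorem qY_zero_small : (okY 0 0 && qY 0 0 == 0) = true := by
  decide +kernel

theorem rPoly_small : (allBelow 22 fun n => !okY n 0 ||
    agree (comp (fun _ => (rPoly n).2) (fun _ => pPoly n) 0)
      [(0, (rPoly n).1, 0, 1), (0, 0, 0, -1)]) = true := by
  decide +kernel

theorem pPoly_small : (allBelow 22 fun n => (pPoly n).all fun t => Nat.beq t.1 0) = true := by
  decide +kernel

theorem coprime_small : (allBelow 22 fun n => !okY n 0 ||
    (Nat.beq (Int.gcd (rPoly n).1 (qY n 0)) 1 && Nat.beq (12 % (rPoly n).1) 0)) = true := by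
  decide +kernel

end ReducedTables

section Formal

variable {n m : ℕ}

theorem okX_congr (h : n % 22 = m % 22) : okX n = okX m := by
  funext a
  rw [okX, okX, cl_congr h, cr_congr h]

theorem dL_congr (h : n % 22 = m % 22) : dL n = dL m := by
  funext a
  rw [dL, dL, dRow_congr h, okX_congr h, okX_congr (show (n + 1) % 22 = (m + 1) % 22 by omega)]

theorem sparseRow_congr (T : List (List (ℕ × Comb))) (h : n % 22 = m % 22) :
    sparseRow T n = sparseRow T m := by
  funext a
  rw [sparseRow, sparseRow, h]

theorem fL_congr (h : n % 22 = m % 22) : fL n = fL m := sparseRow_congr _ h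

theorem gL_congr (h : n % 22 = m % 22) : gL n = gL m := sparseRow_congr _ h

theorem hL_congr (h : n % 22 = m % 22) : hL n = hL m := sparseRow_congr _ h

theorem pPoly_congr (h : n % 22 = m % 22) : pPoly n = pPoly m := by
  rw [pPoly, pPoly, h]

theorem rPoly_congr (h : n % 22 = m % 22) : rPoly n = rPoly m := by
  rw [rPoly, rPoly, h]

theorem pL_congr (h : n % 22 = m % 22) : pL n = pL m := by
  funext y
  rw [pL, pL, pPoly_congr h]

theorem yRow_congr (h : n % 22 = m % 22) : yRow n = yRow m := by
  rw [yRow, yRow, h]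

theorem okY_congr (h : n % 22 = m % 22) : okY n = okY m := by
  funext y
  rw [okY, okY, yRow_congr h]

theorem qX_add (n a k : ℕ) : qX (n % 22 + k) a = qX (n + k) a + 12 * ((n / 22 : ℕ) : ℤ) := by
  rw [qX, qX, cM_add]
  ring

theorem qY_add (n y k : ℕ) : qY (n % 22 + k) y = qY (n + k) y + 12 * ((n / 22 : ℕ) : ℤ) := by
  have h : (n % 22 + k) % 22 = (n + k) % 22 := by omega
  have h' : ((n % 22 + k) / 22 : ℕ) + n / 22 = (n + k) / 22 := by omega
  rw [qY, qY, yRow_congr h, ← h']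
  push_cast
  ring

theorem lt_of_mem_sparseRow {T : List (List (ℕ × Comb))} {b a : ℕ} {t : ℕ × ℕ × ℕ × ℤ}
    (h : (T.all fun r => r.all fun x => Nat.blt x.1 b) = true) (ht : t ∈ sparseRow T n a) :
    a < b := by
  obtain ⟨x, hx, -⟩ := List.mem_flatMap.1 ht
  obtain ⟨hx, hxa⟩ := List.mem_filter.1 hx
  rw [List.getD_eq_getElem?_getD] at hx
  cases hr : T[n % 22]? with
  | none => simp [hr] at hx
  | some r =>
    have := List.all_eq_true.1 (List.all_eq_true.1 h r (List.mem_of_getElem? hr)) x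
      (by simpa [hr] using hx)
    rw [Nat.blt_eq] at this
    rwa [Nat.eq_of_beq_eq_true hxa] at this

theorem homogRow_spec {L : Comb} {okC : ℕ → Bool} {b : Bool} {q : ℕ → ℤ} {q' : ℤ}
    (h : homogRow L okC b q q' = true) {t : ℕ × ℕ × ℕ × ℤ} (ht : t ∈ L) :
    b = true ∧ okC t.1 = true ∧ q t.1 = q' := by
  have := List.all_eq_true.1 h t ht
  simpa [and_assoc] using this

theorem homog_fL (n : ℕ) : Homog (fL n) (okX n) (okY n) (qX n) (qY n) := by
  intro y t ht
  have hy : y < 2 := by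
    have := tables_bounded
    simp only [Bool.and_eq_true] at this
    exact lt_of_mem_sparseRow this.1.1 ht
  have hn : n % 22 < 22 := Nat.mod_lt _ (by norm_num)
  have h := allBelow_iff.1 (allBelow_iff.1 fL_homog_small _ hn) y hy
  rw [fL_congr (Nat.mod_mod n 22), okX_congr (Nat.mod_mod n 22), okY_congr (Nat.mod_mod n 22)] at h
  obtain ⟨h1, h2, h3⟩ := homogRow_spec h ht
  have e1 := qX_add n t.1 0
  have e2 := qY_add n y 0
  simp only [add_zero] at e1 e2
  exact ⟨h1, h2, by linarith⟩

theorem homog_gL (n : ℕ) : Homog (gL n) (okY n) (okX n) (qY n) (qX n) := by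
  intro a t ht
  have ha : a < 18 := by
    have := tables_bounded
    simp only [Bool.and_eq_true] at this
    exact lt_of_mem_sparseRow this.1.2 ht
  have hn : n % 22 < 22 := Nat.mod_lt _ (by norm_num)
  have h := allBelow_iff.1 (allBelow_iff.1 gL_homog_small _ hn) a ha
  rw [gL_congr (Nat.mod_mod n 22), okX_congr (Nat.mod_mod n 22), okY_congr (Nat.mod_mod n 22)] at h
  obtain ⟨h1, h2, h3⟩ := homogRow_spec h ht
  have e1 := qX_add n a 0
  have e2 := qY_add n t.1 0
  simp only [add_zero] at e1 e2
  exact ⟨h1, h2, by linarith⟩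

theorem mod_add_one_mod (n : ℕ) : (n % 22 + 1) % 22 = (n + 1) % 22 := by omega

theorem homog_hL (n : ℕ) : Homog (hL n) (okX (n + 1)) (okX n) (qX (n + 1)) (qX n) := by
  intro a t ht
  have ha : a < 18 := by
    have := tables_bounded
    simp only [Bool.and_eq_true] at this
    exact lt_of_mem_sparseRow this.2 ht
  have hn : n % 22 < 22 := Nat.mod_lt _ (by norm_num)
  have h := allBelow_iff.1 (allBelow_iff.1 hL_homog_small _ hn) a ha
  rw [hL_congr (Nat.mod_mod n 22), okX_congr (Nat.mod_mod n 22),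
    okX_congr (mod_add_one_mod n)] at h
  obtain ⟨h1, h2, h3⟩ := homogRow_spec h ht
  have e1 := qX_add n a 0
  have e2 := qX_add n t.1 1
  simp only [add_zero] at e1 e2
  exact ⟨h1, h2, by linarith⟩

theorem homog_pL (n : ℕ) : Homog (pL n) (okY n) (okY (n + 1)) (qY n) (qY (n + 1)) := by
  intro y t ht
  have hy : y < 2 := by
    by_contra hy
    have : Nat.beq y 1 = false :=
      Bool.eq_false_iff.2 fun h => hy (by rw [Nat.eq_of_beq_eq_true h]; norm_num)
    simp [pL, this] at ht
  have hn : n % 22 < 22 := Nat.mod_lt _ (by norm_num)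
  have h := allBelow_iff.1 (allBelow_iff.1 pL_homog_small _ hn) y hy
  rw [pL_congr (Nat.mod_mod n 22), okY_congr (Nat.mod_mod n 22),
    okY_congr (mod_add_one_mod n)] at h
  obtain ⟨h1, h2, h3⟩ := homogRow_spec h ht
  have e1 := qY_add n y 1
  have e2 := qY_add n t.1 0
  simp only [add_zero] at e1 e2
  exact ⟨h1, h2, by linarith⟩

end Formal

section Operators

variable {K : Type u} [Field K] {s : ℕ}

theorem app_comp (M N : ℕ → Comb) (f : ℕ → ZMod s → K) :
    app K s (comp M N) f = app K s M (app K s N f) := by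
  funext a k
  change evalL (fun b u v => f b (k - u + v)) (comp M N a) =
    evalL (fun b u v => evalL (fun b' u' v' => f b' (k - u + v - u' + v')) (N b)) (M a)
  rw [comp, evalL_flatMap, evalL]
  congr 1
  refine List.map_congr_left fun t _ => ?_
  rw [evalL_map (fun b u v => f b (k - u + v)) (N t.1) (fun c _ _ => c) (fun _ u _ => t.2.1 + u)
      (fun _ _ v => t.2.2.1 + v) t.2.2.2]
  congr 2
  funext b u v
  congr 1
  push_cast
  ring

theorem evalL_normTerms (L : Comb) (f : ℕ → ZMod s → K) (k : ZMod s) :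
    evalL (fun b u v => f b (k - u + v)) (normTerms L) =
      evalL (fun b u v => f b (k - u + v)) L := by
  rw [normTerms, evalL_map (fun b u v => f b (k - u + v)) L (fun c _ _ => c)
    (fun _ u v => u - v) (fun _ u v => v - u) 1, one_smul]
  congr 1
  funext b u v
  congr 1
  rcases le_total u v with h | h
  · rw [Nat.sub_eq_zero_of_le h, Nat.cast_sub h]
    push_cast
    ring
  · rw [Nat.sub_eq_zero_of_le h, Nat.cast_sub h]
    push_cast
    ring

theorem evalL_of_agree {L L' : Comb} (h : agree L L' = true) (f : ℕ → ZMod s → K) (k : ZMod s) :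
    evalL (fun b u v => f b (k - u + v)) L = evalL (fun b u v => f b (k - u + v)) L' := by
  have h0 := evalL_eq_zero (fun b (u v : ℕ) => f b (k - u + v)) fun t ht =>
    Or.inr (eq_of_beq (List.all_eq_true.1 h t ht))
  rw [evalL_evalAppend, evalL_normTerms, evalL_append,
    evalL_map (fun b u v => f b (k - u + v)) L' (fun c _ _ => c) (fun _ u _ => u)
      (fun _ _ v => v) (-1), neg_one_smul, ← sub_eq_add_neg] at h0
  exact sub_eq_zero.1 h0

theorem app_fL_dL (n : ℕ) (x : ℕ → ZMod s → K) {y : ℕ} (hy : y < 2) :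
    app K s (fL (n + 1)) (app K s (dL n) x) y = app K s (pL n) (app K s (fL n) x) y := by
  have h := allBelow_iff.1 (allBelow_iff.1 fL_dL_small _ (Nat.mod_lt n (by norm_num))) y hy
  rw [fL_congr (mod_add_one_mod n), dL_congr (Nat.mod_mod n 22), pL_congr (Nat.mod_mod n 22),
    fL_congr (Nat.mod_mod n 22)] at h
  rw [← app_comp, ← app_comp]
  exact funext fun k => evalL_of_agree h x k

theorem app_dL_gL (n : ℕ) (w : ℕ → ZMod s → K) {a : ℕ} (ha : a < 18) :
    app K s (dL n) (app K s (gL n) w) a = app K s (gL (n + 1)) (app K s (pL n) w) a := by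
  have h := allBelow_iff.1 (allBelow_iff.1 dL_gL_small _ (Nat.mod_lt n (by norm_num))) a ha
  rw [gL_congr (mod_add_one_mod n), dL_congr (Nat.mod_mod n 22), pL_congr (Nat.mod_mod n 22),
    gL_congr (Nat.mod_mod n 22)] at h
  rw [← app_comp, ← app_comp]
  exact funext fun k => evalL_of_agree h w k

theorem evalL_self (f : ℕ → ZMod s → K) (a : ℕ) (k : ZMod s) :
    evalL (fun b u v => f b (k - u + v)) [(a, 0, 0, 1)] = f a k := by
  simp [evalL]

theorem app_fL_gL (n : ℕ) (w : ℕ → ZMod s → K) {y : ℕ} (hy : y < 2) (hok : okY n y = true) :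
    app K s (fL n) (app K s (gL n) w) y = w y := by
  have h := allBelow_iff.1 (allBelow_iff.1 fL_gL_small _ (Nat.mod_lt n (by norm_num))) y hy
  rw [fL_congr (Nat.mod_mod n 22), gL_congr (Nat.mod_mod n 22), okY_congr (Nat.mod_mod n 22),
    hok, Bool.not_true, Bool.false_or] at h
  rw [← app_comp]
  exact funext fun k => (evalL_of_agree h w k).trans (evalL_self w y k)

theorem app_gL_fL (n : ℕ) (x : ℕ → ZMod s → K) {a : ℕ} (ha : okX (n + 1) a = true) :
    app K s (gL (n + 1)) (app K s (fL (n + 1)) x) a =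
      x a + (app K s (dL n) (app K s (hL n) x) a +
        app K s (hL (n + 1)) (app K s (dL (n + 1)) x) a) := by
  have h := allBelow_iff.1 (allBelow_iff.1 gL_fL_small _ (Nat.mod_lt n (by norm_num))) a
    (okX_lt ha)
  rw [fL_congr (mod_add_one_mod n), gL_congr (mod_add_one_mod n), okX_congr (mod_add_one_mod n),
    dL_congr (Nat.mod_mod n 22), hL_congr (Nat.mod_mod n 22), hL_congr (mod_add_one_mod n),
    dL_congr (mod_add_one_mod n), ha, Bool.not_true, Bool.false_or] at h
  rw [← app_comp, ← app_comp, ← app_comp]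
  refine funext fun k => (evalL_of_agree h x k).trans ?_
  rw [← List.singleton_append, evalL_append, evalL_append, evalL_self]
  rfl

theorem app_gL_fL_zero (x : ℕ → ZMod s → K) {a : ℕ} (ha : okX 0 a = true) (ha' : a % 2 = 0) :
    app K s (gL 0) (app K s (fL 0) x) a = x a + app K s (hL 0) (app K s (dL 0) x) a := by
  have h := allBelow_iff.1 gL_fL_zero_small a (okX_lt ha)
  rw [ha, ha', Bool.not_true, Bool.or_false, show Nat.beq 0 1 = false from rfl,
    Bool.false_or] at h
  rw [← app_comp, ← app_comp]
  refine funext fun k => (evalL_of_agree h x k).trans ?_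
  rw [← List.singleton_append, evalL_append, evalL_self]
  rfl

end Operators

section Reduction

variable (K : Type u) [Field K] (s : ℕ)

/-- Formal linear combinations of translations, acting on functions. -/
def polyOp (L : Comb) : (ZMod s → K) →ₗ[K] (ZMod s → K) :=
  LinearMap.proj 0 ∘ₗ app K s (fun _ => L) ∘ₗ LinearMap.pi fun _ => LinearMap.id

variable {K s}

theorem polyOp_apply (L : Comb) (w : ZMod s → K) (k : ZMod s) :
    polyOp K s L w k = evalL (fun _ u v => w (k - u + v)) L := rfl

theorem pPoly_cell {n : ℕ} {t : ℕ × ℕ × ℕ × ℤ} (ht : t ∈ pPoly n) : t.1 = 0 := by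
  have h := allBelow_iff.1 pPoly_small _ (Nat.mod_lt n (by norm_num))
  rw [pPoly_congr (Nat.mod_mod n 22)] at h
  exact Nat.eq_of_beq_eq_true (List.all_eq_true.1 h t ht)

theorem app_pL_one (n : ℕ) (f : ℕ → ZMod s → K) :
    app K s (pL n) f 1 = polyOp K s (pPoly n) (f 0) := by
  funext k
  exact evalL_congr (f := fun b u v => f b (k - u + v)) (g := fun _ u v => f 0 (k - u + v))
    fun t ht => by rw [pPoly_cell ht]

theorem app_pL_of_ne (n : ℕ) (f : ℕ → ZMod s → K) {y : ℕ} (hy : y ≠ 1) :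
    app K s (pL n) f y = 0 := by
  have : Nat.beq y 1 = false := Bool.eq_false_iff.2 fun h => hy (Nat.eq_of_beq_eq_true h)
  funext k
  change evalL (fun b u v => f b (k - u + v)) (pL n y) = 0
  rw [pL, this]
  rfl

theorem okY_lt {n y : ℕ} (h : okY n y = true) : y < 2 := by
  obtain ⟨x, hx, hxy⟩ := List.any_eq_true.1 h
  rw [yRow, List.getD_eq_getElem?_getD] at hx
  cases hr : yTable[n % 22]? with
  | none => simp [hr] at hx
  | some r =>
    have := List.all_eq_true.1 (List.all_eq_true.1 yTable_bounded r (List.mem_of_getElem? hr)) x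
      (by simpa [hr] using hx)
    rw [Nat.blt_eq] at this
    rwa [Nat.eq_of_beq_eq_true hxy] at this

/-- The cells contributing to the reduced complex. -/
abbrev ActiveY (s n y : ℕ) : Prop := Active s (okY n) (qY n) y

theorem activeY_unique (hs : 1 < s) {n y y' : ℕ} (h : ActiveY s n y) (h' : ActiveY s n y') :
    y = y' := by
  have key : ActiveY s n 0 → ¬ ActiveY s n 1 := by
    intro h0 h1
    have h := allBelow_iff.1 qY_small _ (Nat.mod_lt n (by norm_num))
    rw [okY_congr (Nat.mod_mod n 22), h0.1, h1.1] at h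
    have h2 : qY (n % 22) 1 = qY (n % 22) 0 + 1 := by simpa using h
    have e0 := qY_add n 0 0
    have e1 := qY_add n 1 0
    simp only [add_zero] at e0 e1
    have h3 : qY n 1 = qY n 0 + 1 := by linarith
    have h4 := h1.2
    rw [h3, Int.cast_add, h0.2, zero_add, Int.cast_one] at h4
    have : Fact (1 < s) := ⟨hs⟩
    exact one_ne_zero h4
  have hy := okY_lt h.1
  have hy' := okY_lt h'.1
  interval_cases y <;> interval_cases y'
  · rfl
  · exact absurd h' (key h)
  · exact absurd h (key h')
  · rfl

theorem app_fL_eq_single (hs : 1 < s) {n y : ℕ} (hy : ActiveY s n y) {x : ℕ → ZMod s → K}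
    (hx : x ∈ Coch K s n) : app K s (fL n) x = Pi.single y (app K s (fL n) x y) := by
  funext y'
  by_cases h : y' = y
  · subst h
    rw [Pi.single_eq_same]
  · rw [Pi.single_eq_of_ne h]
    exact (homog_fL n).app_mem hx y' fun h' => h (activeY_unique hs h' hy)

theorem single_mem_supp {n y : ℕ} (hy : ActiveY s n y) (w : ZMod s → K) :
    Pi.single y w ∈ supp K s (okY n) (qY n) := fun y' hy' => by
  rw [Pi.single_eq_of_ne]
  rintro rfl
  exact hy' hy

theorem app_eq_of_cells {n : ℕ} {x x' : ℕ → ZMod s → K} (hx : x ∈ Coch K s n)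
    (hx' : x' ∈ Coch K s n) (h : ∀ a, Active s (okX n) (qX n) a → x a = x' a) : x = x' := by
  funext a
  by_cases ha : Active s (okX n) (qX n) a
  · exact h a ha
  · rw [hx a ha, hx' a ha]

theorem gL_fL_mem (hs : 1 < s) {n : ℕ} {z z' : Coch K s n} (hz : cobdry K s n z = 0)
    (hz' : (z' : ℕ → ZMod s → K) = app K s (gL n) (app K s (fL n) z)) :
    z' - z ∈ bdry (cobdry K s) n := by
  have hz0 : app K s (dL n) z = 0 := congrArg Subtype.val hz
  cases n with
  | zero =>
    have : z' = z := by
      refine Subtype.ext (app_eq_of_cells z'.2 z.2 fun a ha => ?_)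
      have h := allBelow_iff.1 qX_zero_small a (okX_lt ha.1)
      rw [ha.1, Bool.not_true, Bool.false_or, beq_iff_eq] at h
      have h2 := ha.2
      have ha2 : a % 2 = 0 := by
        have : Fact (1 < s) := ⟨hs⟩
        rcases Nat.mod_two_eq_zero_or_one a with h0 | h1
        · exact h0
        · rw [h, h1, Nat.cast_one, Int.cast_one] at h2
          exact absurd h2 one_ne_zero
      rw [hz', app_gL_fL_zero _ ha.1 ha2, hz0, map_zero]
      exact add_zero _
    rw [this, sub_self]
    exact Submodule.zero_mem _
  | succ n =>
    refine ⟨⟨app K s (hL n) z, (homog_hL n).app_mem z.2⟩, ?_⟩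
    rw [eq_sub_iff_add_eq]
    refine Subtype.ext (app_eq_of_cells (Submodule.coe_mem _) z'.2 fun a ha => ?_)
    rw [hz', app_gL_fL n _ ha.1, hz0, map_zero]
    change app K s (dL n) (app K s (hL n) z) a + (z : ℕ → ZMod s → K) a = _
    rw [Pi.zero_apply, add_zero, add_comm]

theorem dL_gL_apply {n : ℕ} {w : ℕ → ZMod s → K} (hw : w ∈ supp K s (okY n) (qY n)) :
    app K s (dL n) (app K s (gL n) w) = app K s (gL (n + 1)) (app K s (pL n) w) :=
  app_eq_of_cells (n := n + 1) ((homog_dL n).app_mem ((homog_gL n).app_mem hw))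
    ((homog_gL (n + 1)).app_mem ((homog_pL n).app_mem hw)) fun _ ha =>
      app_dL_gL n w (okX_lt ha.1)

/-- A component of the projection to the reduced complex. -/
def projY (K : Type u) [Field K] (s n y : ℕ) : Coch K s n →ₗ[K] (ZMod s → K) :=
  LinearMap.proj y ∘ₗ app K s (fL n) ∘ₗ (Coch K s n).subtype

/-- A component of the inclusion of the reduced complex. -/
def inclY (K : Type u) [Field K] {s n y : ℕ} (hy : ActiveY s n y) :
    (ZMod s → K) →ₗ[K] Coch K s n :=
  (app K s (gL n) ∘ₗ LinearMap.single K _ y).codRestrict _ fun w =>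
    (homog_gL n).app_mem (single_mem_supp hy w)

theorem inclY_projY_mem (hs : 1 < s) {n y : ℕ} (hy : ActiveY s n y) {z : Coch K s n}
    (hz : cobdry K s n z = 0) : inclY K hy (projY K s n y z) - z ∈ bdry (cobdry K s) n := by
  refine gL_fL_mem hs hz ?_
  rw [app_fL_eq_single hs hy z.2]
  rfl

theorem projY_inclY {n y : ℕ} (hy : ActiveY s n y) (w : ZMod s → K) :
    projY K s n y (inclY K hy w) = w :=
  (app_fL_gL n _ (okY_lt hy.1) hy.1).trans (Pi.single_eq_same _ _)

theorem finrank_HH_source [NeZero s] (hs : 1 < s) {n : ℕ} (hy : ActiveY s n 0) :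
    Module.finrank K (HH K s n) =
      Module.finrank K (LinearMap.ker (polyOp K s (pPoly n))) := by
  refine (finrank_HH_eq (Z' := LinearMap.ker (polyOp K s (pPoly n))) (B' := ⊥) (projY K s n 0)
    (inclY K hy) ?_ ?_ ?_ ?_ ?_ ?_).trans (finrank_subquotient_bot _)
  · intro z hz
    have hz0 : app K s (dL n) z = 0 := congrArg Subtype.val hz
    change polyOp K s (pPoly n) (app K s (fL n) z 0) = 0
    rw [← app_pL_one, ← app_fL_dL n _ one_lt_two, hz0, map_zero]
    rfl
  · intro z hz
    rw [Submodule.mem_bot]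
    cases n with
    | zero => rw [(Submodule.mem_bot K).1 hz, map_zero]
    | succ n =>
      obtain ⟨x, rfl⟩ := hz
      exact (app_fL_dL n _ two_pos).trans (app_pL_of_ne _ _ zero_ne_one)
  · intro w hw
    refine Subtype.ext ((dL_gL_apply (single_mem_supp hy w)).trans ?_)
    have : app K s (pL n) (Pi.single 0 w) = 0 := by
      funext y
      by_cases h : y = 1
      · subst h
        rw [app_pL_one, Pi.single_eq_same]
        exact hw
      · exact app_pL_of_ne _ _ h
    rw [this, map_zero]
    rfl
  · intro w hw
    rw [(Submodule.mem_bot K).1 hw, map_zero]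
    exact Submodule.zero_mem _
  · exact fun z hz => inclY_projY_mem hs hy hz
  · intro w _
    rw [projY_inclY, sub_self]
    exact Submodule.zero_mem _

theorem finrank_HH_target [NeZero s] (hs : 1 < s) {n : ℕ} (hy : ActiveY s (n + 1) 1)
    (hy' : ActiveY s n 0) :
    Module.finrank K (HH K s (n + 1)) =
      Module.finrank K ((ZMod s → K) ⧸ LinearMap.range (polyOp K s (pPoly n))) := by
  refine (finrank_HH_eq (Z' := ⊤) (B' := LinearMap.range (polyOp K s (pPoly n)))
    (projY K s (n + 1) 1) (inclY K hy) (fun _ _ => trivial) ?_ ?_ ?_ ?_ ?_).trans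
    (finrank_subquotient_top _)
  · rintro _ ⟨x, rfl⟩
    exact ⟨app K s (fL n) x 0, ((app_fL_dL n _ one_lt_two).trans (app_pL_one _ _)).symm⟩
  · intro w _
    refine Subtype.ext ((dL_gL_apply (single_mem_supp hy w)).trans ?_)
    have : app K s (pL (n + 1)) (Pi.single 1 w) = 0 := by
      funext y
      by_cases h : y = 1
      · subst h
        rw [app_pL_one, Pi.single_eq_of_ne zero_ne_one, map_zero]
        rfl
      · exact app_pL_of_ne _ _ h
    rw [this, map_zero]
    rfl
  · rintro _ ⟨w, rfl⟩
    refine ⟨inclY K hy' w, Subtype.ext ((dL_gL_apply (single_mem_supp hy' w)).trans ?_)⟩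
    have : app K s (pL n) (Pi.single 0 w) = Pi.single 1 (polyOp K s (pPoly n) w) := by
      funext y
      by_cases h : y = 1
      · subst h
        rw [app_pL_one, Pi.single_eq_same, Pi.single_eq_same]
      · rw [app_pL_of_ne _ _ h, Pi.single_eq_of_ne h]
    rw [this]
    rfl
  · exact fun z hz => inclY_projY_mem hs hy hz
  · intro w _
    rw [projY_inclY, sub_self]
    exact Submodule.zero_mem _

theorem finrank_HH_none [NeZero s] (hs : 1 < s) {n : ℕ} (hy : ∀ y, ¬ ActiveY s n y) :
    Module.finrank K (HH K s n) = 0 := by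
  refine finrank_HH_eq_zero fun z hz => ?_
  have h0 : app K s (fL n) z = 0 := funext fun y => (homog_fL n).app_mem z.2 y (hy y)
  have := gL_fL_mem (z' := 0) hs hz (by rw [h0, map_zero]; rfl)
  rw [zero_sub] at this
  exact neg_mem_iff.1 this

end Reduction

section Dimensions

variable (K : Type u) [Field K] {s : ℕ}

/-- The value of the differential of the reduced complex on constant functions. -/
def pOne (n : ℕ) : ℤ := ((pPoly n).map fun t => t.2.2.2).sum

open scoped Classical in
/-- The dimension of the kernel of an integer acting on a field. -/
noncomputable def kerDim (c : ℤ) : ℕ := if (c : K) = 0 then 1 else 0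

variable {K}

theorem periodic_of_mem_ker {n : ℕ} (hn : okY n 0 = true) {w : ZMod s → K}
    (hw : polyOp K s (pPoly n) w = 0) (k : ZMod s) : w (k - ((rPoly n).1 : ℕ)) = w k := by
  have h := allBelow_iff.1 rPoly_small _ (Nat.mod_lt n (by norm_num))
  rw [okY_congr (Nat.mod_mod n 22), hn, rPoly_congr (Nat.mod_mod n 22),
    pPoly_congr (Nat.mod_mod n 22), Bool.not_true, Bool.false_or] at h
  have h1 := evalL_of_agree h (fun _ => w) k
  have h2 : app K s (comp (fun _ => (rPoly n).2) fun _ => pPoly n) (fun _ => w) 0 k = 0 := by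
    rw [app_comp]
    have : app K s (fun _ => pPoly n) (fun _ => w) = 0 := funext fun _ => hw
    rw [this, map_zero]
    rfl
  have h3 := h1.symm.trans h2
  simp only [evalL, List.map_cons, List.map_nil, List.sum_cons, List.sum_nil, one_smul,
    neg_smul, Nat.cast_zero, add_zero, sub_zero] at h3
  exact add_neg_eq_zero.1 h3

theorem isUnit_period {n : ℕ} (hy : ActiveY s n 0) : IsUnit (((rPoly n).1 : ℕ) : ZMod s) := by
  have h := allBelow_iff.1 coprime_small _ (Nat.mod_lt n (by norm_num))
  rw [okY_congr (Nat.mod_mod n 22), hy.1, rPoly_congr (Nat.mod_mod n 22), Bool.not_true,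
    Bool.false_or, Bool.and_eq_true] at h
  obtain ⟨e, he⟩ := Nat.dvd_of_mod_eq_zero (Nat.eq_of_beq_eq_true h.2)
  have hc : IsCoprime (((rPoly n).1 : ℕ) : ℤ) (qY (n % 22) 0) :=
    Int.isCoprime_iff_gcd_eq_one.2 (Nat.eq_of_beq_eq_true h.1)
  obtain ⟨a, b, hab⟩ := hc
  have e0 := qY_add n 0 0
  simp only [add_zero] at e0
  generalize n / 22 = N at e0
  have he' : (12 : ℤ) = ((rPoly n).1 : ℕ) * e := by exact_mod_cast he
  have h2 : ((a * ((rPoly n).1 : ℕ) + b * qY (n % 22) 0 : ℤ) : ZMod s) = 1 := by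
    rw [hab, Int.cast_one]
  rw [e0, he'] at h2
  push_cast at h2
  rw [hy.2] at h2
  refine IsUnit.of_mul_eq_one (a + b * e * (N : ZMod s)) ?_
  rw [← h2]
  ring

theorem eq_const_of_mem_ker [NeZero s] {n : ℕ} (hy : ActiveY s n 0) {w : ZMod s → K}
    (hw : polyOp K s (pPoly n) w = 0) (k : ZMod s) : w k = w 0 := by
  obtain ⟨x, hx⟩ := isUnit_period hy
  have key : ∀ (j : ℕ) (k : ZMod s), w (k - j * ((rPoly n).1 : ℕ)) = w k := by
    intro j
    induction j with
    | zero => simp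
    | succ j ih =>
      intro k
      rw [← ih k, ← periodic_of_mem_ker hy.1 hw (k - j * ((rPoly n).1 : ℕ))]
      congr 1
      push_cast
      ring
  have := key (k * (x⁻¹ : (ZMod s)ˣ)).val k
  rw [ZMod.natCast_zmod_val, ← hx, mul_assoc, Units.inv_mul, mul_one, sub_self] at this
  exact this.symm

theorem polyOp_const (n : ℕ) (c : K) :
    polyOp K s (pPoly n) (fun _ => c) = fun _ => (pOne n : K) * c := by
  funext k
  rw [polyOp_apply, pOne]
  induction pPoly n with
  | nil => simp [evalL_nil]
  | cons t L ih =>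
    rw [evalL_cons, ih, List.map_cons, List.sum_cons, Int.cast_add, add_mul, zsmul_eq_mul]

theorem finrank_ker_polyOp [NeZero s] {n : ℕ} (hy : ActiveY s n 0) :
    Module.finrank K (LinearMap.ker (polyOp K s (pPoly n))) = kerDim K (pOne n) := by
  let κ : K →ₗ[K] (ZMod s → K) := LinearMap.pi fun _ => LinearMap.id
  have hw : ∀ w, polyOp K s (pPoly n) w = 0 → w = fun _ => w 0 := fun w hw =>
    funext (eq_const_of_mem_ker hy hw)
  rw [kerDim]
  split_ifs with h
  · have : LinearMap.ker (polyOp K s (pPoly n)) = LinearMap.range κ := by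
      ext w
      constructor
      · exact fun hk => ⟨w 0, (hw w hk).symm⟩
      · rintro ⟨c, rfl⟩
        refine (polyOp_const n c).trans (funext fun _ => ?_)
        rw [h, zero_mul]
        rfl
    rw [this, LinearMap.finrank_range_of_inj fun a b hab => congrFun hab 0,
      Module.finrank_self]
  · have : LinearMap.ker (polyOp K s (pPoly n)) = ⊥ := by
      rw [LinearMap.ker_eq_bot']
      intro w hk
      have h0 := hw w hk
      rw [h0, polyOp_const] at hk
      have h1 := congrFun hk 0
      rw [h0, (mul_eq_zero.1 h1).resolve_left h]
      rfl
    rw [this, finrank_bot]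

theorem finrank_coker_polyOp [NeZero s] {n : ℕ} (hy : ActiveY s n 0) :
    Module.finrank K ((ZMod s → K) ⧸ LinearMap.range (polyOp K s (pPoly n))) =
      kerDim K (pOne n) := by
  have h1 := Submodule.finrank_quotient_add_finrank (LinearMap.range (polyOp K s (pPoly n)))
  have h2 := LinearMap.finrank_range_add_finrank_ker (polyOp K s (pPoly n))
  rw [← finrank_ker_polyOp hy]
  omega

theorem ActiveY.source {n : ℕ} (hy : ActiveY s (n + 1) 1) : ActiveY s n 0 := by
  have h := allBelow_iff.1 qY_target_small _ (Nat.mod_lt n (by norm_num))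
  rw [okY_congr (Nat.mod_mod n 22), okY_congr (mod_add_one_mod n), hy.1, Bool.not_true,
    Bool.false_or, Bool.and_eq_true, beq_iff_eq] at h
  have e0 := qY_add n 0 0
  have e1 := qY_add n 1 1
  simp only [add_zero] at e0 e1
  refine ⟨h.1, ?_⟩
  have : qY n 0 = qY (n + 1) 1 := by linarith [h.2]
  rw [this]
  exact hy.2

theorem activeY_zero : ActiveY s 0 0 := by
  have h := qY_zero_small
  rw [Bool.and_eq_true, beq_iff_eq] at h
  exact ⟨h.1, by rw [h.2, Int.cast_zero]⟩

open scoped Classical in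
theorem finrank_HH (K : Type u) [Field K] [NeZero s] (hs : 1 < s) (n : ℕ) :
    Module.finrank K (HH K s n) = if ActiveY s n 0 then kerDim K (pOne n) else
      if ActiveY s n 1 then kerDim K (pOne (n + 21)) else 0 := by
  split_ifs with h0 h1
  · rw [finrank_HH_source hs h0, finrank_ker_polyOp h0]
  · cases n with
    | zero => exact absurd activeY_zero h0
    | succ n =>
      rw [finrank_HH_target hs h1 h1.source, finrank_coker_polyOp h1.source, pOne, pOne,
        pPoly_congr (show n % 22 = (n + 1 + 21) % 22 by omega)]
  · refine finrank_HH_none hs fun y hy => ?_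
    have := okY_lt hy.1
    interval_cases y
    · exact h0 hy
    · exact h1 hy

end Dimensions

section Matching

/-- The dimensions of the Hochschild cohomology, in terms of truth values. -/
def hhBool (r l : ℕ) (c0 c1 p2 p3 : Bool) : ℕ :=
  if ((r == 0 || r == 6 || r == 7 || r == 8) && c0 && (l == 0)) ||
      ((r == 0 || r == 6) && c1 && (l == 0) && p3) ||
      ((r == 1 || r == 9) && c0) ||
      ((r == 2 || r == 4 || r == 10) && c1 && !(l == 0)) ||
      (r == 3 && c0 && (l == 0) && p2) ||
      (r == 3 && c0 && !(l == 0)) ||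
      ((r == 4 || r == 10) && c0 && !(l == 0) && p3) ||
      (r == 4 && c1 && (l == 0) && p2) ||
      (r == 5 && c0 && p3) ||
      ((r == 6 || r == 7) && c0 && !(l == 0) && p2) then 1
  else 0

theorem hhDim_eq (p s t : ℕ) : hhDim p s t = hhBool (t % 11) (t / 11 % 2)
    ((6 * (t / 11) + t % 11 / 2) % s == 0 % s) ((6 * (t / 11) + t % 11 / 2) % s == 1 % s)
    (p == 2) (p == 3) := rfl

/-- The number `6 ℓ + m` attached to a degree `11 ℓ + r`, where `m` is half of `r`. -/
def halfDeg (t : ℕ) : ℕ := 6 * (t / 11) + t % 11 / 2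

/-- The activity of a cell of the reduced complex, in terms of truth values. -/
def activeBool (t y : ℕ) (c0 c1 : Bool) : Bool :=
  okY t y && ((qY t y == -(halfDeg t : ℤ)) && c0 || (qY t y == 1 - (halfDeg t : ℤ)) && c1)

/-- The dimension of the kernel of a small integer acting on a field, in terms of truth values. -/
def kerDimBool (c : ℤ) (p2 p3 : Bool) : ℕ :=
  if (c.natAbs == 0) || (c.natAbs == 2 && p2) || (c.natAbs == 3 && p3) then 1 else 0

theorem pOne_small : (allBelow 22 fun n => (pOne n).natAbs.blt 4) = true := by
  decide +kernel

theorem qY_halfDeg_small : (allBelow 22 fun n => allBelow 2 fun y => !okY n y ||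
    (qY n y == -(halfDeg n : ℤ)) || (qY n y == 1 - (halfDeg n : ℤ))) = true := by
  decide +kernel

/-- The reduced complex and the formula give the same dimension in degree `n`. -/
def dimsAgree (n : ℕ) (c0 c1 p2 p3 : Bool) : Bool :=
  (c0 && c1) || (p2 && p3) || Nat.beq
    (if activeBool n 0 c0 c1 then kerDimBool (pOne n) p2 p3 else
      if activeBool n 1 c0 c1 then kerDimBool (pOne (n + 21)) p2 p3 else 0)
    (hhBool (n % 11) (n / 11 % 2) c0 c1 p2 p3)

theorem dimsAgree_small : (allBelow 22 fun n => [true, false].all fun c0 =>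
    [true, false].all fun c1 => [true, false].all fun p2 => [true, false].all fun p3 =>
      dimsAgree n c0 c1 p2 p3) = true := by
  decide +kernel

theorem pOne_congr {n m : ℕ} (h : n % 22 = m % 22) : pOne n = pOne m := by
  rw [pOne, pOne, pPoly_congr h]

theorem halfDeg_mod (t : ℕ) : halfDeg t = halfDeg (t % 22) + 12 * (t / 22) := by
  rw [halfDeg, halfDeg]
  omega

theorem natCast_eq_zero_iff_beq {s x : ℕ} : (x : ZMod s) = 0 ↔ (x % s == 0 % s) = true := by
  rw [beq_iff_eq, ← Nat.cast_zero, ZMod.natCast_eq_natCast_iff]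
  rfl

theorem natCast_eq_one_iff_beq {s x : ℕ} : (x : ZMod s) = 1 ↔ (x % s == 1 % s) = true := by
  rw [beq_iff_eq, ← Nat.cast_one, ZMod.natCast_eq_natCast_iff]
  rfl

theorem activeY_iff {s t y : ℕ} : ActiveY s t y ↔
    activeBool (t % 22) y (halfDeg t % s == 0 % s) (halfDeg t % s == 1 % s) = true := by
  have hq := qY_add t y 0
  simp only [add_zero] at hq
  have hd := halfDeg_mod t
  rw [ActiveY, Active, activeBool, okY_congr (Nat.mod_mod t 22), Bool.and_eq_true,
    Bool.or_eq_true, Bool.and_eq_true, Bool.and_eq_true, ← natCast_eq_zero_iff_beq,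
    ← natCast_eq_one_iff_beq, beq_iff_eq, beq_iff_eq]
  refine and_congr_right fun hok => ?_
  have h := allBelow_iff.1 (allBelow_iff.1 qY_halfDeg_small _ (Nat.mod_lt t (by norm_num))) y
    (okY_lt hok)
  rw [okY_congr (Nat.mod_mod t 22), hok, Bool.not_true, Bool.false_or, Bool.or_eq_true,
    beq_iff_eq, beq_iff_eq] at h
  rcases h with h | h
  · have h1 : qY t y = -(halfDeg t : ℤ) := by
      rw [hd]
      push_cast
      push_cast at hq
      linarith
    have h2 : qY (t % 22) y ≠ 1 - (halfDeg (t % 22) : ℤ) := by omega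
    simp only [h, h1, true_and, Int.cast_neg, Int.cast_natCast, neg_eq_zero]
    exact ⟨Or.inl, fun h' => h'.resolve_right fun h'' => h2 (h.trans h''.1)⟩
  · have h1 : qY t y = 1 - (halfDeg t : ℤ) := by
      rw [hd]
      push_cast
      push_cast at hq
      linarith
    have h2 : qY (t % 22) y ≠ -(halfDeg (t % 22) : ℤ) := by omega
    simp only [h, h1, true_and, Int.cast_sub, Int.cast_one, Int.cast_natCast, sub_eq_zero]
    exact ⟨fun h' => Or.inr h'.symm, fun h' =>
      (h'.resolve_left fun h'' => h2 (h.trans h''.1)).symm⟩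

theorem kerDim_eq (K : Type u) [Field K] {c : ℤ} (hc : c.natAbs < 4) :
    kerDim K c = kerDimBool c (ringChar K == 2) (ringChar K == 3) := by
  have h0 : (c : K) = 0 ↔ ringChar K ∣ c.natAbs := by
    rw [← ringChar.spec K c.natAbs]
    rcases Int.natAbs_eq c with h | h
    · conv_lhs => rw [h, Int.cast_natCast]
    · conv_lhs => rw [h, Int.cast_neg, Int.cast_natCast, neg_eq_zero]
  have h1 : ringChar K ≠ 1 := CharP.ringChar_ne_one
  rw [kerDim, kerDimBool]
  simp only [h0]
  congr 1
  simp only [Bool.or_eq_true, Bool.and_eq_true, beq_iff_eq, eq_iff_iff]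
  generalize c.natAbs = d at *
  generalize ringChar K = p at *
  interval_cases d
  · simp
  · simp [h1]
  · simp [Nat.dvd_prime Nat.prime_two, h1]
  · simp [Nat.dvd_prime Nat.prime_three, h1]

theorem finrank_HH_eq_hhDim (K : Type u) [Field K] {s : ℕ} (hs : 1 < s) (t : ℕ) :
    Module.finrank K (HH K s t) = hhDim (ringChar K) s t := by
  have : NeZero s := ⟨by omega⟩
  have hp := fun n : ℕ => allBelow_iff.1 pOne_small _ (Nat.mod_lt n (by norm_num))
  simp only [Nat.blt_eq] at hp
  have e0 : pOne t = pOne (t % 22) := pOne_congr (by omega)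
  have e1 : pOne (t + 21) = pOne (t % 22 + 21) := pOne_congr (by omega)
  have h0 := hp t
  have h1 : (pOne (t % 22 + 21)).natAbs < 4 := by
    rw [pOne_congr (show (t % 22 + 21) % 22 = (t + 21) % 22 % 22 by omega)]
    exact hp (t + 21)
  rw [finrank_HH K hs t, hhDim_eq, e0, e1, kerDim_eq K h0, kerDim_eq K h1]
  simp only [activeY_iff]
  have h := allBelow_iff.1 dimsAgree_small _ (Nat.mod_lt t (by norm_num))
  simp only [List.all_eq_true] at h
  have hmem : ∀ b : Bool, b ∈ [true, false] := by decide
  have h := h (halfDeg t % s == 0 % s) (hmem _) (halfDeg t % s == 1 % s) (hmem _)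
    (ringChar K == 2) (hmem _) (ringChar K == 3) (hmem _)
  have c01 : ((halfDeg t % s == 0 % s) && (halfDeg t % s == 1 % s)) = false := by
    rw [Bool.eq_false_iff, Ne, Bool.and_eq_true, beq_iff_eq, beq_iff_eq, Nat.zero_mod,
      Nat.mod_eq_of_lt hs]
    omega
  have p23 : ((ringChar K == 2) && (ringChar K == 3)) = false := by
    rw [Bool.eq_false_iff, Ne, Bool.and_eq_true, beq_iff_eq, beq_iff_eq]
    omega
  rw [dimsAgree, c01, p23, Bool.false_or, Bool.false_or] at h
  have h := Nat.eq_of_beq_eq_true h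
  have r1 : t % 22 % 11 = t % 11 := by omega
  have r2 : t % 22 / 11 % 2 = t / 11 % 2 := by omega
  rw [r1, r2] at h
  exact h

end Matching

/-- The additive structure of `HH^*(R_s)` for `s > 1` :
`dim_K HH^t(R_s) = 1` exactly in the listed cases, and `0` otherwise. -/
theorem hochschild_dims (K : Type u) [Field K] (s : ℕ) (hs : 1 < s) (t : ℕ) :
    Module.finrank K ↥(HH K s t) = hhDim (ringChar K) s t :=
  finrank_HH_eq_hhDim K hs t

end E6
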